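/- For every K > 0 and for λ²-almost every (ξ, x) ∈ [0,1)², with I_N(x) = [⌊2^N x⌋ 2^{-N}, (⌊2^N x⌋ + 1) 2^{-N}) the dyadic interval of length 2^{-N} containing x, we have liminf_{N→∞} [log λ({v ∈ I_N(x) : |W(v) − W(x) − ∫_x^v S(ξ, t) dt| ≤ K·2^{-N}}) / log 2^{-N}] ≥ 2, where λ is Lebesgue measure on ℝ. -/

import Mathlib

open Real MeasureTheory Set Filter

noncomputable section

/-- The Euclidean plane. -/
abbrev E2 : Type := EuclideanSpace ℝ (Fin 2)

/-- The unit vector `(cos t, sin t)` in the Euclidean plane. -/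
def cs (t : ℝ) : E2 := (WithLp.equiv 2 (Fin 2 → ℝ)).symm ![Real.cos t, Real.sin t]

/-- The vector `(-sin t, cos t)` in the Euclidean plane. -/
def cs' (t : ℝ) : E2 := (WithLp.equiv 2 (Fin 2 → ℝ)).symm ![-Real.sin t, Real.cos t]

/-- The two-dimensional Weierstrass function
`W(x) = ∑_{n≥0} 2^{-n/2} (cos (2π 2^n x), sin (2π 2^n x))`. -/
def Wfn (x : ℝ) : E2 := ∑' n : ℕ, (2 : ℝ) ^ (-(n : ℝ) / 2) • cs (2 * π * 2 ^ n * x)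

/-- `dig j ξ` is the `j`-th binary digit of `ξ`: `⌊2^j ξ⌋ mod 2` (as a real number). -/
def dig (j : ℕ) (ξ : ℝ) : ℝ := ((⌊(2 : ℝ) ^ j * ξ⌋ % 2 : ℤ) : ℝ)

/-- `rho n ξ = ∑_{i=1}^n d_{n+1-i}(ξ) 2^{-i}`. -/
def rho (n : ℕ) (ξ : ℝ) : ℝ := ∑ i ∈ Finset.Icc 1 n, dig (n + 1 - i) ξ / 2 ^ i

/-- `x` is a dyadic rational. -/
def dyadic (x : ℝ) : Prop := ∃ (k : ℕ) (m : ℤ), x = (m : ℝ) / 2 ^ k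

/-- The stable-direction function
`S(ξ,x) = -2π ∑_{n≥1} 2^{-n/2} (-sin (2π(ρ_n(ξ)+x/2^n)), cos (2π(ρ_n(ξ)+x/2^n)))`. -/
def Sfn (ξ x : ℝ) : E2 :=
  (-(2 * π)) • ∑' n : ℕ,
    (2 : ℝ) ^ (-((n : ℝ) + 1) / 2) • cs' (2 * π * (rho (n + 1) ξ + x / 2 ^ (n + 1)))

/-- The function `H` given by the doubly infinite series
`H(ξ,x) = ∑_{n≥0} 2^{-n/2} ((cos,sin)(2π 2^n x) - (1,0))
        + ∑_{k≥1} 2^{k/2} ((cos,sin)(2π(ρ_k(ξ)+x/2^k)) - (cos,sin)(2π ρ_k(ξ)))`. -/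
def Hfn (ξ x : ℝ) : E2 :=
  (∑' n : ℕ, (2 : ℝ) ^ (-(n : ℝ) / 2) •
      (cs (2 * π * 2 ^ n * x) - (WithLp.equiv 2 (Fin 2 → ℝ)).symm ![1, 0]))
  + ∑' k : ℕ, (2 : ℝ) ^ (((k : ℝ) + 1) / 2) •
      (cs (2 * π * (rho (k + 1) ξ + x / 2 ^ (k + 1))) - cs (2 * π * rho (k + 1) ξ))

/-- The baker transformation `B(ξ,x) = (2ξ mod 1, (⌊2ξ⌋ + x)/2)`. -/
def baker (p : ℝ × ℝ) : ℝ × ℝ :=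
  (Int.fract (2 * p.1), ((⌊2 * p.1⌋ : ℝ) + p.2) / 2)

/-- The unit square `[0,1)²`. -/
def usq : Set (ℝ × ℝ) := Ico (0:ℝ) 1 ×ˢ Ico (0:ℝ) 1

/-- The explicit formula for the `N`-th backward iterate of the baker transformation:
`B^{-N}(ξ,x) = (ξ/2^N + ∑_{j=1}^N d_j(x) 2^{-(N+1-j)}, 2^N x mod 1)`. -/
def bakerInvN (N : ℕ) (p : ℝ × ℝ) : ℝ × ℝ :=
  (p.1 / 2 ^ N + ∑ j ∈ Finset.Icc 1 N, dig j p.2 / 2 ^ (N + 1 - j),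
    Int.fract ((2 : ℝ) ^ N * p.2))

open scoped ENNReal

/-- The ratio `2^{-1/2}`. -/
def rr : ℝ := (√2)⁻¹

/-- The unit-speed character `x ↦ exp (2π i x)`. -/
def ee (x : ℝ) : ℂ := Complex.exp ((2 * π * x : ℝ) * Complex.I)

/-- The Weierstrass function as a map to `ℂ`. -/
def wf (x : ℝ) : ℂ := ∑' n : ℕ, (rr ^ n : ℝ) • ee (2 ^ n * x)

/-- The finite sum governing the increments of `wf` at large scales. -/
def Tf (M : ℕ) (x : ℝ) : ℂ := ∑ k ∈ Finset.range M, ((√2) ^ (k + 1) : ℝ) • ee (x / 2 ^ (k + 1))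

/-- The derivative of `Tf M`, up to the factor `2π i`. -/
def Sf (M : ℕ) (x : ℝ) : ℂ := ∑ k ∈ Finset.range M, (rr ^ (k + 1) : ℝ) • ee (x / 2 ^ (k + 1))

lemma rr_pos : 0 < rr := by unfold rr; positivity

lemma rr_sq : rr ^ 2 = 1 / 2 := by
  unfold rr; rw [inv_pow, Real.sq_sqrt (by norm_num)]; norm_num

lemma rr_le : rr ≤ 0.7072 := by
  have := rr_sq; have := rr_pos; nlinarith

lemma le_rr : 0.7071 ≤ rr := by
  have := rr_sq; have := rr_pos; nlinarith

lemma rr_lt_one : rr < 1 := by have := rr_le; linarith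

lemma rr_mul_sqrt : rr * √2 = 1 := by
  unfold rr; rw [inv_mul_cancel₀]; positivity

lemma sqrt_two_pow_eq (k : ℕ) : (√2) ^ k = 2 ^ k * rr ^ k := by
  rw [← mul_pow]; congr 1
  have h := Real.mul_self_sqrt (show (0:ℝ) ≤ 2 by norm_num)
  have := rr_mul_sqrt
  calc √2 = √2 * (rr * √2) := by rw [this, mul_one]
    _ = 2 * rr := by rw [mul_comm rr, ← mul_assoc, h]

lemma norm_ee (x : ℝ) : ‖ee x‖ = 1 := by
  unfold ee; exact Complex.norm_exp_ofReal_mul_I _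

lemma ee_add (x y : ℝ) : ee (x + y) = ee x * ee y := by
  unfold ee; rw [← Complex.exp_add]; congr 1; push_cast; ring

lemma ee_int (n : ℤ) : ee n = 1 := by
  unfold ee
  rw [Complex.exp_eq_one_iff]; exact ⟨n, by push_cast; ring⟩

lemma ee_half : ee (1 / 2) = -1 := by
  unfold ee
  rw [← Complex.exp_pi_mul_I]; congr 1; push_cast; ring

lemma ee_add_int (x : ℝ) (n : ℤ) : ee (x + n) = ee x := by
  rw [ee_add, ee_int, mul_one]

lemma hasDerivAt_ee (x : ℝ) : HasDerivAt ee (2 * π * Complex.I * ee x) x := by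
  have h : HasDerivAt (fun x : ℝ => ((2 * π * x : ℝ) : ℂ) * Complex.I) (2 * π * Complex.I) x := by
    have h1 : HasDerivAt (fun x : ℝ => 2 * π * x) (2 * π) x := by
      simpa using (hasDerivAt_id x).const_mul (2 * π)
    simpa using h1.ofReal_comp.mul_const Complex.I
  have := h.cexp
  unfold ee
  convert this using 1
  ring

lemma continuous_ee : Continuous ee := by
  unfold ee; fun_prop

lemma norm_ee_sub_le (x y : ℝ) : ‖ee x - ee y‖ ≤ 2 * π * |x - y| := by
  have h : ee x - ee y = ee y * (Complex.exp (Complex.I * ((2 * π * (x - y) : ℝ) : ℂ)) - 1) := by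
    have : ee x = ee y * ee (x - y) := by rw [← ee_add]; congr 1; ring
    rw [this, mul_sub, mul_one]; congr 2
    unfold ee; rw [mul_comm Complex.I]
  rw [h, norm_mul, norm_ee, one_mul]
  refine (Real.norm_exp_I_mul_ofReal_sub_one_le).trans ?_
  rw [Real.norm_eq_abs, abs_mul, abs_of_pos (by positivity)]

lemma norm_ee_sub_sub_le (x y : ℝ) :
    ‖ee x - ee y - (x - y : ℝ) * (2 * π * Complex.I * ee y)‖ ≤ 4 * π ^ 2 * |x - y| ^ 2 := by
  have key : ∀ t ∈ segment ℝ y x, ‖(2 * π * Complex.I * ee t) - (2 * π * Complex.I * ee y)‖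
      ≤ 4 * π ^ 2 * |x - y| := by
    intro t ht
    rw [← mul_sub, norm_mul]
    have h1 : ‖(2 * π * Complex.I : ℂ)‖ = 2 * π := by
      simp [abs_of_pos Real.pi_pos]
    have h2 : |t - y| ≤ |x - y| := by
      have := norm_sub_le_of_mem_segment ht
      simpa [Real.norm_eq_abs, abs_sub_comm] using this
    rw [h1]
    calc 2 * π * ‖ee t - ee y‖ ≤ 2 * π * (2 * π * |t - y|) := by
          gcongr; exact norm_ee_sub_le _ _
      _ ≤ 2 * π * (2 * π * |x - y|) := by gcongr
      _ = _ := by ring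
  have := (convex_segment y x).norm_image_sub_le_of_norm_hasDerivWithin_le
    (f := fun t => ee t - (t : ℂ) * (2 * π * Complex.I * ee y))
    (f' := fun t => (2 * π * Complex.I * ee t) - (2 * π * Complex.I * ee y))
    (fun t ht => ((hasDerivAt_ee t).sub
      (by simpa using (Complex.ofRealCLM.hasDerivAt (x := t)).mul_const
            (2 * π * Complex.I * ee y))).hasDerivWithinAt)
    key (left_mem_segment ℝ y x) (right_mem_segment ℝ y x)
  calc _ = ‖ee x - (x : ℂ) * (2 * π * Complex.I * ee y) - (ee y - (y : ℂ) * (2 * π * Complex.I * ee y))‖ := by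
        congr 1; push_cast; ring
    _ ≤ _ := this
    _ = _ := by rw [Real.norm_eq_abs]; ring

lemma summable_rr_pow : Summable (fun n : ℕ => rr ^ n) :=
  summable_geometric_of_lt_one rr_pos.le rr_lt_one

lemma norm_wf_term (n : ℕ) (x : ℝ) : ‖(rr ^ n : ℝ) • ee x‖ = rr ^ n := by
  rw [norm_smul, norm_ee, mul_one, Real.norm_of_nonneg (pow_nonneg rr_pos.le _)]

lemma summable_wf (x : ℝ) : Summable (fun n : ℕ => (rr ^ n : ℝ) • ee (2 ^ n * x)) :=
  Summable.of_norm (by simpa only [norm_wf_term] using summable_rr_pow)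

lemma continuous_wf : Continuous wf := by
  unfold wf
  refine continuous_tsum (fun n => ?_) summable_rr_pow (fun n x => (norm_wf_term n _).le)
  have h : Continuous fun x : ℝ => ee (2 ^ n * x) :=
    continuous_ee.comp (continuous_const.mul continuous_id)
  exact h.const_smul (rr ^ n)

lemma tsum_rr_pow_le : ∑' n : ℕ, rr ^ n ≤ 4 := by
  rw [tsum_geometric_of_lt_one rr_pos.le rr_lt_one, inv_le_comm₀ (by linarith [rr_lt_one]) (by norm_num)]
  have := rr_le; linarith

lemma norm_wf_le (x : ℝ) : ‖wf x‖ ≤ 4 := by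
  refine (norm_tsum_le_tsum_norm ?_).trans ?_
  · simpa only [norm_wf_term] using summable_rr_pow
  · simpa only [norm_wf_term] using tsum_rr_pow_le

lemma wf_add_int (x : ℝ) (k : ℤ) : wf (x + k) = wf x := by
  unfold wf
  congr 1; ext1 n; congr 1
  have : (2:ℝ) ^ n * (x + k) = 2 ^ n * x + ((2 ^ n * k : ℤ) : ℝ) := by push_cast; ring
  rw [this, ee_add_int]

lemma sqrt_two_pow_mul_wf (M : ℕ) (y : ℝ) :
    ((√2) ^ M : ℝ) • wf y = Tf M (2 ^ M * y) + wf (2 ^ M * y) := by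
  have h := (summable_wf y).sum_add_tsum_nat_add M
  unfold wf Tf
  rw [← h, smul_add, Finset.smul_sum, ← Finset.sum_range_reflect]
  have hr : ∀ j, √2 ^ j * rr ^ j = 1 := fun j => by
    rw [← mul_pow, mul_comm, rr_mul_sqrt, one_pow]
  congr 1
  · refine Finset.sum_congr rfl fun j hj => ?_
    have hj' := Finset.mem_range.1 hj
    obtain ⟨i, rfl⟩ : ∃ i, M = i + (j + 1) := ⟨M - (j + 1), by omega⟩
    have e : i + (j + 1) - 1 - j = i := by omega
    have e1 : √2 ^ (i + (j + 1)) * rr ^ i = √2 ^ (j + 1) := by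
      rw [pow_add, mul_right_comm, hr, one_mul]
    have e2 : (2:ℝ) ^ (i + (j + 1)) * y / 2 ^ (j + 1) = 2 ^ i * y := by
      rw [pow_add]; field_simp
    rw [e, smul_smul, e1, e2]
  · rw [← ((summable_nat_add_iff M).2 (summable_wf y)).tsum_const_smul]
    refine tsum_congr fun n => ?_
    have e1 : √2 ^ M * rr ^ (n + M) = rr ^ n := by
      rw [pow_add, mul_comm, mul_assoc, mul_comm (rr ^ M), hr, mul_one]
    have e2 : (2:ℝ) ^ (n + M) * y = 2 ^ n * (2 ^ M * y) := by rw [pow_add]; ring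
    rw [smul_smul, e1, e2]

lemma sum_rr_pow_le (M : ℕ) : ∑ k ∈ Finset.range M, rr ^ (k + 1) ≤ 2.5 := by
  have h : ∑ k ∈ Finset.range M, rr ^ k ≤ ∑' n : ℕ, rr ^ n :=
    summable_rr_pow.sum_le_tsum _ (fun _ _ => pow_nonneg rr_pos.le _)
  rw [tsum_geometric_of_lt_one rr_pos.le rr_lt_one] at h
  have h2 : (1 - rr)⁻¹ ≤ 3.45 := by
    rw [inv_le_comm₀ (by linarith [rr_lt_one]) (by norm_num)]
    have := rr_le; norm_num; linarith
  simp_rw [pow_succ, ← Finset.sum_mul]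
  have := rr_le; have := rr_pos
  nlinarith

lemma norm_Tf_sub_le (M : ℕ) (x y : ℝ) : ‖Tf M x - Tf M y‖ ≤ 16 * |x - y| := by
  unfold Tf
  rw [← Finset.sum_sub_distrib]
  refine (norm_sum_le _ _).trans ?_
  have : ∀ k ∈ Finset.range M, ‖(√2 ^ (k + 1) : ℝ) • ee (x / 2 ^ (k + 1)) -
      (√2 ^ (k + 1) : ℝ) • ee (y / 2 ^ (k + 1))‖ ≤ rr ^ (k + 1) * (2 * π * |x - y|) := by
    intro k _
    rw [← smul_sub, norm_smul, Real.norm_of_nonneg (by positivity), sqrt_two_pow_eq]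
    have h := norm_ee_sub_le (x / 2 ^ (k + 1)) (y / 2 ^ (k + 1))
    rw [← sub_div, abs_div, abs_of_pos (show (0:ℝ) < 2 ^ (k + 1) by positivity)] at h
    calc _ ≤ 2 ^ (k + 1) * rr ^ (k + 1) * (2 * π * (|x - y| / 2 ^ (k + 1))) := by
          have := rr_pos; gcongr
      _ = _ := by field_simp
  refine (Finset.sum_le_sum this).trans ?_
  rw [← Finset.sum_mul, ← mul_assoc]
  gcongr
  have := sum_rr_pow_le M
  have h3 := Real.pi_lt_d2; have := Real.pi_pos
  nlinarith

lemma norm_Tf_sub_sub_le (M : ℕ) (x y : ℝ) :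
    ‖Tf M x - Tf M y - (x - y : ℝ) * (2 * π * Complex.I * Sf M y)‖ ≤ 100 * |x - y| ^ 2 := by
  unfold Tf Sf
  rw [← Finset.sum_sub_distrib, Finset.mul_sum, Finset.mul_sum, ← Finset.sum_sub_distrib]
  refine (norm_sum_le _ _).trans ?_
  have : ∀ k ∈ Finset.range M, ‖(√2 ^ (k + 1) : ℝ) • ee (x / 2 ^ (k + 1)) -
      (√2 ^ (k + 1) : ℝ) • ee (y / 2 ^ (k + 1)) - (x - y : ℝ) * (2 * π * Complex.I *
        ((rr ^ (k + 1) : ℝ) • ee (y / 2 ^ (k + 1))))‖ ≤ rr ^ (k + 1) * (4 * π ^ 2 * |x - y| ^ 2) := by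
    intro k _
    have h := norm_ee_sub_sub_le (x / 2 ^ (k + 1)) (y / 2 ^ (k + 1))
    rw [← sub_div, abs_div, abs_of_pos (show (0:ℝ) < 2 ^ (k + 1) by positivity)] at h
    have e : (√2 ^ (k + 1) : ℝ) • ee (x / 2 ^ (k + 1)) -
      (√2 ^ (k + 1) : ℝ) • ee (y / 2 ^ (k + 1)) - (x - y : ℝ) * (2 * π * Complex.I *
        ((rr ^ (k + 1) : ℝ) • ee (y / 2 ^ (k + 1)))) = (√2 ^ (k + 1) : ℝ) •
        (ee (x / 2 ^ (k + 1)) - ee (y / 2 ^ (k + 1)) -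
          ((x - y) / 2 ^ (k + 1) : ℝ) * (2 * π * Complex.I * ee (y / 2 ^ (k + 1)))) := by
      rw [smul_sub, smul_sub, sqrt_two_pow_eq]
      simp only [Complex.real_smul]
      push_cast
      field_simp
    rw [e, norm_smul, Real.norm_of_nonneg (by positivity), sqrt_two_pow_eq]
    calc _ ≤ 2 ^ (k + 1) * rr ^ (k + 1) * (4 * π ^ 2 * (|x - y| / 2 ^ (k + 1)) ^ 2) := by
          have := rr_pos; gcongr
      _ = rr ^ (k + 1) * (4 * π ^ 2 * |x - y| ^ 2) / 2 ^ (k + 1) := by field_simp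
      _ ≤ _ := div_le_self (by have := rr_pos; positivity) (one_le_pow₀ (by norm_num))
  refine (Finset.sum_le_sum this).trans ?_
  rw [← Finset.sum_mul, ← mul_assoc]
  gcongr
  have := sum_rr_pow_le M
  have h3 := Real.pi_lt_d2; have := Real.pi_pos
  nlinarith

/-- The unit complex number with argument `t`. -/
def cis (t : ℝ) : ℂ := Complex.exp (t * Complex.I)

lemma norm_cis (t : ℝ) : ‖cis t‖ = 1 := Complex.norm_exp_ofReal_mul_I _

lemma continuous_cis : Continuous cis := by unfold cis; fun_prop

lemma cis_add (s t : ℝ) : cis (s + t) = cis s * cis t := by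
  unfold cis; rw [← Complex.exp_add]; congr 1; push_cast; ring

lemma conj_cis (t : ℝ) : (starRingEnd ℂ) (cis t) = cis (-t) := by
  unfold cis; rw [← Complex.exp_conj]; simp

lemma norm_cis_sub_le (x y : ℝ) : ‖cis x - cis y‖ ≤ |x - y| := by
  have h : cis x - cis y = cis y * (Complex.exp (Complex.I * ((x - y : ℝ) : ℂ)) - 1) := by
    have : cis x = cis y * cis (x - y) := by rw [← cis_add]; congr 1; ring
    rw [this, mul_sub, mul_one]; congr 2
    unfold cis; rw [mul_comm Complex.I]
  rw [h, norm_mul, norm_cis, one_mul]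
  exact Real.norm_exp_I_mul_ofReal_sub_one_le

lemma norm_integral_cis_le {φ : ℝ → ℝ} {a b : ℝ} (hab : a ≤ b) :
    ‖∫ y in a..b, cis (φ y)‖ ≤ b - a := by
  have := intervalIntegral.norm_integral_le_of_norm_le_const (a := a) (b := b) (C := 1)
    (f := fun y => cis (φ y)) (fun y _ => (norm_cis _).le)
  rwa [one_mul, abs_of_nonneg (by linarith)] at this

/-- First derivative van der Corput estimate. -/
lemma norm_integral_cis_le_of_deriv {φ φ1 φ2 : ℝ → ℝ} (h1 : ∀ y, HasDerivAt φ (φ1 y) y)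
    (h2 : ∀ y, HasDerivAt φ1 (φ2 y) y) (hc : Continuous φ2) {a b l L : ℝ} (hab : a ≤ b)
    (hl : 0 < l) (hφ1 : ∀ y ∈ Icc a b, l ≤ |φ1 y|) (hφ2 : ∀ y ∈ Icc a b, |φ2 y| ≤ L) :
    ‖∫ y in a..b, cis (φ y)‖ ≤ 2 / l + (b - a) * L / l ^ 2 := by
  have hne : ∀ y ∈ uIcc a b, φ1 y ≠ 0 := fun y hy => by
    rw [uIcc_of_le hab] at hy
    exact abs_pos.1 (hl.trans_le (hφ1 y hy))
  have c1 : Continuous φ1 := continuous_iff_continuousAt.2 fun y => (h2 y).continuousAt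
  have c0 : Continuous φ := continuous_iff_continuousAt.2 fun y => (h1 y).continuousAt
  have hu : ∀ y ∈ uIcc a b, HasDerivAt (fun y => (((φ1 y)⁻¹ : ℝ) : ℂ))
      ((-(φ2 y) / (φ1 y) ^ 2 : ℝ) : ℂ) y := fun y hy => ((h2 y).inv (hne y hy)).ofReal_comp
  have hv : ∀ y ∈ uIcc a b, HasDerivAt (fun y => -Complex.I * cis (φ y))
      (φ1 y * cis (φ y)) y := fun y _ => by
    have := (((h1 y).ofReal_comp.mul_const Complex.I).cexp).const_mul (-Complex.I)
    refine this.congr_deriv ?_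
    unfold cis
    linear_combination (-(φ1 y : ℂ) * Complex.exp (φ y * Complex.I)) * Complex.I_mul_I
  have hcc : Continuous fun y => cis (φ y) := continuous_cis.comp c0
  have hu' : ContinuousOn (fun y => ((-(φ2 y) / (φ1 y) ^ 2 : ℝ) : ℂ)) (uIcc a b) := by
    refine Complex.continuous_ofReal.comp_continuousOn ?_
    exact hc.neg.continuousOn.div (c1.pow 2).continuousOn (fun y hy => pow_ne_zero _ (hne y hy))
  have parts := intervalIntegral.integral_mul_deriv_eq_deriv_mul hu hv hu'.intervalIntegrable
    (Continuous.intervalIntegrable (by fun_prop) _ _)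
  have e : ∫ y in a..b, cis (φ y) = ∫ y in a..b, (((φ1 y)⁻¹ : ℝ) : ℂ) * (φ1 y * cis (φ y)) := by
    refine intervalIntegral.integral_congr fun y hy => ?_
    have : (φ1 y : ℂ) ≠ 0 := by exact_mod_cast hne y hy
    rw [← mul_assoc, Complex.ofReal_inv, inv_mul_cancel₀ this, one_mul]
  rw [e, parts]
  have bd : ∀ y ∈ Icc a b, ‖(((φ1 y)⁻¹ : ℝ) : ℂ) * (-Complex.I * cis (φ y))‖ ≤ 1 / l := by
    intro y hy
    rw [norm_mul, norm_mul, norm_cis, norm_neg, Complex.norm_I, mul_one, mul_one,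
      Complex.norm_real, Real.norm_eq_abs, abs_inv, one_div]
    exact inv_anti₀ hl (hφ1 y hy)
  have bi : ‖∫ y in a..b, ((-(φ2 y) / (φ1 y) ^ 2 : ℝ) : ℂ) * (-Complex.I * cis (φ y))‖
      ≤ L / l ^ 2 * |b - a| := by
    refine intervalIntegral.norm_integral_le_of_norm_le_const fun y hy => ?_
    have hy : y ∈ Icc a b := by
      rw [uIoc_of_le hab] at hy; exact Ioc_subset_Icc_self hy
    rw [norm_mul, norm_mul, norm_cis, norm_neg, Complex.norm_I, mul_one, mul_one,
      Complex.norm_real, Real.norm_eq_abs, abs_div, abs_neg, abs_pow]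
    have := hφ1 y hy
    have h0 := hφ2 y hy
    have : 0 ≤ L := (abs_nonneg _).trans h0
    gcongr
  rw [abs_of_nonneg (by linarith)] at bi
  have hb := bd b (right_mem_Icc.2 hab)
  have ha := bd a (left_mem_Icc.2 hab)
  refine (norm_sub_le _ _).trans ?_
  refine (add_le_add (norm_sub_le _ _) bi).trans ?_
  calc _ ≤ 1 / l + 1 / l + L / l ^ 2 * (b - a) := by gcongr
    _ = _ := by ring

/-- Second derivative van der Corput estimate. -/
lemma norm_integral_cis_le_of_deriv2 {φ φ1 φ2 : ℝ → ℝ} (h1 : ∀ y, HasDerivAt φ (φ1 y) y)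
    (h2 : ∀ y, HasDerivAt φ1 (φ2 y) y) (hc : Continuous φ2) {a b l L d : ℝ} (hab : a ≤ b)
    (hl : 0 < l) (hd : 0 < d) (hφ2 : ∀ y ∈ Icc a b, l ≤ φ2 y) (hφ2' : ∀ y ∈ Icc a b, |φ2 y| ≤ L) :
    ‖∫ y in a..b, cis (φ y)‖ ≤ 2 * d + 2 * (2 / (l * d) + (b - a) * L / (l * d) ^ 2) := by
  have c1 : Continuous φ1 := continuous_iff_continuousAt.2 fun y => (h2 y).continuousAt
  have c0 : Continuous φ := continuous_iff_continuousAt.2 fun y => (h1 y).continuousAt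
  have hcc : Continuous fun y => cis (φ y) := continuous_cis.comp c0
  have slope : ∀ x ∈ Icc a b, ∀ y ∈ Icc a b, x ≤ y → l * (y - x) ≤ φ1 y - φ1 x := by
    refine (convex_Icc a b).mul_sub_le_image_sub_of_le_deriv c1.continuousOn
      (fun y _ => (h2 y).differentiableAt.differentiableWithinAt) fun y hy => ?_
    rw [(h2 y).deriv]; exact hφ2 y (interior_subset hy)
  obtain ⟨c, hcI, hcl⟩ : ∃ c ∈ Icc a b, ∀ y ∈ Icc a b, l * |y - c| ≤ |φ1 y| := by
    have hz : ∀ c ∈ Icc a b, (∀ y ∈ Icc a b, c ≤ y → l * (y - c) ≤ |φ1 y|) →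
        (∀ y ∈ Icc a b, y ≤ c → l * (c - y) ≤ |φ1 y|) → ∀ y ∈ Icc a b, l * |y - c| ≤ |φ1 y| := by
      intro c _ hr hl y hy
      rcases le_total c y with h | h
      · rw [abs_of_nonneg (by linarith)]; exact hr y hy h
      · rw [abs_sub_comm, abs_of_nonneg (by linarith)]; exact hl y hy h
    have ha := left_mem_Icc.2 hab
    have hb := right_mem_Icc.2 hab
    by_cases h0 : 0 ≤ φ1 a
    · refine ⟨a, ha, hz a ha (fun y hy h => ?_) (fun y hy h => ?_)⟩
      · have := slope a ha y hy h
        exact le_trans (by linarith) (le_abs_self _)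
      · have : y = a := le_antisymm h hy.1
        subst this; simp
    by_cases h0' : φ1 b ≤ 0
    · refine ⟨b, hb, hz b hb (fun y hy h => ?_) (fun y hy h => ?_)⟩
      · have : y = b := le_antisymm hy.2 h
        subst this; simp
      · have := slope y hy b hb h
        exact le_trans (by linarith) (neg_le_abs _)
    obtain ⟨c, hc, hc0⟩ : (0:ℝ) ∈ φ1 '' Icc a b :=
      intermediate_value_Icc hab c1.continuousOn ⟨by linarith, by linarith⟩
    refine ⟨c, hc, hz c hc (fun y hy h => ?_) (fun y hy h => ?_)⟩
    · have := slope c hc y hy h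
      exact le_trans (by linarith) (le_abs_self _)
    · have := slope y hy c hc h
      exact le_trans (by linarith) (neg_le_abs _)
  have hL : 0 ≤ L := (abs_nonneg _).trans (hφ2' a (left_mem_Icc.2 hab))
  set B := 2 / (l * d) + (b - a) * L / (l * d) ^ 2 with hB
  have hld : 0 < l * d := by positivity
  have hB0 : 0 ≤ B := by have : 0 ≤ b - a := by linarith
                         positivity
  have side : ∀ p q, a ≤ p → p ≤ q → q ≤ b → (∀ y ∈ Icc p q, d ≤ |y - c|) →
      ‖∫ y in p..q, cis (φ y)‖ ≤ B := by
    intro p q hp hpq hq hy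
    have hsub : Icc p q ⊆ Icc a b := Icc_subset_Icc hp hq
    refine (norm_integral_cis_le_of_deriv h1 h2 hc hpq hld (L := L) (fun y hy' => ?_)
      (fun y hy' => hφ2' y (hsub hy'))).trans ?_
    · refine le_trans ?_ (hcl y (hsub hy'))
      have := hy y hy'; gcongr
    · rw [hB]; gcongr
  set p := max a (c - d)
  set q := min b (c + d)
  have hpc : p ≤ c := max_le hcI.1 (by linarith)
  have hcq : c ≤ q := le_min hcI.2 (by linarith)
  have ii : ∀ s t, IntervalIntegrable (fun y => cis (φ y)) volume s t :=
    fun s t => hcc.intervalIntegrable _ _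
  rw [← intervalIntegral.integral_add_adjacent_intervals (ii a p) (ii p b),
    ← intervalIntegral.integral_add_adjacent_intervals (ii p q) (ii q b)]
  have i1 : ‖∫ y in a..p, cis (φ y)‖ ≤ B := by
    rcases le_total a (c - d) with h | h
    · have : p = c - d := max_eq_right h
      refine side a p le_rfl (le_max_left _ _) (hpc.trans hcI.2) fun y hy => ?_
      rw [abs_sub_comm]
      exact le_trans (by linarith [hy.2]) (le_abs_self _)
    · have : p = a := max_eq_left h
      rw [this]; simpa using hB0
  have i3 : ‖∫ y in q..b, cis (φ y)‖ ≤ B := by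
    rcases le_total (c + d) b with h | h
    · have : q = c + d := min_eq_right h
      refine side q b (hcI.1.trans hcq) (min_le_left _ _) le_rfl fun y hy => ?_
      exact le_trans (by linarith [hy.1]) (le_abs_self _)
    · have : q = b := min_eq_left h
      rw [this]; simpa using hB0
  have i2 := norm_integral_cis_le (φ := φ) (hpc.trans hcq)
  have hp1 : c - d ≤ p := le_max_right _ _
  have hq1 : q ≤ c + d := min_le_right _ _
  refine (norm_add_le _ _).trans ((add_le_add le_rfl (norm_add_le _ _)).trans ?_)
  linarith

lemma norm_integral_cis_neg (φ : ℝ → ℝ) (a b : ℝ) :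
    ‖∫ y in a..b, cis (-φ y)‖ = ‖∫ y in a..b, cis (φ y)‖ := by
  simp_rw [← conj_cis]
  rw [intervalIntegral.norm_intervalIntegral_eq, intervalIntegral.norm_intervalIntegral_eq,
    integral_conj, RCLike.norm_conj]

set_option maxHeartbeats 400000 in
/-- A phase whose first two derivatives are dominated by two functions
which are never simultaneously small oscillates. -/
lemma norm_integral_cis_le_of_approx {φ φ1 φ2 p s : ℝ → ℝ} (h1 : ∀ y, HasDerivAt φ (φ1 y) y)
    (h2 : ∀ y, HasDerivAt φ1 (φ2 y) y) (hc : Continuous φ2) {Z d : ℝ} (hd : 0 < d) (hd1 : d ≤ 1)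
    (hZ : Z * d ^ 3 = 1) (hps : ∀ y, p y ^ 2 + s y ^ 2 = Z ^ 2)
    (hp : ∀ y z, |p y - p z| ≤ 3.15 * Z * |y - z|) (hs : ∀ y z, |s y - s z| ≤ 3.15 * Z * |y - z|)
    (hφ1 : ∀ y, |φ1 y - 2 * π * rr * p y| ≤ 2 * π * rr * (0.55 * Z))
    (hφ2 : ∀ y, |φ2 y - 2 * π ^ 2 * rr * s y| ≤ 2 * π ^ 2 * rr * (0.22 * Z)) :
    ‖∫ y in (0:ℝ)..1, cis (φ y)‖ ≤ 1024 * d := by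
  have hZ0 : 0 < Z := by
    by_contra h
    have : Z * d ^ 3 ≤ 0 := mul_nonpos_of_nonpos_of_nonneg (by linarith) (by positivity)
    linarith
  have r0 := rr_pos
  have r1 := rr_le
  have r2 := le_rr
  have p1 := Real.pi_gt_d2
  have p2 := Real.pi_lt_d2
  have hpi2 : 9.8596 ≤ π ^ 2 := by nlinarith
  have hpi2' : π ^ 2 ≤ 9.9225 := by nlinarith
  set A := 2 * π * rr with hA
  set B := 2 * π ^ 2 * rr with hB
  have hA1 : 4.4 ≤ A := by rw [hA]; nlinarith
  have hB1 : 13.9 ≤ B := by rw [hB]; nlinarith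
  have hB2 : B ≤ 14.04 := by rw [hB]; nlinarith
  have c0 : Continuous φ := continuous_iff_continuousAt.2 fun y => (h1 y).continuousAt
  have hcc : Continuous fun y => cis (φ y) := continuous_cis.comp c0
  have sle : ∀ y, |s y| ≤ Z := fun y =>
    abs_le_of_sq_le_sq (by nlinarith [hps y, sq_nonneg (p y)]) hZ0.le
  have up : ∀ y, |φ2 y| ≤ 18 * Z := fun y => by
    have h := hφ2 y
    have e : |φ2 y| ≤ |φ2 y - B * s y| + |B * s y| := by
      simpa using abs_add_le (φ2 y - B * s y) (B * s y)
    rw [abs_mul, abs_of_pos (by linarith : 0 < B)] at e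
    have := sle y
    nlinarith [abs_nonneg (s y)]
  have piece : ∀ a b : ℝ, a ≤ b → b - a ≤ 1 / 64 → ‖∫ y in a..b, cis (φ y)‖ ≤ 16 * d := by
    intro a b hab hba
    have near : ∀ y ∈ Icc a b, |y - a| ≤ 1 / 64 := fun y hy => by
      rw [abs_of_nonneg (by linarith [hy.1])]; linarith [hy.2]
    by_cases hpa : 0.65 * Z ≤ |p a|
    · have lo : ∀ y ∈ Icc a b, 0.22 * Z ≤ |φ1 y| := fun y hy => by
        have h3 := hp y a
        have h4 := near y hy
        have h5 : |p a| ≤ |p y| + |p y - p a| := by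
          have := abs_sub_abs_le_abs_sub (p a) (p y); rw [abs_sub_comm] at this; linarith
        have h6 : 0.6 * Z ≤ |p y| := by nlinarith
        have h7 := hφ1 y
        have h8 : A * |p y| ≤ |φ1 y| + |φ1 y - A * p y| := by
          have := abs_sub_abs_le_abs_sub (A * p y) (φ1 y)
          rw [abs_sub_comm, abs_mul, abs_of_pos (by linarith : 0 < A)] at this; linarith
        nlinarith
      have := norm_integral_cis_le_of_deriv h1 h2 hc hab (by positivity) lo (fun y _ => up y)
      refine this.trans ?_
      have hZi : 1 / Z = d ^ 3 := by field_simp; linarith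
      have e1 : 2 / (0.22 * Z) = (2 / 0.22) * d ^ 3 := by rw [← hZi]; field_simp
      have e2 : (b - a) * (18 * Z) / (0.22 * Z) ^ 2 = (b - a) * (18 / 0.22 ^ 2) * d ^ 3 := by
        rw [← hZi]; field_simp
      rw [e1, e2]
      have hd3 : d ^ 3 ≤ d := by
        calc d ^ 3 = d * d ^ 2 := by ring
          _ ≤ d * 1 := by gcongr; exact pow_le_one₀ hd.le hd1
          _ = d := mul_one d
      have : (b - a) * (18 / 0.22 ^ 2) ≤ 1 / 64 * (18 / 0.22 ^ 2) := by gcongr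
      have hd30 : 0 < d ^ 3 := by positivity
      norm_num at this ⊢
      nlinarith
    · push Not at hpa
      have hsa : 0.75 * Z ≤ |s a| := by
        have := hps a
        by_contra! h
        have h3 : p a ^ 2 < (0.65 * Z) ^ 2 := by rw [← sq_abs]; gcongr
        have h4 : s a ^ 2 < (0.75 * Z) ^ 2 := by rw [← sq_abs]; gcongr
        nlinarith
      have final : 2 * d + 2 * (2 / (6.6 * Z * d) + (b - a) * (18 * Z) / (6.6 * Z * d) ^ 2)
          ≤ 16 * d := by
        have e1 : 2 / (6.6 * Z * d) = 2 / 6.6 * d ^ 2 := by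
          rw [div_eq_iff (by positivity)]
          calc (2:ℝ) = 2 * (Z * d ^ 3) := by rw [hZ, mul_one]
            _ = _ := by field_simp
        have e2 : (b - a) * (18 * Z) / (6.6 * Z * d) ^ 2 = (b - a) * (18 / 6.6 ^ 2) * d := by
          rw [div_eq_iff (by positivity)]
          calc (b - a) * (18 * Z) = (b - a) * (18 * Z) * (Z * d ^ 3) := by rw [hZ, mul_one]
            _ = _ := by field_simp
        rw [e1, e2]
        have : (b - a) * (18 / 6.6 ^ 2) ≤ 1 / 64 * (18 / 6.6 ^ 2) := by gcongr
        norm_num at this ⊢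
        nlinarith
      have lo : ∀ y ∈ Icc a b, |s y - s a| ≤ 0.05 * Z := fun y hy => by
        have h3 := hs y a
        have h4 := near y hy
        nlinarith
      rcases le_abs.1 hsa with h | h
      · refine (norm_integral_cis_le_of_deriv2 h1 h2 hc hab (l := 6.6 * Z) (by positivity) hd
          (fun y hy => ?_) (fun y _ => up y)).trans final
        have h3 := abs_le.1 (lo y hy)
        have h4 := abs_le.1 (hφ2 y)
        have h5 : 0.7 * Z ≤ s y := by linarith
        nlinarith
      · rw [← norm_integral_cis_neg]
        refine (norm_integral_cis_le_of_deriv2 (fun y => (h1 y).neg) (fun y => (h2 y).neg) hc.neg hab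
          (l := 6.6 * Z) (by positivity) hd
          (fun y hy => ?_) (fun y _ => (abs_neg _).trans_le (up y))).trans final
        have h3 := abs_le.1 (lo y hy)
        have h4 := abs_le.1 (hφ2 y)
        have h5 : s y ≤ -(0.7 * Z) := by linarith
        nlinarith
  have split := intervalIntegral.sum_integral_adjacent_intervals (f := fun y => cis (φ y))
    (μ := volume) (a := fun k : ℕ => (k : ℝ) / 64) (n := 64)
    (fun k _ => hcc.intervalIntegrable _ _)
  have e : ∫ y in (0:ℝ)..1, cis (φ y) = ∑ k ∈ Finset.range 64,
      ∫ y in ((k:ℕ):ℝ) / 64..((k + 1 : ℕ) : ℝ) / 64, cis (φ y) := by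
    have z0 : ((0:ℕ):ℝ) / 64 = 0 := by simp
    have z1 : ((64:ℕ):ℝ) / 64 = 1 := by norm_num
    rw [split, z0, z1]
  rw [e]
  refine (norm_sum_le _ _).trans ?_
  refine (Finset.sum_le_card_nsmul _ _ (16 * d) fun k _ => piece _ _ ?_ ?_).trans ?_
  · push_cast; gcongr; linarith
  · push_cast; apply le_of_eq; ring
  · rw [Finset.card_range, nsmul_eq_mul]; push_cast; linarith

/-- A lacunary trigonometric polynomial with geometric coefficients. -/
def lacSum (q : ℝ) (M : ℕ) (x : ℝ) : ℂ :=
  ∑ k ∈ Finset.range M, (q ^ (k + 1) : ℝ) • ee (x / 2 ^ (k + 1))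

lemma Sf_eq (M : ℕ) : Sf M = lacSum rr M := rfl

lemma hasDerivAt_lacSum (q : ℝ) (M : ℕ) (x : ℝ) :
    HasDerivAt (lacSum q M) (2 * π * Complex.I * lacSum (q / 2) M x) x := by
  unfold lacSum
  rw [Finset.mul_sum]
  refine HasDerivAt.fun_sum fun k _ => ?_
  have h := (hasDerivAt_ee (x / 2 ^ (k + 1))).scomp x
    ((hasDerivAt_id x).div_const ((2:ℝ) ^ (k + 1)))
  refine (h.const_smul (q ^ (k + 1))).congr_deriv ?_
  simp only [Complex.real_smul, div_pow]
  push_cast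
  ring

lemma norm_lacSum_le {q : ℝ} (hq : 0 ≤ q) (hq1 : q < 1) (M : ℕ) (x : ℝ) :
    ‖lacSum q M x‖ ≤ q / (1 - q) := by
  have h1 : ‖lacSum q M x‖ ≤ ∑ k ∈ Finset.range M, q ^ (k + 1) := by
    refine (norm_sum_le _ _).trans (Finset.sum_le_sum fun k _ => ?_)
    rw [norm_smul, norm_ee, mul_one, Real.norm_of_nonneg (by positivity)]
  have h2 := (summable_geometric_of_lt_one hq hq1).sum_le_tsum (Finset.range M)
    (fun k _ => by positivity)
  rw [tsum_geometric_of_lt_one hq hq1] at h2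
  refine h1.trans ?_
  simp_rw [pow_succ]
  rw [← Finset.sum_mul, div_eq_mul_inv, mul_comm]
  gcongr

lemma lacSum_add (q : ℝ) (l M : ℕ) (x : ℝ) :
    lacSum q (l + M) x = lacSum q l x + (q ^ l : ℝ) • lacSum q M (x / 2 ^ l) := by
  unfold lacSum
  rw [Finset.sum_range_add, Finset.smul_sum]
  congr 1
  refine Finset.sum_congr rfl fun k _ => ?_
  rw [smul_smul]
  congr 2
  · rw [← pow_add]; congr 1
  · rw [div_div, ← pow_add]; congr 1

lemma lacSum_add_mul (q : ℝ) (l : ℕ) (x : ℝ) (k : ℕ) :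
    lacSum q l (x + 2 ^ l * k) = lacSum q l x := by
  unfold lacSum
  refine Finset.sum_congr rfl fun j hj => ?_
  obtain ⟨i, rfl⟩ : ∃ i, l = (j + 1) + i := ⟨l - (j + 1), by have := Finset.mem_range.1 hj; omega⟩
  have : (x + 2 ^ (j + 1 + i) * k) / 2 ^ (j + 1) = x / 2 ^ (j + 1) + ((2 ^ i * k : ℕ) : ℤ) := by
    push_cast; rw [pow_add]; field_simp
  rw [this, ee_add_int]

lemma lacSum_sub_approx {q : ℝ} (hq : 0 ≤ q) (hq1 : q < 1) (M b b' : ℕ) (y : ℝ) :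
    ‖lacSum q (1 + M) (2 * b + y) - lacSum q (1 + M) (2 * b' + 1 + y) - (2 * q : ℝ) * ee (y / 2)‖
      ≤ 2 * (q * (q / (1 - q))) := by
  rw [lacSum_add, lacSum_add]
  have e1 : lacSum q 1 (2 * b + y) = q * ee (y / 2) := by
    simp only [lacSum, Finset.sum_range_one, zero_add, pow_one, Complex.real_smul]
    rw [show (2 * (b:ℝ) + y) / 2 = y / 2 + ((b : ℤ) : ℝ) by push_cast; ring, ee_add_int]
  have e2 : lacSum q 1 (2 * b' + 1 + y) = -(q * ee (y / 2)) := by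
    simp only [lacSum, Finset.sum_range_one, zero_add, pow_one, Complex.real_smul]
    rw [show (2 * (b':ℝ) + 1 + y) / 2 = (y / 2 + 1 / 2) + ((b' : ℤ) : ℝ) by push_cast; ring,
      ee_add_int, ee_add, ee_half]
    ring
  rw [e1, e2, pow_one]
  have h1 := norm_lacSum_le hq hq1 M ((2 * b + y) / 2 ^ 1)
  have h2 := norm_lacSum_le hq hq1 M ((2 * b' + 1 + y) / 2 ^ 1)
  calc _ = ‖q • lacSum q M ((2 * b + y) / 2 ^ 1) - q • lacSum q M ((2 * b' + 1 + y) / 2 ^ 1)‖ := by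
        congr 1; push_cast; ring
    _ ≤ _ := by
        refine (norm_sub_le _ _).trans ?_
        rw [norm_smul, norm_smul, Real.norm_of_nonneg hq]
        have := mul_le_mul_of_nonneg_left h1 hq
        have := mul_le_mul_of_nonneg_left h2 hq
        linarith

lemma continuous_lacSum (q : ℝ) (M : ℕ) : Continuous (lacSum q M) :=
  continuous_iff_continuousAt.2 fun y => (hasDerivAt_lacSum q M y).continuousAt

lemma inner_eq_re (ζ z : ℂ) : inner ℝ ζ z = ζ.re * z.re + ζ.im * z.im := by
  rw [Complex.inner]; simp; ring

lemma norm_integral_cross_le (M b b' : ℕ) (ζ : ℂ) {d : ℝ} (hd : 0 < d) (hd1 : d ≤ 1)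
    (hζ : ‖ζ‖ * d ^ 3 = 1) :
    ‖∫ y in (0:ℝ)..1, cis (inner ℝ ζ (Sf (1 + M) (2 * b + y)) -
      inner ℝ ζ (Sf (1 + M) (2 * b' + 1 + y)))‖ ≤ 1024 * d := by
  have r0 := rr_pos
  have r1 := rr_le
  have r2 := le_rr
  have rs := rr_sq
  set f : ℝ → ℝ → ℂ := fun q y => lacSum q (1 + M) (2 * b + y) - lacSum q (1 + M) (2 * b' + 1 + y)
    with hf
  have hder : ∀ q y, HasDerivAt (f q) (2 * π * Complex.I * f (q / 2) y) y := by
    intro q y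
    have h1 := (hasDerivAt_lacSum q (1 + M) (2 * b + y)).comp_const_add (2 * (b:ℝ)) y
    have h2 := (hasDerivAt_lacSum q (1 + M) (2 * b' + 1 + y)).comp_const_add (2 * (b':ℝ) + 1) y
    refine (h1.sub h2).congr_deriv ?_
    simp only [hf]; ring
  have hcont : ∀ q, Continuous (f q) := fun q =>
    continuous_iff_continuousAt.2 fun y => (hder q y).continuousAt
  have hin : ∀ (g : ℝ → ℂ) (g' : ℂ) (y : ℝ), HasDerivAt g g' y →
      HasDerivAt (fun y => (inner ℝ ζ (g y) : ℝ)) (inner ℝ ζ g') y := fun g g' y h => by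
    exact (innerSL ℝ ζ).hasFDerivAt.comp_hasDerivAt y h
  have hI : ‖(2 * π * Complex.I : ℂ)‖ = 2 * π := by simp [abs_of_pos Real.pi_pos]
  have key := norm_integral_cis_le_of_approx
    (φ := fun y => inner ℝ ζ (f rr y))
    (φ1 := fun y => inner ℝ ζ (2 * π * Complex.I * f (rr / 2) y))
    (φ2 := fun y => inner ℝ ζ (2 * π * Complex.I * (2 * π * Complex.I * f (rr / 2 / 2) y)))
    (p := fun y => inner ℝ ζ (Complex.I * ee (y / 2)))
    (s := fun y => - inner ℝ ζ (ee (y / 2)))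
    (fun y => hin _ _ _ (hder _ _)) (fun y => hin _ _ _ ((hder _ _).const_mul _))
    (by have := hcont (rr / 2 / 2); fun_prop) hd hd1 hζ ?_ ?_ ?_ ?_ ?_
  · simpa [hf, inner_sub_right, Sf_eq] using key
  · intro y
    have h := norm_ee (y / 2)
    have h1 : ‖ee (y / 2)‖ ^ 2 = 1 := by rw [h, one_pow]
    rw [Complex.sq_norm, Complex.normSq_apply] at h1
    rw [inner_eq_re, inner_eq_re, Complex.sq_norm, Complex.normSq_apply]
    simp only [Complex.mul_re, Complex.mul_im, Complex.I_re, Complex.I_im]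
    linear_combination (ζ.re * ζ.re + ζ.im * ζ.im) * h1
  · intro y z
    rw [← inner_sub_right, ← mul_sub]
    refine (abs_real_inner_le_norm _ _).trans ?_
    rw [norm_mul, Complex.norm_I, one_mul]
    have h := norm_ee_sub_le (y / 2) (z / 2)
    rw [← sub_div, abs_div, abs_of_pos (show (0:ℝ) < 2 by norm_num)] at h
    have := Real.pi_lt_d2
    have h2 : ‖ee (y / 2) - ee (z / 2)‖ ≤ 3.15 * |y - z| := by
      refine h.trans ?_
      nlinarith [abs_nonneg (y - z)]
    nlinarith [norm_nonneg ζ]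
  · intro y z
    rw [neg_sub_neg, ← inner_sub_right]
    refine (abs_real_inner_le_norm _ _).trans ?_
    have h := norm_ee_sub_le (z / 2) (y / 2)
    rw [← sub_div, abs_div, abs_of_pos (show (0:ℝ) < 2 by norm_num), abs_sub_comm z y] at h
    have := Real.pi_lt_d2
    have h2 : ‖ee (z / 2) - ee (y / 2)‖ ≤ 3.15 * |y - z| := by
      refine h.trans ?_
      nlinarith [abs_nonneg (y - z)]
    nlinarith [norm_nonneg ζ]
  · intro y
    have h := lacSum_sub_approx (q := rr / 2) (by positivity) (by linarith) M b b' y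
    have e : inner ℝ ζ (2 * π * Complex.I * f (rr / 2) y) -
        2 * π * rr * inner ℝ ζ (Complex.I * ee (y / 2)) =
        inner ℝ ζ (2 * π * Complex.I * (f (rr / 2) y - (2 * (rr / 2) : ℝ) * ee (y / 2))) := by
      rw [← real_inner_smul_right, ← inner_sub_right]
      congr 1; simp only [Complex.real_smul]; push_cast; ring
    rw [e]
    refine (abs_real_inner_le_norm _ _).trans ?_
    rw [norm_mul, hI]
    have hb : 2 * (rr / 2 * (rr / 2 / (1 - rr / 2))) ≤ rr * 0.55 := by
      have : rr / 2 / (1 - rr / 2) ≤ 0.55 := by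
        rw [div_le_iff₀ (by linarith)]; linarith
      nlinarith
    have := h.trans hb
    have hp := Real.pi_pos
    calc ‖ζ‖ * (2 * π * ‖f (rr / 2) y - (2 * (rr / 2) : ℝ) * ee (y / 2)‖)
        ≤ ‖ζ‖ * (2 * π * (rr * 0.55)) := by gcongr
      _ = _ := by ring
  · intro y
    have h := lacSum_sub_approx (q := rr / 2 / 2) (by positivity) (by linarith) M b b' y
    have e : inner ℝ ζ (2 * π * Complex.I * (2 * π * Complex.I * f (rr / 2 / 2) y)) -
        2 * π ^ 2 * rr * -inner ℝ ζ (ee (y / 2)) =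
        inner ℝ ζ (2 * π * Complex.I * (2 * π * Complex.I *
          (f (rr / 2 / 2) y - (2 * (rr / 2 / 2) : ℝ) * ee (y / 2)))) := by
      rw [mul_neg, sub_neg_eq_add, ← real_inner_smul_right, ← inner_add_right]
      congr 1; simp only [Complex.real_smul]; push_cast
      linear_combination (2 * π ^ 2 * rr * ee (y / 2)) * Complex.I_mul_I
    rw [e]
    refine (abs_real_inner_le_norm _ _).trans ?_
    rw [norm_mul (2 * π * Complex.I), norm_mul (2 * π * Complex.I), hI]
    have hb : 2 * (rr / 2 / 2 * (rr / 2 / 2 / (1 - rr / 2 / 2))) ≤ rr * 0.11 := by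
      have : rr / 2 / 2 / (1 - rr / 2 / 2) ≤ 0.22 := by
        rw [div_le_iff₀ (by linarith)]; linarith
      nlinarith
    have := h.trans hb
    have hp := Real.pi_pos
    calc ‖ζ‖ * (2 * π * (2 * π * ‖f (rr / 2 / 2) y - (2 * (rr / 2 / 2) : ℝ) * ee (y / 2)‖))
        ≤ ‖ζ‖ * (2 * π * (2 * π * (rr * 0.11))) := by gcongr
      _ = _ := by ring

lemma sum_range_mul_eq {α : Type*} [AddCommMonoid α] (A B : ℕ) (f : ℕ → α) :
    ∑ b ∈ Finset.range (A * B), f b =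
      ∑ b0 ∈ Finset.range A, ∑ b1 ∈ Finset.range B, f (b0 + A * b1) := by
  rw [Finset.sum_comm]
  induction B with
  | zero => simp
  | succ B ih =>
    rw [Nat.mul_succ, Finset.sum_range_add, ih, Finset.sum_range_succ]
    simp_rw [add_comm]

/-- The averaged exponential sum attached to the phases `Sf M`. -/
def expSum (M : ℕ) (ζ : ℂ) (x : ℝ) : ℂ :=
  ((2:ℝ) ^ M)⁻¹ • ∑ b ∈ Finset.range (2 ^ M), cis (inner ℝ ζ (Sf M (b + x)))

lemma continuous_inner_Sf (M : ℕ) (ζ : ℂ) : Continuous fun x => (inner ℝ ζ (Sf M x) : ℝ) :=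
  continuous_const.inner (continuous_lacSum rr M)

lemma continuous_expSum (M : ℕ) (ζ : ℂ) : Continuous (expSum M ζ) := by
  have h : ∀ b : ℕ, Continuous fun x : ℝ => cis (inner ℝ ζ (Sf M (b + x))) := fun b =>
    continuous_cis.comp ((continuous_inner_Sf M ζ).comp (continuous_const.add continuous_id))
  unfold expSum
  fun_prop

lemma norm_inv_smul_sum_le {N : ℕ} (F : ℕ → ℂ) {C : ℝ} (hC : 0 ≤ C) (h : ∀ b, ‖F b‖ ≤ C) :
    ‖((N:ℝ))⁻¹ • ∑ b ∈ Finset.range N, F b‖ ≤ C := by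
  rw [norm_smul, norm_inv, Real.norm_natCast]
  have : ‖∑ b ∈ Finset.range N, F b‖ ≤ N * C :=
    (norm_sum_le _ _).trans ((Finset.sum_le_card_nsmul _ _ C fun b _ => h b).trans (by simp))
  rcases Nat.eq_zero_or_pos N with h0 | h0
  · subst h0; simpa using hC
  · have : (0:ℝ) < N := by exact_mod_cast h0
    rw [inv_mul_le_iff₀ this]; assumption

lemma norm_expSum_le (M : ℕ) (ζ : ℂ) (x : ℝ) : ‖expSum M ζ x‖ ≤ 1 := by
  have := norm_inv_smul_sum_le (N := 2 ^ M) (fun b => cis (inner ℝ ζ (Sf M (b + x)))) zero_le_one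
    (fun b => (norm_cis _).le)
  simpa [expSum] using this

lemma expSum_add_one (M : ℕ) (ζ : ℂ) (x : ℝ) : expSum M ζ (x + 1) = expSum M ζ x := by
  unfold expSum
  congr 1
  have h1 := Finset.sum_range_succ (fun b : ℕ => cis (inner ℝ ζ (Sf M (b + x)))) (2 ^ M)
  have h2 := Finset.sum_range_succ' (fun b : ℕ => cis (inner ℝ ζ (Sf M (b + x)))) (2 ^ M)
  have h3 : Sf M (((2 ^ M : ℕ) : ℝ) + x) = Sf M (((0 : ℕ) : ℝ) + x) := by
    have := lacSum_add_mul rr M x 1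
    rw [Sf_eq]
    rw [show (((2 ^ M : ℕ) : ℝ) + x) = x + 2 ^ M * ((1:ℕ):ℝ) by push_cast; ring, this]; simp
  rw [h1, h3] at h2
  have h4 := add_right_cancel h2
  rw [h4]
  refine Finset.sum_congr rfl fun b _ => ?_
  congr 3; push_cast; ring

lemma expSum_add_int (M : ℕ) (ζ : ℂ) (x : ℝ) (k : ℤ) : expSum M ζ (x + k) = expSum M ζ x := by
  have : Function.Periodic (expSum M ζ) 1 := expSum_add_one M ζ
  simpa using this.int_mul k x

/-- One residue class modulo `2 ^ l` of the exponential sum. -/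
def expPart (l M : ℕ) (ζ : ℂ) (b0 : ℕ) (x : ℝ) : ℂ :=
  ((2:ℝ) ^ M)⁻¹ • ∑ b1 ∈ Finset.range (2 ^ M), cis (inner ℝ ζ (Sf (l + M) (b0 + 2 ^ l * b1 + x)))

lemma expSum_add (l M : ℕ) (ζ : ℂ) (x : ℝ) : expSum (l + M) ζ x =
    ((2:ℝ) ^ l)⁻¹ • ∑ b0 ∈ Finset.range (2 ^ l), expPart l M ζ b0 x := by
  unfold expSum expPart
  rw [← Finset.smul_sum, smul_smul, pow_add, pow_add, sum_range_mul_eq, mul_inv]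
  push_cast; rfl

lemma norm_expPart (l M : ℕ) (ζ : ℂ) (b0 : ℕ) (x : ℝ) : ‖expPart l M ζ b0 x‖ =
    ‖expSum M ((rr ^ l : ℝ) • ζ) ((b0 + x) / 2 ^ l)‖ := by
  have : expPart l M ζ b0 x = cis (inner ℝ ζ (Sf l (b0 + x))) *
      expSum M ((rr ^ l : ℝ) • ζ) ((b0 + x) / 2 ^ l) := by
    unfold expPart expSum
    rw [mul_smul_comm, Finset.mul_sum]
    congr 1
    refine Finset.sum_congr rfl fun b _ => ?_
    rw [← cis_add, real_inner_smul_left, ← real_inner_smul_right, ← inner_add_right]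
    congr 2
    rw [Sf_eq, lacSum_add, show (b0:ℝ) + 2 ^ l * b + x = b0 + x + 2 ^ l * b by ring,
      lacSum_add_mul, Sf_eq, Sf_eq]
    congr 3
    field_simp; ring
  rw [this, norm_mul, norm_cis, one_mul]

lemma continuous_expPart (l M : ℕ) (ζ : ℂ) (b : ℕ) : Continuous (expPart l M ζ b) := by
  have h : ∀ b1 : ℕ, Continuous fun x : ℝ => cis (inner ℝ ζ (Sf (l + M) (b + 2 ^ l * b1 + x))) :=
    fun b1 => continuous_cis.comp
      ((continuous_inner_Sf (l + M) ζ).comp (continuous_const.add continuous_id))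
  unfold expPart
  fun_prop

lemma norm_Sf_sub_le (M : ℕ) (x y : ℝ) : ‖Sf M x - Sf M y‖ ≤ 3.5 * |x - y| := by
  have hr := rr_pos; have hr1 := rr_le; have hp := Real.pi_lt_d2; have hp0 := Real.pi_pos
  refine Convex.norm_image_sub_le_of_norm_hasDerivWithin_le (s := univ)
    (fun y _ => (hasDerivAt_lacSum rr M y).hasDerivWithinAt) (fun y _ => ?_) convex_univ
    (mem_univ _) (mem_univ _)
  have h := norm_lacSum_le (q := rr / 2) (by positivity) (by linarith) M y
  have hI : ‖(2 * π * Complex.I : ℂ)‖ = 2 * π := by simp [abs_of_pos Real.pi_pos]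
  rw [norm_mul, hI]
  have : rr / 2 / (1 - rr / 2) ≤ 0.55 := by
    rw [div_le_iff₀ (by linarith)]; linarith
  nlinarith [norm_nonneg (lacSum (rr / 2) M y)]

lemma norm_expSum_sub_le (M : ℕ) (ζ : ℂ) (x y : ℝ) :
    ‖expSum M ζ x - expSum M ζ y‖ ≤ 3.5 * ‖ζ‖ * |x - y| := by
  unfold expSum
  rw [← smul_sub, ← Finset.sum_sub_distrib]
  have := norm_inv_smul_sum_le (N := 2 ^ M)
    (fun b => cis (inner ℝ ζ (Sf M (b + x))) - cis (inner ℝ ζ (Sf M (b + y))))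
    (C := 3.5 * ‖ζ‖ * |x - y|) (by positivity) (fun b => by
      refine (norm_cis_sub_le _ _).trans ?_
      rw [← inner_sub_right]
      refine (abs_real_inner_le_norm _ _).trans ?_
      have := norm_Sf_sub_le M (b + x) (b + y)
      rw [add_sub_add_left_eq_sub] at this
      nlinarith [norm_nonneg ζ])
  simpa using this

/-- The mean square of the exponential sum. -/
def expMean (M : ℕ) (ζ : ℂ) : ℝ := ∫ y in (0:ℝ)..1, ‖expSum M ζ y‖ ^ 2

lemma expMean_le_one (M : ℕ) (ζ : ℂ) : expMean M ζ ≤ 1 := by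
  unfold expMean
  have := intervalIntegral.integral_mono_on (a := 0) (b := 1) (μ := volume)
    (f := fun y => ‖expSum M ζ y‖ ^ 2) (g := fun _ => (1:ℝ)) zero_le_one
    ((((continuous_expSum M ζ).norm).pow 2).intervalIntegrable _ _) (by simp)
    (fun y _ => pow_le_one₀ (norm_nonneg _) (norm_expSum_le _ _ _))
  simpa using this

lemma expMean_succ_le (M : ℕ) (ζ : ℂ) {d : ℝ} (hd : 0 < d) (hd1 : d ≤ 1)
    (hζ : ‖ζ‖ * d ^ 3 = 1) : expMean (1 + M) ζ ≤ expMean M (rr • ζ) / 2 + 512 * d := by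
  have c0 := continuous_expPart 1 M ζ 0
  have c1 := continuous_expPart 1 M ζ 1
  have hs : ∀ y, ‖expSum (1 + M) ζ y‖ ^ 2 = 1 / 4 * ‖expPart 1 M ζ 0 y‖ ^ 2 +
      1 / 4 * ‖expPart 1 M ζ 1 y‖ ^ 2 +
      1 / 2 * (expPart 1 M ζ 0 y * (starRingEnd ℂ) (expPart 1 M ζ 1 y)).re := by
    intro y
    rw [expSum_add]
    simp only [pow_one, Finset.sum_range_succ, Finset.sum_range_zero, zero_add]
    rw [norm_smul, mul_pow]
    simp only [Complex.sq_norm, Complex.normSq_apply, Complex.add_re, Complex.add_im,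
      Complex.mul_re, Complex.conj_re, Complex.conj_im, norm_inv, Real.norm_ofNat]
    ring
  have hsum : (∫ y in (0:ℝ)..1, ‖expPart 1 M ζ 0 y‖ ^ 2) + (∫ y in (0:ℝ)..1, ‖expPart 1 M ζ 1 y‖ ^ 2)
      = 2 * expMean M (rr • ζ) := by
    have cM : Continuous fun y => ‖expSum M (rr • ζ) y‖ ^ 2 := (continuous_expSum M _).norm.pow 2
    have e0 := intervalIntegral.integral_comp_div (fun y => ‖expSum M (rr • ζ) y‖ ^ 2)
      (a := 0) (b := 1) (show (2:ℝ) ≠ 0 by norm_num)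
    have e1 := intervalIntegral.integral_comp_div_add (fun y => ‖expSum M (rr • ζ) y‖ ^ 2)
      (a := 0) (b := 1) (show (2:ℝ) ≠ 0 by norm_num) (1 / 2)
    simp_rw [norm_expPart, pow_one]
    have f0 : ∀ y : ℝ, (((0:ℕ):ℝ) + y) / 2 = y / 2 := fun y => by simp
    have f1 : ∀ y : ℝ, (((1:ℕ):ℝ) + y) / 2 = y / 2 + 1 / 2 := fun y => by push_cast; ring
    simp_rw [f0, f1]
    rw [e0, e1, smul_eq_mul, smul_eq_mul, ← mul_add, expMean]
    congr 1
    have := intervalIntegral.integral_add_adjacent_intervals (a := 0) (b := 1 / 2) (c := 1)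
      (cM.intervalIntegrable (μ := volume) _ _) (cM.intervalIntegrable _ _)
    rw [← this]
    norm_num
  have hcross : ‖∫ y in (0:ℝ)..1, expPart 1 M ζ 0 y * (starRingEnd ℂ) (expPart 1 M ζ 1 y)‖
      ≤ 1024 * d := by
    have e : ∀ y, expPart 1 M ζ 0 y * (starRingEnd ℂ) (expPart 1 M ζ 1 y) =
        (((2 ^ M : ℕ):ℝ))⁻¹ • ∑ b ∈ Finset.range (2 ^ M), (((2 ^ M : ℕ):ℝ))⁻¹ •
          ∑ b' ∈ Finset.range (2 ^ M), cis (inner ℝ ζ (Sf (1 + M) (2 * b + y)) -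
            inner ℝ ζ (Sf (1 + M) (2 * b' + 1 + y))) := by
      intro y
      unfold expPart
      rw [← Finset.smul_sum]
      simp only [Complex.real_smul, map_mul, map_sum, conj_cis, Complex.conj_ofReal,
        sub_eq_add_neg, cis_add, pow_one]
      simp_rw [← Finset.mul_sum, ← Finset.sum_mul]
      have g0 : ∀ b : ℕ, ((0:ℕ):ℝ) + 2 * b + y = 2 * b + y := fun b => by simp
      have g1 : ∀ b : ℕ, ((1:ℕ):ℝ) + 2 * b + y = 2 * b + 1 + y := fun b => by push_cast; ring
      simp_rw [g0, g1]
      push_cast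
      ring
    have cc : ∀ b b' : ℕ, Continuous fun y => cis (inner ℝ ζ (Sf (1 + M) (2 * b + y)) -
            inner ℝ ζ (Sf (1 + M) (2 * b' + 1 + y))) := fun b b' =>
      continuous_cis.comp (((continuous_inner_Sf (1 + M) ζ).comp (by fun_prop)).sub
        ((continuous_inner_Sf (1 + M) ζ).comp (by fun_prop)))
    simp_rw [e]
    rw [intervalIntegral.integral_smul, intervalIntegral.integral_finsetSum (fun b _ =>
      Continuous.intervalIntegrable (by fun_prop) _ _)]
    refine norm_inv_smul_sum_le _ (by positivity) fun b => ?_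
    rw [intervalIntegral.integral_smul, intervalIntegral.integral_finsetSum (fun b' _ =>
      (cc b b').intervalIntegrable _ _)]
    exact norm_inv_smul_sum_le _ (by positivity) fun b' =>
      norm_integral_cross_le M b b' ζ hd hd1 hζ
  have ccr : Continuous fun y => expPart 1 M ζ 0 y * (starRingEnd ℂ) (expPart 1 M ζ 1 y) :=
    c0.mul (Complex.continuous_conj.comp c1)
  have hre : (∫ y in (0:ℝ)..1, (expPart 1 M ζ 0 y * (starRingEnd ℂ) (expPart 1 M ζ 1 y)).re) =
      (∫ y in (0:ℝ)..1, expPart 1 M ζ 0 y * (starRingEnd ℂ) (expPart 1 M ζ 1 y)).re :=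
    Complex.reCLM.intervalIntegral_comp_comm (ccr.intervalIntegrable _ _)
  have := (Complex.re_le_norm _).trans hcross
  unfold expMean at hsum ⊢
  simp_rw [hs]
  rw [intervalIntegral.integral_add, intervalIntegral.integral_add,
    intervalIntegral.integral_const_mul, intervalIntegral.integral_const_mul,
    intervalIntegral.integral_const_mul, hre]
  · linarith
  · exact Continuous.intervalIntegrable (by fun_prop) _ _
  · exact Continuous.intervalIntegrable (by fun_prop) _ _
  · exact Continuous.intervalIntegrable (by fun_prop) _ _
  · exact (continuous_const.mul (Complex.continuous_re.comp ccr)).intervalIntegrable _ _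

lemma expMean_le (M : ℕ) (ζ : ℂ) {d : ℝ} (hd : 0 < d) (hζ : ‖ζ‖ * d ^ 3 = 1) :
    expMean M ζ ≤ 2048 * d + (2 ^ M)⁻¹ := by
  induction M generalizing ζ d with
  | zero =>
    have := expMean_le_one 0 ζ
    norm_num; linarith
  | succ M ih =>
    rcases le_total 1 d with h | h
    · have := expMean_le_one (M + 1) ζ
      have h2 : (0:ℝ) < (2 ^ (M + 1))⁻¹ := by positivity
      linarith
    · have h1 := expMean_succ_le M ζ hd h hζ
      have r0 := rr_pos
      set e : ℝ := (√2) ^ (1 / 3 : ℝ) with he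
      have he0 : 0 < e := by positivity
      have he3 : rr * e ^ 3 = 1 := by
        rw [he, ← Real.rpow_natCast, ← Real.rpow_mul (by positivity)]
        norm_num; exact rr_mul_sqrt
      have he1 : e ≤ 1.5 := by
        by_contra! h
        have : 1.5 ^ 3 < e ^ 3 := by gcongr
        have := le_rr
        nlinarith
      have h2 := ih (rr • ζ) (d := d * e) (by positivity) (by
        rw [norm_smul, Real.norm_of_nonneg r0.le]
        calc rr * ‖ζ‖ * (d * e) ^ 3 = (‖ζ‖ * d ^ 3) * (rr * e ^ 3) := by ring
          _ = 1 := by rw [hζ, he3, mul_one])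
      rw [add_comm M 1]
      have h3 : ((2:ℝ) ^ (1 + M))⁻¹ = (2 ^ M)⁻¹ / 2 := by rw [pow_add]; field_simp
      rw [h3]
      nlinarith

lemma norm_expSum_sq_le (l M : ℕ) (ζ : ℂ) (x : ℝ) : ‖expSum (l + M) ζ x‖ ^ 2 ≤
    expMean M ((rr ^ l : ℝ) • ζ) + 7 * ‖(rr ^ l : ℝ) • ζ‖ / 2 ^ l := by
  set ζ' := (rr ^ l : ℝ) • ζ with hζ'
  wlog hx : x ∈ Ico (0:ℝ) 1 generalizing x
  · have := this (Int.fract x) ⟨Int.fract_nonneg x, Int.fract_lt_one x⟩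
    have e : expSum (l + M) ζ x = expSum (l + M) ζ (Int.fract x) := by
      conv_lhs => rw [← Int.fract_add_floor x]
      rw [expSum_add_int]
    rwa [e]
  set h : ℝ → ℝ := fun y => ‖expSum M ζ' y‖ ^ 2 with hh
  have hcont : Continuous h := (continuous_expSum M ζ').norm.pow 2
  have p2 : (0:ℝ) < 2 ^ l := by positivity
  have hlip : ∀ y z, |y - z| ≤ 1 / 2 ^ l → h y ≤ h z + 7 * ‖ζ'‖ / 2 ^ l := by
    intro y z hyz
    have h1 := (norm_sub_norm_le _ _).trans (norm_expSum_sub_le M ζ' y z)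
    have h2 := norm_expSum_le M ζ' y
    have h3 := norm_expSum_le M ζ' z
    have h4 : 3.5 * ‖ζ'‖ * |y - z| ≤ 3.5 * ‖ζ'‖ * (1 / 2 ^ l) := by gcongr
    have h5 : 7 * ‖ζ'‖ / 2 ^ l = 2 * (3.5 * ‖ζ'‖ * (1 / 2 ^ l)) := by ring
    have h6 : 0 ≤ 3.5 * ‖ζ'‖ * (1 / 2 ^ l) := by positivity
    simp only [hh]
    rw [h5]
    have := norm_nonneg (expSum M ζ' y)
    have := norm_nonneg (expSum M ζ' z)
    nlinarith
  have hcs : ‖expSum (l + M) ζ x‖ ^ 2 ≤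
      ∑ b ∈ Finset.range (2 ^ l), ((2:ℝ) ^ l)⁻¹ * h ((b + x) / 2 ^ l) := by
    rw [expSum_add, norm_smul, mul_pow, ← Finset.mul_sum]
    have h1 : ‖∑ b ∈ Finset.range (2 ^ l), expPart l M ζ b x‖ ^ 2 ≤
        2 ^ l * ∑ b ∈ Finset.range (2 ^ l), h ((b + x) / 2 ^ l) := by
      have h2 := sq_sum_le_card_mul_sum_sq (s := Finset.range (2 ^ l))
        (f := fun b => ‖expPart l M ζ b x‖)
      have h3 : ‖∑ b ∈ Finset.range (2 ^ l), expPart l M ζ b x‖ ^ 2 ≤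
        (∑ b ∈ Finset.range (2 ^ l), ‖expPart l M ζ b x‖) ^ 2 := by
        gcongr; exact norm_sum_le _ _
      simp_rw [norm_expPart] at h2
      simp_rw [norm_expPart] at h3
      refine h3.trans (h2.trans_eq ?_)
      simp [hh, hζ']
    rw [norm_inv, norm_pow, Real.norm_ofNat]
    refine (mul_le_mul_of_nonneg_left h1 (by positivity)).trans_eq ?_
    field_simp
  refine hcs.trans ?_
  have hpiece : ∀ b ∈ Finset.range (2 ^ l), ((2:ℝ) ^ l)⁻¹ * h ((b + x) / 2 ^ l) ≤
      ∫ y in ((b:ℕ):ℝ) / 2 ^ l..((b + 1 : ℕ) : ℝ) / 2 ^ l, (h y + 7 * ‖ζ'‖ / 2 ^ l) := by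
    intro b _
    have hle : (b:ℝ) / 2 ^ l ≤ ((b + 1 : ℕ) : ℝ) / 2 ^ l := by gcongr; omega
    have := intervalIntegral.integral_mono_on (μ := volume) (f := fun _ => h ((b + x) / 2 ^ l))
      (g := fun y => h y + 7 * ‖ζ'‖ / 2 ^ l) hle (by simp)
      ((hcont.add continuous_const).intervalIntegrable _ _) (fun y hy => hlip _ _ (by
        have a1 := hy.1
        have a2 := hy.2
        rw [div_le_iff₀ p2] at a1
        rw [le_div_iff₀ p2] at a2
        push_cast at a2
        have hx0 := hx.1
        have hx1 := hx.2
        rw [abs_le]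
        constructor
        · rw [neg_le_sub_iff_le_add, ← add_div, le_div_iff₀ p2]; linarith
        · rw [sub_le_iff_le_add, div_le_iff₀ p2, add_mul, one_div, inv_mul_cancel₀ p2.ne']
          linarith))
    rw [intervalIntegral.integral_const, smul_eq_mul] at this
    refine le_trans (le_of_eq ?_) this
    congr 1
    push_cast
    field_simp; ring
  refine (Finset.sum_le_sum hpiece).trans ?_
  have hsum := intervalIntegral.sum_integral_adjacent_intervals (n := 2 ^ l)
    (f := fun y => h y + 7 * ‖ζ'‖ / 2 ^ l) (a := fun k : ℕ => (k:ℝ) / 2 ^ l) (μ := volume)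
    (fun k _ => (hcont.add continuous_const).intervalIntegrable _ _)
  rw [hsum]
  have z0 : ((0:ℕ):ℝ) / 2 ^ l = 0 := by simp
  have z1 : ((2 ^ l:ℕ):ℝ) / 2 ^ l = 1 := by push_cast; field_simp
  rw [z0, z1, intervalIntegral.integral_add (hcont.intervalIntegrable _ _) (by simp)]
  simp [expMean, hh]

lemma norm_expSum_le_of_pow {M : ℕ} {ζ : ℂ} {d : ℝ} (x : ℝ) (hd : 0 < d) (hd1 : d ≤ 1)
    (hζ : ‖ζ‖ * d ^ 12 = 1) (hM : 1 ≤ 2 ^ M * d ^ 16) : ‖expSum M ζ x‖ ≤ 50 * d := by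
  have hd12 : d ^ 12 ≤ 1 := pow_le_one₀ hd.le hd1
  have ht1 : 1 ≤ ‖ζ‖ := by
    by_contra! h
    have : ‖ζ‖ * d ^ 12 < 1 := by nlinarith [norm_nonneg ζ, pow_pos hd 12]
    linarith
  have ht0 : 0 < ‖ζ‖ := by linarith
  have htM : ‖ζ‖ ≤ 2 ^ M := by
    have : d ^ 16 ≤ d ^ 12 := pow_le_pow_of_le_one hd.le hd1 (by norm_num)
    have h2 : ‖ζ‖ * d ^ 12 ≤ 2 ^ M * d ^ 12 := by rw [hζ]; exact hM.trans (by gcongr)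
    exact le_of_mul_le_mul_right h2 (by positivity)
  have hex : ∃ l : ℕ, ‖ζ‖ ≤ 2 ^ l := ⟨M, htM⟩
  classical
  obtain ⟨l, hl, hl2⟩ : ∃ l : ℕ, ‖ζ‖ ≤ 2 ^ l ∧ (2:ℝ) ^ l ≤ 2 * ‖ζ‖ ∧ l ≤ M := by
    refine ⟨Nat.find hex, Nat.find_spec hex, ?_, Nat.find_min' hex htM⟩
    rcases h : Nat.find hex with _ | k
    · norm_num; linarith
    · have := Nat.find_min hex (m := k) (by omega)
      rw [pow_succ]; linarith
  obtain ⟨hl2, hlM⟩ := hl2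
  obtain ⟨M', rfl⟩ : ∃ M', M = l + M' := ⟨M - l, by omega⟩
  have main := norm_expSum_sq_le l M' ζ x
  have r0 := rr_pos
  set t := ‖(rr ^ l : ℝ) • ζ‖ with ht
  have ht' : t = rr ^ l * ‖ζ‖ := by
    rw [ht, norm_smul, Real.norm_of_nonneg (by positivity)]
  have tpos : 0 < t := by rw [ht']; positivity
  have tsq : t ^ 2 * 2 ^ l = ‖ζ‖ ^ 2 := by
    rw [ht', mul_pow, ← pow_mul, mul_comm l 2, pow_mul, rr_sq, mul_right_comm, ← mul_pow]
    norm_num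
  set e : ℝ := t ^ (-(1 / 3) : ℝ) with he
  have epos : 0 < e := by positivity
  have he3 : t * e ^ 3 = 1 := by
    rw [he, ← Real.rpow_natCast, ← Real.rpow_mul tpos.le]
    norm_num
    rw [Real.rpow_neg_one, mul_inv_cancel₀ tpos.ne']
  have hmean := expMean_le M' _ epos he3
  have he6 : t ^ 2 * e ^ 6 = 1 := by
    calc t ^ 2 * e ^ 6 = (t * e ^ 3) ^ 2 := by ring
      _ = 1 := by rw [he3, one_pow]
  have het : ‖ζ‖ * e ^ 6 ≤ 2 := by
    have : ‖ζ‖ * (‖ζ‖ * e ^ 6) ≤ ‖ζ‖ * 2 := by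
      calc ‖ζ‖ * (‖ζ‖ * e ^ 6) = (t ^ 2 * e ^ 6) * 2 ^ l := by rw [← mul_assoc, ← sq, ← tsq]; ring
        _ ≤ _ := by rw [he6]; linarith
    exact le_of_mul_le_mul_left this ht0
  have hed : e ≤ 1.2 * d ^ 2 := by
    by_contra! h
    have h1 : (1.2 * d ^ 2) ^ 6 < e ^ 6 := by gcongr
    have h2 : ‖ζ‖ * (1.2 * d ^ 2) ^ 6 < ‖ζ‖ * e ^ 6 := by gcongr
    have h3 : ‖ζ‖ * (1.2 * d ^ 2) ^ 6 = 1.2 ^ 6 * (‖ζ‖ * d ^ 12) := by ring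
    rw [h3, hζ] at h2
    norm_num at h2; linarith
  have hM' : ((2:ℝ) ^ M')⁻¹ ≤ 2 * d ^ 4 := by
    rw [inv_le_iff_one_le_mul₀ (by positivity)]
    calc (1:ℝ) ≤ 2 ^ (l + M') * d ^ 16 := hM
      _ = 2 ^ l * (2 ^ M' * d ^ 16) := by rw [pow_add]; ring
      _ ≤ 2 * ‖ζ‖ * (2 ^ M' * d ^ 16) := by gcongr
      _ = 2 * d ^ 4 * 2 ^ M' * (‖ζ‖ * d ^ 12) := by ring
      _ = _ := by rw [hζ, mul_one]
  have ht2 : t / 2 ^ l ≤ d ^ 6 := by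
    refine abs_le_of_sq_le_sq' ?_ (by positivity) |>.2
    rw [div_pow, div_le_iff₀ (by positivity)]
    have : t ^ 2 ≤ ‖ζ‖ := by
      have : ‖ζ‖ * t ^ 2 ≤ ‖ζ‖ * ‖ζ‖ := by rw [← sq, ← tsq, mul_comm]; gcongr
      exact le_of_mul_le_mul_left this ht0
    calc t ^ 2 ≤ ‖ζ‖ := this
      _ = (‖ζ‖ * d ^ 12) * ‖ζ‖ := by rw [hζ, one_mul]
      _ = (d ^ 6) ^ 2 * ‖ζ‖ ^ 2 := by ring
      _ ≤ (d ^ 6) ^ 2 * (2 ^ l) ^ 2 := by gcongr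
  have d4 : d ^ 4 ≤ d ^ 2 := pow_le_pow_of_le_one hd.le hd1 (by norm_num)
  have d6 : d ^ 6 ≤ d ^ 2 := pow_le_pow_of_le_one hd.le hd1 (by norm_num)
  refine abs_le_of_sq_le_sq' ?_ (by positivity) |>.2
  rw [mul_div_assoc] at main
  nlinarith [sq_nonneg d]

/-- Decay of the exponential sum, with dyadic bookkeeping. -/
lemma norm_expSum_le_two_pow {M a : ℕ} {ζ : ℂ} (x : ℝ) (h1 : 2 ^ (48 * a) ≤ ‖ζ‖)
    (h2 : ‖ζ‖ ^ 4 ≤ 2 ^ (3 * M)) : ‖expSum M ζ x‖ ≤ 50 * ((2:ℝ) ^ (4 * a))⁻¹ := by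
  have ht1 : 1 ≤ ‖ζ‖ := le_trans (one_le_pow₀ (by norm_num)) h1
  have ht0 : 0 < ‖ζ‖ := by linarith
  set d : ℝ := ‖ζ‖ ^ (-(1 / 12) : ℝ) with hd
  have hd0 : 0 < d := by positivity
  have hd1 : d ≤ 1 := Real.rpow_le_one_of_one_le_of_nonpos ht1 (by norm_num)
  have hd12 : ‖ζ‖ * d ^ 12 = 1 := by
    rw [hd, ← Real.rpow_natCast, ← Real.rpow_mul ht0.le]
    norm_num
    rw [Real.rpow_neg_one, mul_inv_cancel₀ ht0.ne']
  have key := norm_expSum_le_of_pow x hd0 hd1 hd12 (M := M) (by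
    have h3 : ((2:ℝ) ^ M * d ^ 16) ^ 3 = 2 ^ (3 * M) * d ^ 48 := by
      rw [mul_pow, ← pow_mul, ← pow_mul, mul_comm M 3]
    have h4 : 1 ≤ ((2:ℝ) ^ M * d ^ 16) ^ 3 := by
      rw [h3]
      calc (1:ℝ) = (‖ζ‖ * d ^ 12) ^ 4 := by rw [hd12, one_pow]
        _ = ‖ζ‖ ^ 4 * d ^ 48 := by ring
        _ ≤ _ := by gcongr
    by_contra! h
    have : ((2:ℝ) ^ M * d ^ 16) ^ 3 < 1 := pow_lt_one₀ (by positivity) h (by norm_num)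
    linarith)
  refine key.trans ?_
  gcongr
  by_contra! h
  have h5 : (((2:ℝ) ^ (4 * a))⁻¹) ^ 12 < d ^ 12 := by gcongr
  have h6 : (2:ℝ) ^ (48 * a) * (((2:ℝ) ^ (4 * a))⁻¹) ^ 12 = 1 := by
    rw [inv_pow, ← pow_mul, show 4 * a * 12 = 48 * a by ring, mul_inv_cancel₀ (by positivity)]
  have h7 : (2:ℝ) ^ (48 * a) * (((2:ℝ) ^ (4 * a))⁻¹) ^ 12 < ‖ζ‖ * d ^ 12 :=
    (mul_le_mul_of_nonneg_right h1 (by positivity)).trans_lt (by gcongr)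
  rw [h6, hd12] at h7
  exact lt_irrefl _ h7

/-- The centered Gaussian measure on `ℂ` with density `(b / π) exp (-b ‖u‖ ^ 2)`. -/
def gaussC (b : ℝ) : Measure ℂ :=
  volume.withDensity fun u => ENNReal.ofReal (b / π * rexp (-b * ‖u‖ ^ 2))

lemma integral_gaussC {b : ℝ} (hb : 0 < b) (g : ℂ → ℂ) :
    ∫ u, g u ∂gaussC b = ∫ u, (b / π * rexp (-b * ‖u‖ ^ 2)) • g u := by
  unfold gaussC
  rw [integral_withDensity_eq_integral_toReal_smul (by fun_prop) (by simp)]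
  refine integral_congr_ae (Eventually.of_forall fun u => ?_)
  simp only
  rw [ENNReal.toReal_ofReal (by have := Real.pi_pos; positivity)]

lemma integral_exp_neg_mul_sq_norm {b : ℝ} (hb : 0 < b) :
    Integrable (fun u : ℂ => rexp (-b * ‖u‖ ^ 2)) ∧
    ∫ u : ℂ, rexp (-b * ‖u‖ ^ 2) = π / b := by
  have h1 := GaussianFourier.integrable_cexp_neg_mul_sq_norm_add (V := ℂ) (b := (b : ℂ)) (by simpa) 0 0
  have h2 := GaussianFourier.integral_cexp_neg_mul_sq_norm_add (V := ℂ) (b := (b : ℂ)) (by simpa) 0 0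
  have e : ∀ u : ℂ, Complex.exp (-(b:ℂ) * ‖u‖ ^ 2 + 0 * (inner ℝ (0:ℂ) u : ℝ)) =
      ((rexp (-b * ‖u‖ ^ 2) : ℝ) : ℂ) := fun u => by push_cast; simp
  simp_rw [e] at h1 h2
  refine ⟨by have := h1.re; simpa only [RCLike.re_eq_complex_re, Complex.ofReal_re] using this, ?_⟩
  rw [integral_complex_ofReal] at h2
  simp only [Complex.finrank_real_complex] at h2
  norm_num at h2
  simp only [neg_mul]
  exact_mod_cast h2

lemma gaussC_univ {b : ℝ} (hb : 0 < b) : gaussC b univ = 1 := by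
  obtain ⟨h1, h2⟩ := integral_exp_neg_mul_sq_norm hb
  have hp := Real.pi_pos
  unfold gaussC
  rw [withDensity_apply _ MeasurableSet.univ, Measure.restrict_univ,
    ← ofReal_integral_eq_lintegral_ofReal (h1.const_mul _)
      (Eventually.of_forall fun u => by positivity), integral_const_mul, h2]
  rw [show b / π * (π / b) = 1 by field_simp]; simp

lemma isProbabilityMeasure_gaussC {b : ℝ} (hb : 0 < b) : IsProbabilityMeasure (gaussC b) :=
  ⟨gaussC_univ hb⟩

lemma integral_cis_gaussC {b : ℝ} (hb : 0 < b) (x : ℂ) :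
    ∫ u, cis (inner ℝ u x) ∂gaussC b = ((rexp (-‖x‖ ^ 2 / (4 * b)) : ℝ) : ℂ) := by
  have h2 := GaussianFourier.integral_cexp_neg_mul_sq_norm_add (V := ℂ) (b := (b : ℂ)) (by simpa)
    Complex.I x
  have hp : (π : ℂ) ≠ 0 := by exact_mod_cast Real.pi_ne_zero
  have hb' : (b : ℂ) ≠ 0 := by exact_mod_cast hb.ne'
  rw [integral_gaussC hb]
  have e : ∀ u : ℂ, (b / π * rexp (-b * ‖u‖ ^ 2)) • cis (inner ℝ u x) = (b / π : ℂ) *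
      Complex.exp (-(b:ℂ) * ‖u‖ ^ 2 + Complex.I * (inner ℝ x u : ℝ)) := fun u => by
    rw [Complex.exp_add, Complex.real_smul, real_inner_comm, cis]; push_cast; ring_nf
  simp_rw [e]
  rw [integral_const_mul, h2]
  simp only [Complex.finrank_real_complex]
  norm_num
  rw [← mul_assoc]
  rw [show (b / π : ℂ) * (π / b) = 1 by field_simp, one_mul]

lemma gaussC_ball_le {b U : ℝ} (hb : 0 < b) (hU : 0 ≤ U) :
    (gaussC b).real {u | ‖u‖ < U} ≤ b * U ^ 2 := by
  have hp := Real.pi_pos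
  refine ENNReal.toReal_le_of_le_ofReal (by positivity) ?_
  have hs : {u : ℂ | ‖u‖ < U} = Metric.ball 0 U := by ext; simp
  unfold gaussC
  rw [hs, withDensity_apply _ Metric.isOpen_ball.measurableSet]
  calc _ ≤ ∫⁻ _ in Metric.ball (0:ℂ) U, ENNReal.ofReal (b / π) := by
        refine lintegral_mono fun u => ENNReal.ofReal_le_ofReal ?_
        refine mul_le_of_le_one_right (by positivity) ?_
        rw [Real.exp_le_one_iff]
        have : 0 ≤ b * ‖u‖ ^ 2 := by positivity
        linarith
    _ = ENNReal.ofReal (b * U ^ 2) := by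
        rw [setLIntegral_const, Complex.volume_ball]
        have e : (NNReal.pi : ENNReal) = ENNReal.ofReal π := by
          rw [ENNReal.ofReal, ← NNReal.coe_real_pi, Real.toNNReal_coe]
        rw [e, ← ENNReal.ofReal_pow hU, ← ENNReal.ofReal_mul (by positivity),
          ← ENNReal.ofReal_mul (by positivity)]
        congr 1; field_simp

lemma gaussC_compl_ball_le {b U : ℝ} (hb : 0 < b) (hU : 0 ≤ U) :
    (gaussC b).real {u | U < ‖u‖} ≤ 2 * rexp (-b * U ^ 2 / 2) := by
  have hp := Real.pi_pos
  obtain ⟨h1, h2⟩ := integral_exp_neg_mul_sq_norm (half_pos hb)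
  refine ENNReal.toReal_le_of_le_ofReal (by positivity) ?_
  unfold gaussC
  rw [withDensity_apply _ (isOpen_lt continuous_const continuous_norm).measurableSet]
  calc _ ≤ ∫⁻ u in {u : ℂ | U < ‖u‖}, ENNReal.ofReal
          (b / π * rexp (-b * U ^ 2 / 2) * rexp (-(b / 2) * ‖u‖ ^ 2)) := by
        refine setLIntegral_mono (by fun_prop) fun u hu => ENNReal.ofReal_le_ofReal ?_
        rw [mul_assoc, ← Real.exp_add]
        have hu : U < ‖u‖ := hu
        have : b * U ^ 2 ≤ b * ‖u‖ ^ 2 := by gcongr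
        gcongr
        linarith
    _ ≤ ∫⁻ u, ENNReal.ofReal
          (b / π * rexp (-b * U ^ 2 / 2) * rexp (-(b / 2) * ‖u‖ ^ 2)) := setLIntegral_le_lintegral _ _
    _ = _ := by
        rw [← ofReal_integral_eq_lintegral_ofReal (h1.const_mul _)
          (Eventually.of_forall fun u => by positivity), integral_const_mul, h2]
        congr 1; field_simp

section

variable {n : ℕ} {f : ℝ → ℂ} {μ μ' : Measure ℝ}

lemma integral_gauss_swap {b : ℝ} (hb : 0 < b) [IsFiniteMeasure μ] [IsFiniteMeasure μ']
    (hf : Continuous f) (n : ℕ) (η : ℕ → ℂ) :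
    ((∫ p, (n:ℝ)⁻¹ * ∑ j ∈ Finset.range n, rexp (-‖f p.2 - f p.1 + η j‖ ^ 2 / (4 * b))
      ∂μ.prod μ' : ℝ) : ℂ) =
    ∫ u, ((n:ℝ)⁻¹ • ∑ j ∈ Finset.range n, cis (inner ℝ u (η j))) *
      ((∫ z, cis (-inner ℝ u (f z)) ∂μ) * (∫ z, cis (inner ℝ u (f z)) ∂μ')) ∂gaussC b := by
  have := isProbabilityMeasure_gaussC hb
  have hc : Continuous fun q : ℂ × (ℝ × ℝ) =>
      ((n:ℝ)⁻¹ • ∑ j ∈ Finset.range n, cis (inner ℝ q.1 (η j))) *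
        (cis (-inner ℝ q.1 (f q.2.1)) * cis (inner ℝ q.1 (f q.2.2))) := by
    have h1 : ∀ j, Continuous fun q : ℂ × (ℝ × ℝ) => cis (inner ℝ q.1 (η j)) := fun j =>
      continuous_cis.comp (by fun_prop)
    have h2 : Continuous fun q : ℂ × (ℝ × ℝ) => cis (-inner ℝ q.1 (f q.2.1)) :=
      continuous_cis.comp (by fun_prop)
    have h3 : Continuous fun q : ℂ × (ℝ × ℝ) => cis (inner ℝ q.1 (f q.2.2)) :=
      continuous_cis.comp (by fun_prop)
    fun_prop
  have hint : Integrable (Function.uncurry fun (u : ℂ) (p : ℝ × ℝ) =>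
      ((n:ℝ)⁻¹ • ∑ j ∈ Finset.range n, cis (inner ℝ u (η j))) *
        (cis (-inner ℝ u (f p.1)) * cis (inner ℝ u (f p.2)))) ((gaussC b).prod (μ.prod μ')) := by
    refine Integrable.of_bound (C := 1) hc.aestronglyMeasurable (Eventually.of_forall fun q => ?_)
    simp only [Function.uncurry]
    rw [norm_mul, norm_mul, norm_cis, norm_cis, mul_one, mul_one]
    exact norm_inv_smul_sum_le _ zero_le_one fun j => (norm_cis _).le
  have e1 : ∀ u : ℂ, ((n:ℝ)⁻¹ • ∑ j ∈ Finset.range n, cis (inner ℝ u (η j))) *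
      ((∫ z, cis (-inner ℝ u (f z)) ∂μ) * (∫ z, cis (inner ℝ u (f z)) ∂μ')) =
      ∫ p, ((n:ℝ)⁻¹ • ∑ j ∈ Finset.range n, cis (inner ℝ u (η j))) *
        (cis (-inner ℝ u (f p.1)) * cis (inner ℝ u (f p.2))) ∂μ.prod μ' := fun u => by
    rw [integral_const_mul, ← integral_prod_mul]
  simp_rw [e1]
  rw [integral_integral_swap hint, ← integral_complex_ofReal]
  refine integral_congr_ae (Eventually.of_forall fun p => ?_)
  simp only
  have e2 : ∀ u : ℂ, ((n:ℝ)⁻¹ • ∑ j ∈ Finset.range n, cis (inner ℝ u (η j))) *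
        (cis (-inner ℝ u (f p.1)) * cis (inner ℝ u (f p.2))) =
      (n:ℝ)⁻¹ • ∑ j ∈ Finset.range n, cis (inner ℝ u (f p.2 - f p.1 + η j)) := fun u => by
    rw [smul_mul_assoc, Finset.sum_mul]
    congr 1
    refine Finset.sum_congr rfl fun j _ => ?_
    rw [← cis_add, ← cis_add, inner_add_right, inner_sub_right]
    congr 1; ring
  simp_rw [e2]
  rw [integral_smul, integral_finsetSum]
  · simp_rw [integral_cis_gaussC hb]
    rw [Complex.real_smul]; push_cast; rfl
  · intro j _
    refine Integrable.of_bound (C := 1) (Continuous.aestronglyMeasurable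
      (continuous_cis.comp (by fun_prop))) (Eventually.of_forall fun q => (norm_cis _).le)

lemma integral_gauss_self {b : ℝ} (hb : 0 < b) [IsFiniteMeasure μ] (hf : Continuous f) :
    ∫ p, rexp (-‖f p.2 - f p.1‖ ^ 2 / (4 * b)) ∂μ.prod μ =
      ∫ u, ‖∫ z, cis (inner ℝ u (f z)) ∂μ‖ ^ 2 ∂gaussC b := by
  have h := integral_gauss_swap (μ := μ) (μ' := μ) hb hf 1 (fun _ => 0)
  simp only [Finset.sum_range_one, add_zero, Nat.cast_one, inv_one, one_mul, inner_zero_right,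
    one_smul] at h
  have c0 : cis 0 = 1 := by simp [cis]
  have e : ∀ u : ℂ, cis 0 * ((∫ z, cis (-inner ℝ u (f z)) ∂μ) * (∫ z, cis (inner ℝ u (f z)) ∂μ)) =
      ((‖∫ z, cis (inner ℝ u (f z)) ∂μ‖ ^ 2 : ℝ) : ℂ) := fun u => by
    simp_rw [← conj_cis]
    rw [integral_conj, c0, one_mul, mul_comm, Complex.mul_conj, Complex.normSq_eq_norm_sq]
  simp_rw [e] at h
  rw [integral_complex_ofReal] at h
  exact_mod_cast h

/-- If the exponential sums of the shifts `η j` are small at all relevant frequencies then the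
average Gaussian interaction energy is controlled by the self energies. -/
lemma integral_gauss_le {b s U0 U1 : ℝ} (hb : 0 < b) (hs : 0 ≤ s) (hU0 : 0 ≤ U0) (hU1 : 0 ≤ U1)
    [IsFiniteMeasure μ] [IsFiniteMeasure μ'] (hf : Continuous f) (η : ℕ → ℂ)
    (hη : ∀ u : ℂ, U0 ≤ ‖u‖ → ‖u‖ ≤ U1 →
      ‖(n:ℝ)⁻¹ • ∑ j ∈ Finset.range n, cis (inner ℝ u (η j))‖ ≤ s) :
    ∫ p, (n:ℝ)⁻¹ * ∑ j ∈ Finset.range n, rexp (-‖f p.2 - f p.1 + η j‖ ^ 2 / (4 * b)) ∂μ.prod μ' ≤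
      s / 2 * (∫ p, rexp (-‖f p.2 - f p.1‖ ^ 2 / (4 * b)) ∂μ.prod μ +
        ∫ p, rexp (-‖f p.2 - f p.1‖ ^ 2 / (4 * b)) ∂μ'.prod μ') +
      μ.real univ * μ'.real univ * (b * U0 ^ 2 + 2 * rexp (-b * U1 ^ 2 / 2)) := by
  have := isProbabilityMeasure_gaussC hb
  rw [integral_gauss_self hb hf, integral_gauss_self hb hf]
  have hcP : ∀ (ν : Measure ℝ) [IsFiniteMeasure ν],
      Continuous fun u : ℂ => ∫ z, cis (inner ℝ u (f z)) ∂ν := fun ν _ => by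
    refine continuous_of_dominated (bound := fun _ => 1) (fun u => ?_)
      (fun u => Eventually.of_forall fun z => (norm_cis _).le) (integrable_const _)
      (Eventually.of_forall fun z => ?_)
    · exact (continuous_cis.comp (by fun_prop)).aestronglyMeasurable
    · exact continuous_cis.comp (by fun_prop)
  have hbP : ∀ (ν : Measure ℝ) [IsFiniteMeasure ν] (u : ℂ),
      ‖∫ z, cis (inner ℝ u (f z)) ∂ν‖ ≤ ν.real univ := fun ν _ u => by
    have := norm_integral_le_of_norm_le_const (μ := ν) (C := 1)
      (Eventually.of_forall fun z => (norm_cis (inner ℝ u (f z))).le)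
    simpa using this
  have hiP : ∀ (ν : Measure ℝ) [IsFiniteMeasure ν],
      Integrable (fun u : ℂ => ‖∫ z, cis (inner ℝ u (f z)) ∂ν‖ ^ 2) (gaussC b) := fun ν _ => by
    refine Integrable.of_bound (C := ν.real univ ^ 2) ((hcP ν).norm.pow 2).aestronglyMeasurable
      (Eventually.of_forall fun u => ?_)
    rw [norm_pow, norm_norm]
    gcongr; exact hbP ν u
  set P : ℂ → ℂ := fun u => ∫ z, cis (inner ℝ u (f z)) ∂μ with hP
  set P' : ℂ → ℂ := fun u => ∫ z, cis (inner ℝ u (f z)) ∂μ' with hP'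
  set c := μ.real univ * μ'.real univ with hc
  have c0 : 0 ≤ c := by positivity
  have hm0 : MeasurableSet {u : ℂ | ‖u‖ < U0} :=
    (isOpen_lt continuous_norm continuous_const).measurableSet
  have hm1 : MeasurableSet {u : ℂ | U1 < ‖u‖} :=
    (isOpen_lt continuous_const continuous_norm).measurableSet
  set G : ℂ → ℝ := fun u => s / 2 * (‖P u‖ ^ 2 + ‖P' u‖ ^ 2) +
    ({u : ℂ | ‖u‖ < U0}.indicator (fun _ => c) u + {u : ℂ | U1 < ‖u‖}.indicator (fun _ => c) u)
    with hG
  have i1 : Integrable (fun u => s / 2 * (‖P u‖ ^ 2 + ‖P' u‖ ^ 2)) (gaussC b) :=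
    ((hiP μ).add (hiP μ')).const_mul _
  have i2 : Integrable ({u : ℂ | ‖u‖ < U0}.indicator (fun _ => c)) (gaussC b) :=
    (integrable_const c).indicator hm0
  have i3 : Integrable ({u : ℂ | U1 < ‖u‖}.indicator (fun _ => c)) (gaussC b) :=
    (integrable_const c).indicator hm1
  have i23 : Integrable (fun u => {u : ℂ | ‖u‖ < U0}.indicator (fun _ => c) u +
      {u : ℂ | U1 < ‖u‖}.indicator (fun _ => c) u) (gaussC b) := i2.add i3
  have hGint : Integrable G (gaussC b) := i1.add i23
  have hGval : ∫ u, G u ∂gaussC b = s / 2 * (∫ u, ‖P u‖ ^ 2 ∂gaussC b + ∫ u, ‖P' u‖ ^ 2 ∂gaussC b) +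
      c * ((gaussC b).real {u | ‖u‖ < U0} + (gaussC b).real {u | U1 < ‖u‖}) := by
    simp only [hG]
    rw [integral_add i1 i23, integral_add i2 i3, integral_const_mul,
      integral_add (hiP μ) (hiP μ'), integral_indicator hm0, integral_indicator hm1]
    simp only [integral_const, measureReal_restrict_apply_univ, smul_eq_mul]
    ring
  have key : ∀ u : ℂ, ‖((n:ℝ)⁻¹ • ∑ j ∈ Finset.range n, cis (inner ℝ u (η j))) *
      ((∫ z, cis (-inner ℝ u (f z)) ∂μ) * P' u)‖ ≤ G u := by
    intro u
    have hconj : ‖∫ z, cis (-inner ℝ u (f z)) ∂μ‖ = ‖P u‖ := by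
      simp_rw [← conj_cis]
      rw [integral_conj, RCLike.norm_conj]
    have hΦ1 : ‖(n:ℝ)⁻¹ • ∑ j ∈ Finset.range n, cis (inner ℝ u (η j))‖ ≤ 1 :=
      norm_inv_smul_sum_le _ zero_le_one fun j => (norm_cis _).le
    rw [norm_mul, norm_mul, hconj]
    have n0 := norm_nonneg (P u)
    have n1 := norm_nonneg (P' u)
    have hpc : ‖P u‖ * ‖P' u‖ ≤ c := mul_le_mul (hbP μ u) (hbP μ' u) n1 (by positivity)
    have j0 : 0 ≤ {u : ℂ | ‖u‖ < U0}.indicator (fun _ => c) u := indicator_nonneg (fun _ _ => c0) u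
    have j1 : 0 ≤ {u : ℂ | U1 < ‖u‖}.indicator (fun _ => c) u := indicator_nonneg (fun _ _ => c0) u
    have j2 : 0 ≤ s / 2 * (‖P u‖ ^ 2 + ‖P' u‖ ^ 2) := by positivity
    have triv : ‖(n:ℝ)⁻¹ • ∑ j ∈ Finset.range n, cis (inner ℝ u (η j))‖ * (‖P u‖ * ‖P' u‖) ≤ c :=
      (mul_le_of_le_one_left (by positivity) hΦ1).trans hpc
    simp only [hG]
    by_cases h0 : ‖u‖ < U0
    · have : {u : ℂ | ‖u‖ < U0}.indicator (fun _ => c) u = c := indicator_of_mem (s := {u : ℂ | ‖u‖ < U0}) h0 _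
      linarith
    by_cases h1 : U1 < ‖u‖
    · have : {u : ℂ | U1 < ‖u‖}.indicator (fun _ => c) u = c := indicator_of_mem (s := {u : ℂ | U1 < ‖u‖}) h1 _
      linarith
    · have := hη u (not_lt.1 h0) (not_lt.1 h1)
      calc _ ≤ s * (‖P u‖ * ‖P' u‖) := by gcongr
        _ ≤ s / 2 * (‖P u‖ ^ 2 + ‖P' u‖ ^ 2) := by nlinarith [sq_nonneg (‖P u‖ - ‖P' u‖)]
        _ ≤ _ := by linarith
  have swap := integral_gauss_swap (μ := μ) (μ' := μ') hb hf n η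
  calc _ ≤ ‖((∫ p, (n:ℝ)⁻¹ * ∑ j ∈ Finset.range n, rexp (-‖f p.2 - f p.1 + η j‖ ^ 2 / (4 * b))
      ∂μ.prod μ' : ℝ) : ℂ)‖ := by rw [Complex.norm_real]; exact le_abs_self _
    _ ≤ ∫ u, G u ∂gaussC b := by
        rw [swap]
        exact norm_integral_le_of_norm_le hGint (Eventually.of_forall key)
    _ ≤ _ := by
        rw [hGval]
        have a0 := gaussC_ball_le hb hU0
        have a1 := gaussC_compl_ball_le hb hU1
        gcongr

end

/-- The real power `2 ^ x` as an extended nonnegative real. -/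
def tp (x : ℝ) : ℝ≥0∞ := ENNReal.ofReal ((2 : ℝ) ^ x)

lemma tp_add (x y : ℝ) : tp (x + y) = tp x * tp y := by
  unfold tp; rw [Real.rpow_add two_pos, ENNReal.ofReal_mul (by positivity)]

lemma tp_mono {x y : ℝ} (h : x ≤ y) : tp x ≤ tp y :=
  ENNReal.ofReal_le_ofReal (Real.rpow_le_rpow_of_exponent_le one_le_two h)

lemma tp_pos (x : ℝ) : 0 < tp x := by unfold tp; positivity

lemma tp_ne_top (x : ℝ) : tp x ≠ ∞ := ENNReal.ofReal_ne_top

lemma tp_natCast (n : ℕ) : tp n = 2 ^ n := by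
  unfold tp; rw [Real.rpow_natCast, ENNReal.ofReal_pow zero_le_two]; simp

lemma eventually_const_mul_tp_le {C : ℝ≥0∞} (hC : C ≠ ∞) {x y : ℝ} (h : x < y) :
    ∀ᶠ n : ℕ in atTop, C * tp (-(y * n)) ≤ tp (-(x * n)) := by
  obtain ⟨k, hk⟩ := ENNReal.exists_nat_gt hC
  have hk2 : C ≤ tp k := by
    rw [tp_natCast]
    exact hk.le.trans (by exact_mod_cast Nat.lt_two_pow_self.le)
  have : ∀ᶠ n : ℕ in atTop, (k : ℝ) / (y - x) ≤ n :=
    (tendsto_natCast_atTop_atTop (R := ℝ)).eventually_ge_atTop _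
  filter_upwards [this] with n hn
  rw [div_le_iff₀ (by linarith)] at hn
  calc C * tp (-(y * n)) ≤ tp k * tp (-(y * n)) := by gcongr
    _ = tp (k + -(y * n)) := (tp_add _ _).symm
    _ ≤ _ := tp_mono (by linarith)

/-- The sets `A n` have exponentially small measure in the unit interval. -/
def ExpSmall (A : ℕ → Set ℝ) : Prop :=
  ∃ c > 0, ∀ᶠ n : ℕ in atTop, volume (A n ∩ Ico 0 1) ≤ tp (-(c * n))

lemma ExpSmall.mono {A A' : ℕ → Set ℝ} (h : ExpSmall A) (hA : ∀ᶠ n in atTop, A' n ⊆ A n) :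
    ExpSmall A' := by
  obtain ⟨c, hc, h⟩ := h
  refine ⟨c, hc, ?_⟩
  filter_upwards [h, hA] with n h1 h2
  exact (measure_mono (by gcongr)).trans h1

lemma ExpSmall.of_le {A : ℕ → Set ℝ} {C : ℝ≥0∞} (hC : C ≠ ∞) {c : ℝ} (hc : 0 < c)
    (h : ∀ᶠ n : ℕ in atTop, volume (A n ∩ Ico 0 1) ≤ C * tp (-(c * n))) : ExpSmall A := by
  refine ⟨c / 2, by positivity, ?_⟩
  filter_upwards [h, eventually_const_mul_tp_le hC (half_lt_self hc)] with n h1 h2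
  exact h1.trans h2

lemma ExpSmall.of_volume_le {A A' : ℕ → Set ℝ} {C : ℝ≥0∞} (hC : C ≠ ∞) (hA : ExpSmall A)
    (h : ∀ᶠ n : ℕ in atTop, volume (A' n ∩ Ico 0 1) ≤ C * volume (A n ∩ Ico 0 1)) :
    ExpSmall A' := by
  obtain ⟨c, hc, hA⟩ := hA
  refine .of_le hC hc ?_
  filter_upwards [h, hA] with n h1 h2
  exact h1.trans (by gcongr)

lemma ExpSmall.union {A A' : ℕ → Set ℝ} (h : ExpSmall A) (h' : ExpSmall A') :
    ExpSmall fun n => A n ∪ A' n := by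
  obtain ⟨c, hc, h⟩ := h
  obtain ⟨c', hc', h'⟩ := h'
  refine .of_le (C := 2) (by simp) (c := min c c') (lt_min hc hc') ?_
  filter_upwards [h, h'] with n h1 h2
  rw [union_inter_distrib_right, two_mul]
  refine (measure_union_le _ _).trans (add_le_add (h1.trans (tp_mono ?_)) (h2.trans (tp_mono ?_)))
  · have := min_le_left c c'; gcongr
  · have := min_le_right c c'; gcongr

lemma ExpSmall.comp_mul {A : ℕ → Set ℝ} (h : ExpSmall A) {k : ℕ} (hk : 1 ≤ k) :
    ExpSmall fun n => A (k * n) := by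
  obtain ⟨c, hc, h⟩ := h
  refine ⟨c, hc, ?_⟩
  have hk' : (1:ℝ) ≤ k := by exact_mod_cast hk
  filter_upwards [(tendsto_id.const_mul_atTop' hk).eventually h] with n hn
  refine hn.trans (tp_mono ?_)
  simp only [id, Nat.cast_mul]
  have : (n:ℝ) ≤ k * n := le_mul_of_one_le_left (by positivity) hk'
  nlinarith

lemma ExpSmall.comp_div {A : ℕ → Set ℝ} (h : ExpSmall A) {k : ℕ} (hk : 1 ≤ k) :
    ExpSmall fun n => A (n / k) := by
  obtain ⟨c, hc, h⟩ := h
  have hk' : (0:ℝ) < k := by exact_mod_cast hk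
  refine .of_le (C := tp c) (tp_ne_top _) (c := c / k) (by positivity) ?_
  filter_upwards [(Nat.tendsto_div_const_atTop (n := k) (by omega)).eventually h] with n hn
  refine hn.trans ?_
  rw [← tp_add]
  refine tp_mono ?_
  have h1 : n < k * (n / k) + k := by
    have := Nat.div_add_mod n k; have := Nat.mod_lt n hk; omega
  have h2 : (n:ℝ) / k ≤ (n / k : ℕ) + 1 := by
    rw [div_le_iff₀ hk']
    have : (n:ℝ) < k * (n / k : ℕ) + k := by exact_mod_cast h1
    linarith
  have h3 : c / k * n = c * (n / k) := by ring
  rw [h3]; nlinarith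

/-- The points `y'` such that the point `(y', wf y')` of the graph of `wf` is `ρ`-close to
`(y, wf y)`. -/
def Bset (ρ y : ℝ) : Set ℝ := {y' | |y' - y| ≤ ρ ∧ ‖wf y' - wf y‖ ≤ ρ}

lemma measurableSet_Bset_prod (ρ : ℝ) : MeasurableSet {p : ℝ × ℝ | p.2 ∈ Bset ρ p.1} := by
  have := continuous_wf
  refine (IsClosed.inter ?_ ?_).measurableSet
  · exact isClosed_le (f := fun p : ℝ × ℝ => |p.2 - p.1|) (by fun_prop) continuous_const
  · exact isClosed_le (f := fun p : ℝ × ℝ => ‖wf p.2 - wf p.1‖) (by fun_prop) continuous_const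

lemma measurableSet_Bset (ρ y : ℝ) : MeasurableSet (Bset ρ y) :=
  measurable_prodMk_left (measurableSet_Bset_prod ρ)

lemma measurable_volume_Bset (ρ : ℝ) : Measurable fun y => volume (Bset ρ y) :=
  measurable_measure_prodMk_left (measurableSet_Bset_prod ρ)

lemma Bset_mono {ρ ρ' : ℝ} (h : ρ ≤ ρ') (y : ℝ) : Bset ρ y ⊆ Bset ρ' y :=
  fun _ hy => ⟨hy.1.trans h, hy.2.trans h⟩

lemma mem_Bset_comm {ρ y y' : ℝ} : y' ∈ Bset ρ y ↔ y ∈ Bset ρ y' := by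
  simp only [Bset, mem_ofPred_eq, abs_sub_comm, norm_sub_rev]

lemma Bset_subset_Icc (ρ y : ℝ) : Bset ρ y ⊆ Icc (y - ρ) (y + ρ) := fun y' hy => by
  have := abs_le.1 hy.1; constructor <;> linarith

lemma volume_Bset_le (ρ y : ℝ) : volume (Bset ρ y) ≤ ENNReal.ofReal (2 * ρ) := by
  refine (measure_mono (Bset_subset_Icc ρ y)).trans ?_
  rw [Real.volume_Icc]; exact ENNReal.ofReal_le_ofReal (by linarith)

lemma volume_Bset_ne_top (ρ y : ℝ) : volume (Bset ρ y) ≠ ∞ :=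
  ((volume_Bset_le ρ y).trans_lt ENNReal.ofReal_lt_top).ne

lemma volume_Bset_add_int (ρ y : ℝ) (k : ℤ) : volume (Bset ρ (y + k)) = volume (Bset ρ y) := by
  have : Bset ρ y = (fun x => x + (k:ℝ)) ⁻¹' Bset ρ (y + k) := by
    ext x
    simp only [Bset, mem_preimage, mem_ofPred_eq, wf_add_int, add_sub_add_right_eq_sub]
  rw [this, measure_preimage_add_right]

lemma lintegral_biUnion_finset_le {α ι : Type*} [MeasurableSpace α] {μ : Measure α}
    (t : Finset ι) (s : ι → Set α) (f : α → ℝ≥0∞) :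
    ∫⁻ x in ⋃ i ∈ t, s i, f x ∂μ ≤ ∑ i ∈ t, ∫⁻ x in s i, f x ∂μ := by
  classical
  induction t using Finset.induction_on with
  | empty => simp
  | insert i t hi ih =>
    rw [Finset.set_biUnion_insert, Finset.sum_insert hi]
    exact (lintegral_union_le _ _ _).trans (by gcongr)

/-- For fixed `y'`, the reciprocal of the measure of `Bset ρ y`, integrated over the `y` close
to `y'`, is bounded by a universal constant. -/
lemma exists_lintegral_inv_volume_Bset_le : ∃ C : ℕ, ∀ ρ : ℝ, 0 < ρ → ∀ y' : ℝ,
    ∫⁻ y in Bset ρ y', (volume (Bset ρ y))⁻¹ ≤ C := by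
  obtain ⟨t, -, htf, ht⟩ := (isCompact_closedBall (0 : ℝ × ℂ) 1).finite_cover_balls
    (e := 1 / 2) (by norm_num)
  refine ⟨htf.toFinset.card, fun ρ hρ y' => ?_⟩
  set φ : ℝ → ℝ × ℂ := fun y => (ρ⁻¹ * (y - y'), (ρ⁻¹ : ℝ) • (wf y - wf y')) with hφ
  have hφc : Continuous φ := by have := continuous_wf; fun_prop
  set A : ℝ × ℂ → Set ℝ := fun c => φ ⁻¹' Metric.ball c (1 / 2) with hA
  have hAo : ∀ c, MeasurableSet (A c) := fun c => (Metric.isOpen_ball.preimage hφc).measurableSet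
  have hsub : Bset ρ y' ⊆ ⋃ c ∈ htf.toFinset, A c := by
    intro y hy
    have h1 : φ y ∈ Metric.closedBall (0 : ℝ × ℂ) 1 := by
      rw [mem_closedBall_zero_iff, Prod.norm_def, max_le_iff]
      simp only [hφ, norm_smul, norm_mul, Real.norm_eq_abs, abs_inv, abs_of_pos hρ]
      rw [inv_mul_le_one₀ hρ, inv_mul_le_one₀ hρ]
      exact hy
    obtain ⟨c, hc, hyc⟩ := mem_iUnion₂.1 (ht h1)
    exact mem_iUnion₂.2 ⟨c, by simpa using hc, hyc⟩
  have hcell : ∀ c, ∫⁻ y in A c, (volume (Bset ρ y))⁻¹ ≤ 1 := by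
    intro c
    have h1 : ∀ y ∈ A c, A c ⊆ Bset ρ y := by
      intro y hy x hx
      have h2 : dist (φ x) (φ y) ≤ 1 := by
        have := dist_triangle_right (φ x) (φ y) c
        have hx' : dist (φ x) c < 1 / 2 := hx
        have hy' : dist (φ y) c < 1 / 2 := hy
        linarith
      rw [dist_eq_norm, Prod.norm_def, max_le_iff] at h2
      simp only [hφ, Prod.fst_sub, Prod.snd_sub, ← mul_sub, ← smul_sub, sub_sub_sub_cancel_right,
        norm_smul, norm_mul, Real.norm_eq_abs, abs_inv, abs_of_pos hρ] at h2
      rw [inv_mul_le_one₀ hρ, inv_mul_le_one₀ hρ] at h2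
      exact h2
    calc ∫⁻ y in A c, (volume (Bset ρ y))⁻¹ ≤ ∫⁻ _ in A c, (volume (A c))⁻¹ :=
          setLIntegral_mono measurable_const fun y hy =>
            ENNReal.inv_le_inv.2 (measure_mono (h1 y hy))
      _ = (volume (A c))⁻¹ * volume (A c) := setLIntegral_const _ _
      _ ≤ 1 := ENNReal.inv_mul_le_one _
  calc ∫⁻ y in Bset ρ y', (volume (Bset ρ y))⁻¹
      ≤ ∫⁻ y in ⋃ c ∈ htf.toFinset, A c, (volume (Bset ρ y))⁻¹ := lintegral_mono_set hsub
    _ ≤ ∑ c ∈ htf.toFinset, ∫⁻ y in A c, (volume (Bset ρ y))⁻¹ := by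
        exact lintegral_biUnion_finset_le _ _ _
    _ ≤ ∑ c ∈ htf.toFinset, 1 := Finset.sum_le_sum fun c _ => hcell c
    _ = _ := by simp

/-- The part of a periodic set in an interval of integer length. -/
lemma volume_inter_Ico_le {E : Set ℝ} (hE : ∀ (x : ℝ) (k : ℤ), x + k ∈ E ↔ x ∈ E) (a : ℤ)
    (n : ℕ) : volume (E ∩ Ico (a:ℝ) (a + n)) ≤ n * volume (E ∩ Ico 0 1) := by
  induction n with
  | zero => simp
  | succ n ih =>
    have h1 : Ico (a:ℝ) (a + (n + 1 : ℕ)) ⊆ Ico (a:ℝ) (a + n) ∪ Ico (a + n) (a + n + 1) := by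
      push_cast; rw [← add_assoc]; exact Ico_subset_Ico_union_Ico
    have h2 : volume (E ∩ Ico ((a:ℝ) + n) (a + n + 1)) = volume (E ∩ Ico 0 1) := by
      have : (fun x => x + ((a + n : ℤ):ℝ)) ⁻¹' (E ∩ Ico ((a:ℝ) + n) (a + n + 1)) = E ∩ Ico 0 1 := by
        ext x
        simp only [preimage_inter, mem_inter_iff, mem_preimage, hE, mem_Ico]
        push_cast
        constructor <;> rintro ⟨h, h', h''⟩ <;> refine ⟨h, ?_, ?_⟩ <;> linarith
      rw [← this, measure_preimage_add_right]
    calc _ ≤ volume (E ∩ (Ico (a:ℝ) (a + n) ∪ Ico (a + n) (a + n + 1))) := by gcongr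
      _ ≤ volume (E ∩ Ico (a:ℝ) (a + n)) + volume (E ∩ Ico ((a:ℝ) + n) (a + n + 1)) := by
        rw [inter_union_distrib_left]; exact measure_union_le _ _
      _ ≤ n * volume (E ∩ Ico 0 1) + volume (E ∩ Ico 0 1) := by rw [h2]; gcongr
      _ = _ := by push_cast; ring

/-- A maximal inequality: few points `y` see a substantial portion of `Bset ρ y` covered by a
small periodic set. -/
lemma exists_volume_density_le : ∃ C : ℕ, ∀ ρ : ℝ, 0 < ρ → ρ ≤ 1 → ∀ E : Set ℝ,
    MeasurableSet E → (∀ (x : ℝ) (k : ℤ), x + k ∈ E ↔ x ∈ E) →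
    volume ({y | volume (Bset ρ y) < 2 * volume (Bset ρ y ∩ E)} ∩ Ico 0 1) ≤
      C * volume (E ∩ Ico 0 1) := by
  obtain ⟨C, hC⟩ := exists_lintegral_inv_volume_Bset_le
  refine ⟨2 * (C * 4), fun ρ hρ hρ1 E hE hper => ?_⟩
  have hv := measurable_volume_Bset ρ
  set F : ℝ → ℝ → ℝ≥0∞ := fun y y' =>
    {p : ℝ × ℝ | p.2 ∈ Bset ρ p.1}.indicator (fun p => (volume (Bset ρ p.1))⁻¹) (y, y') with hF
  have hFm : Measurable (Function.uncurry F) :=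
    (hv.comp measurable_fst).inv.indicator (measurableSet_Bset_prod ρ)
  set E' := E ∩ Ico ((-1 : ℤ):ℝ) ((-1 : ℤ) + (4 : ℕ)) with hE'
  have hE'm : MeasurableSet E' := hE.inter measurableSet_Ico
  have h1 : ∀ y ∈ {y | volume (Bset ρ y) < 2 * volume (Bset ρ y ∩ E)} ∩ Ico 0 1,
      1 ≤ 2 * ∫⁻ y' in E', F y y' := by
    rintro y ⟨hy, hy0, hy1⟩
    have e1 : Bset ρ y ∩ E' = Bset ρ y ∩ E := by
      refine Subset.antisymm (by gcongr; exact inter_subset_left) ?_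
      rintro x ⟨hx, hxE⟩
      have := abs_le.1 hx.1
      refine ⟨hx, hxE, ?_, ?_⟩ <;> push_cast <;> linarith
    have e2 : ∫⁻ y' in E', F y y' = (volume (Bset ρ y))⁻¹ * volume (Bset ρ y ∩ E) := by
      have : F y = (Bset ρ y).indicator fun _ => (volume (Bset ρ y))⁻¹ := by
        ext y'; simp [hF, indicator]
      rw [this, lintegral_indicator (measurableSet_Bset ρ y), setLIntegral_const,
        Measure.restrict_apply (measurableSet_Bset ρ y), e1]
    have hy' : volume (Bset ρ y) < 2 * volume (Bset ρ y ∩ E) := hy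
    have hpos : volume (Bset ρ y) ≠ 0 := by
      intro h0
      have : volume (Bset ρ y ∩ E) = 0 := measure_mono_null inter_subset_left h0
      rw [this, mul_zero] at hy'
      exact not_lt_bot hy'
    rw [e2, mul_left_comm, ← ENNReal.inv_mul_cancel hpos (volume_Bset_ne_top ρ y)]
    gcongr
  calc volume ({y | volume (Bset ρ y) < 2 * volume (Bset ρ y ∩ E)} ∩ Ico 0 1)
      = ∫⁻ y in {y | volume (Bset ρ y) < 2 * volume (Bset ρ y ∩ E)} ∩ Ico 0 1, 1 := by simp
    _ ≤ ∫⁻ y in {y | volume (Bset ρ y) < 2 * volume (Bset ρ y ∩ E)} ∩ Ico 0 1,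
          2 * ∫⁻ y' in E', F y y' := setLIntegral_mono
            (hFm.lintegral_prod_right'.const_mul 2) h1
    _ ≤ ∫⁻ y, 2 * ∫⁻ y' in E', F y y' := setLIntegral_le_lintegral _ _
    _ = 2 * ∫⁻ y' in E', ∫⁻ y, F y y' := by
        rw [← lintegral_lintegral_swap hFm.aemeasurable]
        exact lintegral_const_mul _ hFm.lintegral_prod_right'
    _ ≤ 2 * ∫⁻ y' in E', C := by
        gcongr with y'
        have : (fun y => F y y') = (Bset ρ y').indicator fun y => (volume (Bset ρ y))⁻¹ := by
          ext y
          by_cases h : y' ∈ Bset ρ y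
          · simp [hF, h, mem_Bset_comm.1 h]
          · simp [hF, h, mem_Bset_comm.not.1 h]
        rw [this, lintegral_indicator (measurableSet_Bset ρ y')]
        exact hC ρ hρ y'
    _ ≤ 2 * (C * ((4 : ℕ) * volume (E ∩ Ico 0 1))) := by
        rw [setLIntegral_const]
        gcongr
        exact volume_inter_Ico_le hper (-1) 4
    _ = _ := by push_cast; ring

/-- Decomposition of the unit interval into `N` intervals of equal length. -/
lemma volume_inter_Ico_le_sum {N : ℕ} (hN : 0 < N) (S : Set ℝ) :
    volume (S ∩ Ico 0 1) ≤
      (N : ℝ≥0∞)⁻¹ * ∑ b ∈ Finset.range N, volume ({z : ℝ | (b + z) / N ∈ S} ∩ Ico 0 1) := by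
  have hN' : (0:ℝ) < N := by exact_mod_cast hN
  have h1 : S ∩ Ico 0 1 ⊆ ⋃ b ∈ Finset.range N, S ∩ Ico ((b:ℝ) / N) ((b + 1) / N) := by
    rintro y ⟨hy, hy0, hy1⟩
    refine mem_iUnion₂.2 ⟨⌊N * y⌋₊, ?_, hy, ?_, ?_⟩
    · rw [Finset.mem_range, Nat.floor_lt (by positivity)]; nlinarith
    · rw [div_le_iff₀ hN']
      linarith [Nat.floor_le (show 0 ≤ N * y by positivity)]
    · rw [lt_div_iff₀ hN']
      linarith [Nat.lt_floor_add_one (N * y)]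
  refine (measure_mono h1).trans ((measure_biUnion_finset_le _ _).trans ?_)
  rw [Finset.mul_sum]
  refine Finset.sum_le_sum fun b _ => le_of_eq ?_
  have h2 : {z : ℝ | (b + z) / N ∈ S} ∩ Ico 0 1 =
      (fun z => z * (N:ℝ)⁻¹) ⁻¹' ((fun z => z + (b:ℝ) / N) ⁻¹' (S ∩ Ico ((b:ℝ) / N) ((b + 1) / N))) := by
    ext z
    have e : z * (N:ℝ)⁻¹ + b / N = (b + z) / N := by field_simp; ring
    simp only [mem_inter_iff, mem_ofPred_eq, mem_preimage, e, mem_Ico]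
    rw [div_le_div_iff_of_pos_right hN', div_lt_div_iff_of_pos_right hN']
    constructor <;> rintro ⟨h, h', h''⟩ <;> refine ⟨h, ?_, ?_⟩ <;> linarith
  rw [h2, Real.volume_preimage_mul_right (by positivity), measure_preimage_add_right, inv_inv,
    abs_of_pos hN', ENNReal.ofReal_natCast, ← mul_assoc,
    ENNReal.inv_mul_cancel (by simpa using hN.ne') (by simp), one_mul]

lemma volume_preimage_mul_inter_Ico_le {N : ℕ} (hN : 0 < N) {E : Set ℝ}
    (hper : ∀ (x : ℝ) (k : ℤ), x + k ∈ E ↔ x ∈ E) :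
    volume ({y : ℝ | N * y ∈ E} ∩ Ico 0 1) ≤ volume (E ∩ Ico 0 1) := by
  have hN' : (N:ℝ) ≠ 0 := by exact_mod_cast hN.ne'
  refine (volume_inter_Ico_le_sum hN _).trans ?_
  have : ∀ b ∈ Finset.range N, volume ({z : ℝ | (b + z) / N ∈ {y : ℝ | N * y ∈ E}} ∩ Ico 0 1) =
      volume (E ∩ Ico 0 1) := fun b _ => by
    congr 2; ext z
    have := hper z b
    simp only [mem_ofPred_eq]
    rw [mul_div_cancel₀ _ hN', ← this, add_comm]; simp
  rw [Finset.sum_congr rfl this, Finset.sum_const, Finset.card_range, nsmul_eq_mul, ← mul_assoc,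
    ENNReal.inv_mul_cancel (by simpa using hN.ne') (by simp), one_mul]

lemma norm_Sf_le (M : ℕ) (x : ℝ) : ‖Sf M x‖ ≤ 2.5 := by
  refine (norm_sum_le _ _).trans ((Finset.sum_le_sum fun k _ => ?_).trans (sum_rr_pow_le M))
  rw [norm_smul, norm_ee, mul_one, Real.norm_of_nonneg (pow_nonneg rr_pos.le _)]

lemma norm_two_pi_I : ‖(2 * π * Complex.I : ℂ)‖ = 2 * π := by simp [abs_of_pos Real.pi_pos]

/-- Linearization of `Tf` on pairs of short intervals. -/
lemma norm_Tf_sub_sub_mul_Sf_le {M : ℕ} {K δ z z' c c' : ℝ} (hK : 1 ≤ K) (hδ0 : 0 ≤ δ) (hδ : δ ≤ 1)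
    (hz : |z - c| ≤ δ ^ 2) (hz' : |z' - c'| ≤ δ ^ 2) (hzz : |z' - z| ≤ K * δ)
    (hcc : |c' - c| ≤ 2 * K * δ) (x : ℝ) :
    ‖Tf M (x + z') - Tf M (x + z) - (c' - c : ℝ) * (2 * π * Complex.I * Sf M (x + c))‖ ≤
      180 * K ^ 2 * δ ^ 2 := by
  have hp := Real.pi_lt_d2
  have hp0 := Real.pi_pos
  have e : Tf M (x + z') - Tf M (x + z) - (c' - c : ℝ) * (2 * π * Complex.I * Sf M (x + c)) =
      (Tf M (x + z') - Tf M (x + z) - ((x + z') - (x + z) : ℝ) *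
        (2 * π * Complex.I * Sf M (x + z))) +
      (((z' - c') - (z - c) : ℝ) * (2 * π * Complex.I * Sf M (x + z)) +
        (c' - c : ℝ) * (2 * π * Complex.I * (Sf M (x + z) - Sf M (x + c)))) := by
    push_cast; ring
  have t1 := norm_Tf_sub_sub_le M (x + z') (x + z)
  rw [add_sub_add_left_eq_sub] at t1
  have t1' : |z' - z| ^ 2 ≤ K ^ 2 * δ ^ 2 := by
    rw [← mul_pow]; gcongr
  have t2 : ‖(((z' - c') - (z - c) : ℝ) : ℂ) * (2 * π * Complex.I * Sf M (x + z))‖ ≤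
      (2 * δ ^ 2) * (2 * 3.15 * 2.5) := by
    rw [norm_mul, norm_mul, norm_two_pi_I, Complex.norm_real, Real.norm_eq_abs]
    have := norm_Sf_le M (x + z)
    have h3 : |(z' - c') - (z - c)| ≤ 2 * δ ^ 2 := (abs_sub _ _).trans (by linarith)
    gcongr
  have t3 : ‖((c' - c : ℝ) : ℂ) * (2 * π * Complex.I * (Sf M (x + z) - Sf M (x + c)))‖ ≤
      (2 * K * δ) * (2 * 3.15 * (3.5 * δ ^ 2)) := by
    rw [norm_mul, norm_mul, norm_two_pi_I, Complex.norm_real, Real.norm_eq_abs]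
    have h3 := norm_Sf_sub_le M (x + z) (x + c)
    rw [add_sub_add_left_eq_sub] at h3
    have h4 : ‖Sf M (x + z) - Sf M (x + c)‖ ≤ 3.5 * δ ^ 2 := h3.trans (by gcongr)
    gcongr
  rw [e]
  refine (norm_add_le _ _).trans ?_
  have t4 := norm_add_le (((((z' - c') - (z - c) : ℝ) : ℂ) * (2 * π * Complex.I * Sf M (x + z))))
    (((c' - c : ℝ) : ℂ) * (2 * π * Complex.I * (Sf M (x + z) - Sf M (x + c))))
  rw [add_sub_add_left_eq_sub] at *
  have hd2 : 0 ≤ δ ^ 2 := by positivity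
  have h5 : K * δ * δ ^ 2 ≤ K * δ ^ 2 := by
    have : K * δ ≤ K := by nlinarith
    gcongr
  have h6 : K * δ ^ 2 ≤ K ^ 2 * δ ^ 2 := by
    have : K ≤ K ^ 2 := by nlinarith
    gcongr
  have h7 : δ ^ 2 ≤ K ^ 2 * δ ^ 2 := by
    have : 1 ≤ K ^ 2 := by nlinarith
    nlinarith
  nlinarith

lemma self_energy_le {G J : Set ℝ} (hG : MeasurableSet G) (hJ : MeasurableSet J) {ρ b v l : ℝ}
    (hb : 0 < b) (hρ : 0 ≤ ρ) (hv0 : 0 ≤ v) (hJt : volume J ≠ ⊤) (hJl : volume.real J ≤ l)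
    (hJd : ∀ z ∈ J, ∀ z' ∈ J, |z' - z| ≤ ρ) (hv : ∀ z ∈ G, volume.real (Bset ρ z) ≤ v) :
    ∫ p, rexp (-‖wf p.2 - wf p.1‖ ^ 2 / (4 * b)) ∂(volume.restrict (J ∩ G)).prod
      (volume.restrict (J ∩ G)) ≤ l * (v + l * rexp (-ρ ^ 2 / (4 * b))) := by
  have hJG : MeasurableSet (J ∩ G) := hJ.inter hG
  have hJGt : volume (J ∩ G) ≠ ⊤ := ((measure_mono inter_subset_left).trans_lt hJt.lt_top).ne
  have : IsFiniteMeasure (volume.restrict (J ∩ G)) := ⟨by simpa using hJGt.lt_top⟩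
  have hl : volume.real (J ∩ G) ≤ l := (measureReal_mono inter_subset_left hJt).trans hJl
  have hl0 : 0 ≤ l := measureReal_nonneg.trans hl
  have hw := continuous_wf
  have hint : Integrable (fun p : ℝ × ℝ => rexp (-‖wf p.2 - wf p.1‖ ^ 2 / (4 * b)))
      ((volume.restrict (J ∩ G)).prod (volume.restrict (J ∩ G))) := by
    refine Integrable.of_bound (C := 1) (Continuous.aestronglyMeasurable (by fun_prop))
      (Eventually.of_forall fun p => ?_)
    rw [Real.norm_of_nonneg (by positivity), Real.exp_le_one_iff, neg_div]
    have : 0 ≤ ‖wf p.2 - wf p.1‖ ^ 2 / (4 * b) := by positivity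
    linarith
  set e := rexp (-ρ ^ 2 / (4 * b)) with he
  have he0 : 0 ≤ e := by positivity
  rw [integral_prod _ hint]
  have inner_le : ∀ z ∈ J ∩ G, ∫ z' in J ∩ G, rexp (-‖wf z' - wf z‖ ^ 2 / (4 * b)) ≤ v + l * e := by
    intro z hz
    have hB := measurableSet_Bset ρ z
    have i1 : Integrable ((Bset ρ z).indicator fun _ => (1:ℝ)) (volume.restrict (J ∩ G)) :=
      (integrable_const _).indicator hB
    calc ∫ z' in J ∩ G, rexp (-‖wf z' - wf z‖ ^ 2 / (4 * b))
        ≤ ∫ z' in J ∩ G, ((Bset ρ z).indicator (fun _ => (1:ℝ)) z' + e) := by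
          refine setIntegral_mono_on ?_ (i1.add (integrable_const _)) hJG fun z' hz' => ?_
          · refine Integrable.of_bound (C := 1) (Continuous.aestronglyMeasurable (by fun_prop))
              (Eventually.of_forall fun p => ?_)
            rw [Real.norm_of_nonneg (by positivity), Real.exp_le_one_iff, neg_div]
            have : 0 ≤ ‖wf p - wf z‖ ^ 2 / (4 * b) := by positivity
            linarith
          · by_cases h : z' ∈ Bset ρ z
            · rw [indicator_of_mem h]
              have : rexp (-‖wf z' - wf z‖ ^ 2 / (4 * b)) ≤ 1 := by
                rw [Real.exp_le_one_iff, neg_div]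
                have : 0 ≤ ‖wf z' - wf z‖ ^ 2 / (4 * b) := by positivity
                linarith
              linarith
            · rw [indicator_of_notMem h, zero_add]
              have h1 : ρ < ‖wf z' - wf z‖ := by
                by_contra! h2
                exact h ⟨hJd z hz.1 z' hz'.1, h2⟩
              rw [he]
              gcongr
      _ = volume.real (Bset ρ z ∩ (J ∩ G)) + volume.real (J ∩ G) * e := by
          rw [integral_add i1 (integrable_const _), integral_indicator hB]
          simp [measureReal_restrict_apply, hB]
      _ ≤ v + l * e := by
          gcongr
          exact (measureReal_mono inter_subset_left (volume_Bset_ne_top _ _)).trans (hv z hz.2)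
  calc ∫ z in J ∩ G, ∫ z' in J ∩ G, rexp (-‖wf z' - wf z‖ ^ 2 / (4 * b))
      ≤ ∫ z in J ∩ G, (v + l * e) :=
        setIntegral_mono_on hint.integral_prod_left (integrable_const _) hJG inner_le
    _ = volume.real (J ∩ G) * (v + l * e) := by simp
    _ ≤ _ := by gcongr

/-- The pairs of good points at distance comparable to `K / 2 ^ m` that become close after
translation by `b`. -/
def farSet (G : Set ℝ) (m a : ℕ) (K : ℝ) (b : ℕ) : Set (ℝ × ℝ) :=
  {p | (p.1 ∈ G ∧ p.1 ∈ Ico 0 1) ∧ p.2 ∈ G ∧ K / 2 ^ m / 2 ^ a < |p.2 - p.1| ∧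
    |p.2 - p.1| ≤ K / 2 ^ m ∧
    ‖Tf (2 * m) (b + p.2) - Tf (2 * m) (b + p.1) + (wf p.2 - wf p.1)‖ ≤ K / 2 ^ (2 * m)}

lemma continuous_Tf (M : ℕ) : Continuous (Tf M) := by
  have h : ∀ c : ℝ, Continuous fun x : ℝ => ee (x / c) := fun c =>
    continuous_ee.comp (continuous_id.div_const c)
  unfold Tf
  exact continuous_finsetSum _ fun k _ => (h (2 ^ (k + 1))).const_smul (√2 ^ (k + 1))

lemma measurableSet_farSet {G : Set ℝ} (hG : MeasurableSet G) (m a : ℕ) (K : ℝ) (b : ℕ) :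
    MeasurableSet (farSet G m a K b) := by
  have h1 := continuous_wf
  have h2 := continuous_Tf (2 * m)
  refine ((measurable_fst hG).inter (measurable_fst measurableSet_Ico)).inter
    ((measurable_snd hG).inter (MeasurableSet.inter ?_ (MeasurableSet.inter ?_ ?_)))
  · exact measurableSet_lt (f := fun _ : ℝ × ℝ => K / 2 ^ m / 2 ^ a)
      (g := fun p : ℝ × ℝ => |p.2 - p.1|) measurable_const (by fun_prop)
  · exact measurableSet_le (f := fun p : ℝ × ℝ => |p.2 - p.1|) (by fun_prop) measurable_const
  · refine measurableSet_le (f := fun p : ℝ × ℝ => ‖Tf (2 * m) (b + p.2) - Tf (2 * m) (b + p.1) +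
      (wf p.2 - wf p.1)‖) (Continuous.measurable ?_) measurable_const
    fun_prop

/-- The half-open interval of length `2 ^ (-M)` with left endpoint `j / 2 ^ M`. -/
def cell (M : ℕ) (j : ℤ) : Set ℝ := Ico (j / 2 ^ M) ((j + 1) / 2 ^ M)

lemma volume_cell (M : ℕ) (j : ℤ) : volume (cell M j) = ENNReal.ofReal ((2 ^ M)⁻¹) := by
  rw [cell, Real.volume_Ico]; congr 1; field_simp; ring

lemma abs_sub_le_of_mem_cell {M : ℕ} {j : ℤ} {z z' : ℝ} (h : z ∈ cell M j) (h' : z' ∈ cell M j) :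
    |z' - z| ≤ (2 ^ M)⁻¹ := by
  have e : ((j:ℝ) + 1) / 2 ^ M = j / 2 ^ M + (2 ^ M)⁻¹ := by field_simp
  obtain ⟨h1, h2⟩ := h
  obtain ⟨h3, h4⟩ := h'
  rw [e] at h2 h4
  rw [abs_le]; constructor <;> linarith

lemma left_mem_cell (M : ℕ) (j : ℤ) : (j / 2 ^ M : ℝ) ∈ cell M j :=
  ⟨le_rfl, by gcongr; linarith⟩

/-- The total measure of the far pairs in a product of two cells. -/
lemma sum_volume_farSet_inter_le {G : Set ℝ} (hG : MeasurableSet G) {m a : ℕ} (ham : a ≤ m)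
    {K U0 U1 v : ℝ} (hK : 3 ≤ K) (hU0 : 2 ^ (48 * a) * 2 ^ m * 2 ^ a ≤ U0) (hU1' : 0 ≤ U1)
    (hU1 : (13 * K * U1) ^ 4 ≤ 2 ^ (10 * m))
    (hv0 : 0 ≤ v) (hv : ∀ z ∈ G, volume.real (Bset (200 * K ^ 2 * 2 ^ a / 2 ^ (2 * m)) z) ≤ v)
    (j j' : ℤ) :
    ∑ b ∈ Finset.range (2 ^ (2 * m)),
      volume.real (farSet G m a K b ∩ cell (2 * m) j ×ˢ cell (2 * m) j') ≤
    3 * (50 * (2 ^ (4 * a))⁻¹ * (v + (2 ^ (2 * m))⁻¹ * rexp (-4 ^ a)) +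
      (2 ^ (2 * m))⁻¹ * ((200 * K ^ 2) ^ 2 / 4 * (U0 / 2 ^ (2 * m)) ^ 2 +
        2 * rexp (-(200 * K ^ 2) ^ 2 / 8 * (U1 / 2 ^ (2 * m)) ^ 2))) := by
  set N : ℝ := 2 ^ (2 * m) with hN
  have hN0 : 0 < N := by positivity
  set κ := 200 * K ^ 2 with hκ
  have hκ0 : 0 < κ := by positivity
  by_cases hex : ∃ b : ℕ, (farSet G m a K b ∩ cell (2 * m) j ×ˢ cell (2 * m) j').Nonempty
  swap
  · push Not at hex
    rw [Finset.sum_eq_zero fun b _ => by rw [hex b]; simp]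
    positivity
  set δ : ℝ := (2 ^ m)⁻¹ with hδ
  have hδ0 : 0 < δ := by positivity
  have hδ1 : δ ≤ 1 := inv_le_one_of_one_le₀ (one_le_pow₀ one_le_two)
  have hδN : δ ^ 2 = N⁻¹ := by rw [hδ, hN, inv_pow, ← pow_mul, mul_comm]
  set c : ℝ := j / 2 ^ (2 * m) with hc
  set c' : ℝ := j' / 2 ^ (2 * m) with hc'
  have hz : ∀ z ∈ cell (2 * m) j, |z - c| ≤ δ ^ 2 := fun z h => by
    rw [hδN]; exact abs_sub_le_of_mem_cell (left_mem_cell _ _) h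
  have hz' : ∀ z ∈ cell (2 * m) j', |z - c'| ≤ δ ^ 2 := fun z h => by
    rw [hδN]; exact abs_sub_le_of_mem_cell (left_mem_cell _ _) h
  have hδa : δ ≤ (2 ^ a)⁻¹ := by rw [hδ]; gcongr; norm_num
  set α : ℝ := (2 ^ a)⁻¹ with hα
  have hα0 : 0 < α := by positivity
  have hcc : |c' - c| ≤ 2 * K * δ ∧ δ * α ≤ |c' - c| := by
    obtain ⟨b, ⟨z, z'⟩, ⟨-, -, hz1, hz2, -⟩, hzc, hzc'⟩ := hex
    have h1 := hz z hzc
    have h2 := hz' z' hzc'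
    simp only at hz1 hz2
    rw [div_eq_mul_inv] at hz2
    rw [div_eq_mul_inv, div_eq_mul_inv] at hz1
    have h3 : |(c' - c) - (z' - z)| ≤ 2 * δ ^ 2 := by
      rw [show (c' - c) - (z' - z) = (z - c) - (z' - c') by ring]
      exact (abs_sub _ _).trans (by linarith)
    have h4 := abs_sub_abs_le_abs_sub (c' - c) (z' - z)
    have h5 := abs_sub_abs_le_abs_sub (z' - z) (c' - c)
    rw [abs_sub_comm (z' - z)] at h5
    have h6 := mul_le_mul_of_nonneg_left hδa hδ0.le
    constructor
    · nlinarith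
    · nlinarith [mul_pos hδ0 hα0]
  set τ : ℂ := ((c' - c : ℝ) : ℂ) * (2 * π * Complex.I) with hτ
  have hτn : ‖τ‖ = |c' - c| * (2 * π) := by
    rw [hτ, norm_mul, norm_two_pi_I, Complex.norm_real, Real.norm_eq_abs]
  have hp := Real.pi_lt_d2
  have hp3 := Real.pi_gt_three
  set η : ℕ → ℂ := fun b => τ * Sf (2 * m) (b + c) with hη
  have hclose : ∀ b : ℕ, ∀ p ∈ farSet G m a K b ∩ cell (2 * m) j ×ˢ cell (2 * m) j',
      ‖wf p.2 - wf p.1 + η b‖ ≤ κ / N := by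
    rintro b ⟨z, z'⟩ ⟨⟨-, -, -, hz2, hz3⟩, hzc, hzc'⟩
    simp only at hz2 hz3 ⊢
    rw [div_eq_mul_inv] at hz2
    have h1 := norm_Tf_sub_sub_mul_Sf_le (M := 2 * m) (by linarith) hδ0.le hδ1 (hz z hzc)
      (hz' z' hzc') hz2 hcc.1 b
    rw [← mul_assoc, ← hτ, hδN] at h1
    have e : wf z' - wf z + η b = (Tf (2 * m) (b + z') - Tf (2 * m) (b + z) + (wf z' - wf z)) -
      (Tf (2 * m) (b + z') - Tf (2 * m) (b + z) - τ * Sf (2 * m) (b + c)) := by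
      simp only [hη]; ring
    rw [e]
    refine (norm_sub_le _ _).trans ((add_le_add hz3 h1).trans ?_)
    rw [div_eq_mul_inv, div_eq_mul_inv, ← add_mul]
    gcongr
    nlinarith
  set B : ℝ := κ ^ 2 / (4 * N ^ 2) with hB
  have hB0 : 0 < B := by positivity
  have h4B : 4 * B = (κ / N) ^ 2 := by rw [hB, div_pow]; field_simp
  have hJm : ∀ j, MeasurableSet (cell (2 * m) j) := fun j => measurableSet_Ico
  have hJt : ∀ j, volume (cell (2 * m) j) ≠ ⊤ := fun j => by rw [volume_cell]; simp
  have hJl : ∀ j, volume.real (cell (2 * m) j) ≤ N⁻¹ := fun j => by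
    rw [Measure.real, volume_cell, ENNReal.toReal_ofReal (by positivity)]
  have hfin : ∀ j, IsFiniteMeasure (volume.restrict (cell (2 * m) j ∩ G)) := fun j =>
    ⟨by simpa using (measure_mono inter_subset_left).trans_lt (hJt j).lt_top⟩
  have hself : ∀ j, ∫ p, rexp (-‖wf p.2 - wf p.1‖ ^ 2 / (4 * B))
      ∂(volume.restrict (cell (2 * m) j ∩ G)).prod (volume.restrict (cell (2 * m) j ∩ G)) ≤
      N⁻¹ * (v + N⁻¹ * rexp (-4 ^ a)) := fun j => by
    have h2a : (1:ℝ) ≤ 2 ^ a := one_le_pow₀ one_le_two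
    have := self_energy_le hG (hJm j) hB0 (ρ := κ * 2 ^ a / N) (by positivity) hv0 (hJt j) (hJl j)
      (fun z hz z' hz' => (abs_sub_le_of_mem_cell hz hz').trans (by
        rw [inv_eq_one_div]; gcongr
        have : 1 ≤ κ := by rw [hκ]; nlinarith
        nlinarith)) hv
    refine this.trans (le_of_eq ?_)
    congr 4
    rw [h4B, show (4:ℝ) = 2 ^ 2 by norm_num, ← pow_mul, mul_comm 2 a, pow_mul]
    field_simp
  set μ := volume.restrict (cell (2 * m) j ∩ G) with hμ
  set μ' := volume.restrict (cell (2 * m) j' ∩ G) with hμ'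
  have : IsFiniteMeasure μ := hfin j
  have : IsFiniteMeasure μ' := hfin j'
  have hU00 : 0 ≤ U0 := le_trans (by positivity) hU0
  have hmain := integral_gauss_le (μ := μ) (μ' := μ') (n := 2 ^ (2 * m)) (s := 50 * (2 ^ (4 * a))⁻¹)
    hB0 (by positivity) hU00 hU1' continuous_wf η (fun u hu0 hu1 => by
      set ζ := (starRingEnd ℂ) τ * u with hζ
      have hζn : ‖ζ‖ = |c' - c| * (2 * π) * ‖u‖ := by rw [hζ, norm_mul, RCLike.norm_conj, hτn]
      have hin : ∀ w : ℂ, inner ℝ u (τ * w) = inner ℝ ζ w := fun w => by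
        rw [Complex.inner, Complex.inner, hζ, map_mul, Complex.conj_conj]; congr 1; ring
      have h1 : 2 ^ (48 * a) ≤ ‖ζ‖ := by
        rw [hζn]
        calc (2:ℝ) ^ (48 * a) = (δ * α) * 1 * (2 ^ (48 * a) * 2 ^ m * 2 ^ a) := by
              rw [hδ, hα]; field_simp
          _ ≤ |c' - c| * (2 * π) * ‖u‖ := by
              gcongr
              · exact hcc.2
              · linarith
              · exact hU0.trans hu0
      have h2 : ‖ζ‖ ^ 4 ≤ 2 ^ (3 * (2 * m)) := by
        have h3 : ‖ζ‖ ≤ δ * (13 * K * U1) := by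
          rw [hζn]
          calc |c' - c| * (2 * π) * ‖u‖ ≤ (2 * K * δ) * 6.5 * U1 := by
                gcongr
                · exact hcc.1
                · linarith
            _ = _ := by ring
        calc ‖ζ‖ ^ 4 ≤ (δ * (13 * K * U1)) ^ 4 := by gcongr
          _ = δ ^ 4 * (13 * K * U1) ^ 4 := by ring
          _ ≤ δ ^ 4 * 2 ^ (10 * m) := by gcongr
          _ = _ := by
            rw [hδ, inv_pow, ← pow_mul, inv_mul_eq_div, div_eq_iff (by positivity), ← pow_add]
            congr 1; ring
      have := norm_expSum_le_two_pow c h1 h2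
      unfold expSum at this
      simp only [hη, hin]
      exact_mod_cast this)
  have hvol : ∀ b : ℕ, volume.real (farSet G m a K b ∩ cell (2 * m) j ×ˢ cell (2 * m) j') ≤
      3 * ∫ p, rexp (-‖wf p.2 - wf p.1 + η b‖ ^ 2 / (4 * B)) ∂μ.prod μ' := by
    intro b
    have hw := continuous_wf
    set A := farSet G m a K b ∩ cell (2 * m) j ×ˢ cell (2 * m) j' with hA
    have hAm : MeasurableSet A := (measurableSet_farSet hG m a K b).inter ((hJm j).prod (hJm j'))
    have hint : Integrable (fun p : ℝ × ℝ => rexp (-‖wf p.2 - wf p.1 + η b‖ ^ 2 / (4 * B)))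
        (μ.prod μ') := by
      refine Integrable.of_bound (C := 1) (Continuous.aestronglyMeasurable (by fun_prop))
        (Eventually.of_forall fun p => ?_)
      rw [Real.norm_of_nonneg (by positivity), Real.exp_le_one_iff, neg_div]
      have : 0 ≤ ‖wf p.2 - wf p.1 + η b‖ ^ 2 / (4 * B) := by positivity
      linarith
    have hvA : (μ.prod μ').real A = volume.real A := by
      rw [hμ, hμ', Measure.prod_restrict, measureReal_restrict_apply hAm, ← Measure.volume_eq_prod,
        inter_eq_left.2]
      rintro p ⟨⟨⟨h1, -⟩, h2, -⟩, h3, h4⟩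
      exact ⟨⟨h3, h1⟩, h4, h2⟩
    have hlow : ∀ p ∈ A, 1 / 3 ≤ rexp (-‖wf p.2 - wf p.1 + η b‖ ^ 2 / (4 * B)) := by
      intro p hpA
      have h1 := hclose b p hpA
      have h2 : -1 ≤ -‖wf p.2 - wf p.1 + η b‖ ^ 2 / (4 * B) := by
        rw [le_div_iff₀ (by positivity), h4B]
        have : ‖wf p.2 - wf p.1 + η b‖ ^ 2 ≤ (κ / N) ^ 2 := by gcongr
        linarith
      refine le_trans ?_ (Real.exp_le_exp.2 h2)
      rw [Real.exp_neg, inv_eq_one_div]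
      have := Real.exp_one_lt_d9
      have := Real.exp_pos 1
      gcongr
      linarith
    have h3 : (1 / 3) * (μ.prod μ').real A ≤
        ∫ p in A, rexp (-‖wf p.2 - wf p.1 + η b‖ ^ 2 / (4 * B)) ∂μ.prod μ' := by
      have := setIntegral_mono_on (integrable_const (1 / 3 : ℝ)).integrableOn hint.integrableOn hAm
        hlow
      rw [setIntegral_const, smul_eq_mul, mul_comm] at this
      exact this
    have h4 := setIntegral_le_integral (s := A) hint
      (Eventually.of_forall fun p => by positivity)
    rw [hvA] at h3
    linarith
  have hsum : ∑ b ∈ Finset.range (2 ^ (2 * m)),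
      volume.real (farSet G m a K b ∩ cell (2 * m) j ×ˢ cell (2 * m) j') ≤
      3 * (N * ∫ p, ((2 ^ (2 * m) : ℕ) : ℝ)⁻¹ * ∑ b ∈ Finset.range (2 ^ (2 * m)),
        rexp (-‖wf p.2 - wf p.1 + η b‖ ^ 2 / (4 * B)) ∂μ.prod μ') := by
    refine (Finset.sum_le_sum fun b _ => hvol b).trans (le_of_eq ?_)
    have hw := continuous_wf
    rw [← Finset.mul_sum, integral_const_mul, integral_finsetSum]
    · rw [← mul_assoc N, show N * ((2 ^ (2 * m) : ℕ) : ℝ)⁻¹ = 1 by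
        push_cast; exact mul_inv_cancel₀ hN0.ne', one_mul]
    · intro b _
      refine Integrable.of_bound (C := 1) (Continuous.aestronglyMeasurable (by fun_prop))
        (Eventually.of_forall fun p => ?_)
      rw [Real.norm_of_nonneg (by positivity), Real.exp_le_one_iff, neg_div]
      have : 0 ≤ ‖wf p.2 - wf p.1 + η b‖ ^ 2 / (4 * B) := by positivity
      linarith
  have hμl : ∀ j, (volume.restrict (cell (2 * m) j ∩ G)).real univ ≤ N⁻¹ := fun j => by
    rw [measureReal_restrict_apply_univ]
    exact (measureReal_mono inter_subset_left (hJt j)).trans (hJl j)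
  refine hsum.trans ?_
  gcongr
  have hE0 : 0 ≤ B * U0 ^ 2 + 2 * rexp (-B * U1 ^ 2 / 2) := by positivity
  calc N * ∫ p, ((2 ^ (2 * m) : ℕ) : ℝ)⁻¹ * ∑ b ∈ Finset.range (2 ^ (2 * m)),
        rexp (-‖wf p.2 - wf p.1 + η b‖ ^ 2 / (4 * B)) ∂μ.prod μ'
      ≤ N * (50 * (2 ^ (4 * a))⁻¹ / 2 * (N⁻¹ * (v + N⁻¹ * rexp (-4 ^ a)) +
          N⁻¹ * (v + N⁻¹ * rexp (-4 ^ a))) +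
          N⁻¹ * N⁻¹ * (B * U0 ^ 2 + 2 * rexp (-B * U1 ^ 2 / 2))) := by
        refine mul_le_mul_of_nonneg_left (hmain.trans ?_) hN0.le
        have h1 := hself j
        have h2 := hself j'
        have h3 := hμl j
        have h4 := hμl j'
        gcongr
    _ = 50 * (2 ^ (4 * a))⁻¹ * (v + N⁻¹ * rexp (-4 ^ a)) +
          N⁻¹ * (B * U0 ^ 2 + 2 * rexp (-B * U1 ^ 2 / 2)) := by
        field_simp; ring
    _ = _ := by
        have e1 : B * U0 ^ 2 = κ ^ 2 / 4 * (U0 / N) ^ 2 := by rw [hB]; field_simp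
        have e2 : -B * U1 ^ 2 / 2 = -κ ^ 2 / 8 * (U1 / N) ^ 2 := by rw [hB]; field_simp; ring
        rw [e1, e2]

lemma sqrt_two_pow_two_mul (m : ℕ) : (√2) ^ (2 * m) = 2 ^ m := by
  rw [pow_mul, Real.sq_sqrt zero_le_two]

/-- The scaling relation of the Weierstrass function. -/
lemma two_pow_mul_wf_sub (m : ℕ) (x y : ℝ) : (2 : ℂ) ^ m * (wf x - wf y) =
    Tf (2 * m) (2 ^ (2 * m) * x) - Tf (2 * m) (2 ^ (2 * m) * y) +
      (wf (2 ^ (2 * m) * x) - wf (2 ^ (2 * m) * y)) := by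
  have h1 := sqrt_two_pow_mul_wf (2 * m) x
  have h2 := sqrt_two_pow_mul_wf (2 * m) y
  rw [sqrt_two_pow_two_mul, Complex.real_smul] at h1 h2
  push_cast at h1 h2
  rw [mul_sub, h1, h2]; ring

lemma norm_two_pow_mul (m : ℕ) (w : ℂ) : ‖(2 : ℂ) ^ m * w‖ = 2 ^ m * ‖w‖ := by
  rw [norm_mul, norm_pow]; simp

lemma norm_wf_sub_le (m : ℕ) (x y : ℝ) :
    ‖wf x - wf y‖ ≤ (16 * (2 ^ (2 * m) * |x - y|) + 8) / 2 ^ m := by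
  rw [le_div_iff₀ (by positivity), mul_comm, ← norm_two_pow_mul, two_pow_mul_wf_sub]
  refine (norm_add_le _ _).trans (add_le_add ?_ ?_)
  · refine (norm_Tf_sub_le _ _ _).trans (le_of_eq ?_)
    rw [← mul_sub, abs_mul, abs_of_pos (by positivity)]
  · refine (norm_sub_le _ _).trans ?_
    linarith [norm_wf_le (2 ^ (2 * m) * x), norm_wf_le (2 ^ (2 * m) * y)]

lemma mem_cell_iff {M : ℕ} {j : ℤ} {z : ℝ} : z ∈ cell M j ↔ ⌊2 ^ M * z⌋ = j := by
  rw [Int.floor_eq_iff, cell, mem_Ico, div_le_iff₀ (by positivity), lt_div_iff₀ (by positivity),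
    mul_comm z]

/-- The number of cells that interact with a given one. -/
lemma card_le_of_farSet {G : Set ℝ} {m a : ℕ} {K v : ℝ} (hK : 3 ≤ K)
    (hv0 : 0 ≤ v) (hv : ∀ z ∈ G, volume.real (Bset ((17 * K + 50) / 2 ^ m) z) ≤ v) (j : ℤ)
    (C : Finset ℤ) (hC : ∀ j' ∈ C, ∃ b : ℕ,
      (farSet G m a K b ∩ cell (2 * m) j ×ˢ cell (2 * m) j').Nonempty) :
    (C.card : ℝ) ≤ v * 2 ^ (2 * m) := by
  rcases C.eq_empty_or_nonempty with rfl | ⟨j0, hj0⟩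
  · simp only [Finset.card_empty, Nat.cast_zero]; positivity
  obtain ⟨b0, ⟨z0, z0'⟩, ⟨⟨hz0G, -⟩, -⟩, hz0, -⟩ := hC j0 hj0
  simp only at hz0G hz0
  have hN1 : ((2:ℝ) ^ (2 * m))⁻¹ ≤ 1 / 2 ^ m := by
    rw [inv_eq_one_div]; gcongr
    · norm_num
    · omega
  have hhol : ∀ x y : ℝ, |x - y| ≤ (2 ^ (2 * m))⁻¹ → ‖wf x - wf y‖ ≤ 24 / 2 ^ m := fun x y h => by
    refine (norm_wf_sub_le m x y).trans ?_
    have : (2:ℝ) ^ (2 * m) * |x - y| ≤ 1 := by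
      rw [← mul_inv_cancel₀ (show (2:ℝ) ^ (2 * m) ≠ 0 by positivity)]; gcongr
    gcongr; linarith
  have hsub : ⋃ j' ∈ C, cell (2 * m) j' ⊆ Bset ((17 * K + 50) / 2 ^ m) z0 := by
    refine iUnion₂_subset fun j' hj' y hy => ?_
    obtain ⟨b, ⟨z, z'⟩, ⟨-, -, -, hd, hc⟩, hz, hz'⟩ := hC j' hj'
    simp only at hd hc hz hz'
    have d1 := abs_sub_le_of_mem_cell hz' hy
    have d2 := abs_sub_le_of_mem_cell hz0 hz
    have e1 := hhol _ _ d1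
    have e2 := hhol _ _ d2
    have e3 : ‖wf z' - wf z‖ ≤ 17 * K / 2 ^ m := by
      have h1 := norm_Tf_sub_le (2 * m) (b + z') (b + z)
      rw [add_sub_add_left_eq_sub] at h1
      have h2 := norm_sub_le (Tf (2 * m) (b + z') - Tf (2 * m) (b + z) + (wf z' - wf z))
        (Tf (2 * m) (b + z') - Tf (2 * m) (b + z))
      rw [add_sub_cancel_left] at h2
      have h3 : K / 2 ^ (2 * m) ≤ K / 2 ^ m := by
        rw [div_eq_mul_inv, div_eq_mul_one_div K (2 ^ m)]; gcongr
      calc _ ≤ K / 2 ^ m + 16 * (K / 2 ^ m) := by linarith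
        _ = _ := by ring
    constructor
    · have h := abs_add_three (y - z') (z' - z) (z - z0)
      rw [show y - z' + (z' - z) + (z - z0) = y - z0 by ring] at h
      calc |y - z0| ≤ 1 / 2 ^ m + K / 2 ^ m + 1 / 2 ^ m := by linarith
        _ = (K + 2) / 2 ^ m := by ring
        _ ≤ _ := div_le_div_of_nonneg_right (by linarith) (by positivity)
    · have h := norm_add₃_le (a := wf y - wf z') (b := wf z' - wf z) (c := wf z - wf z0)
      rw [show wf y - wf z' + (wf z' - wf z) + (wf z - wf z0) = wf y - wf z0 by ring] at h
      calc ‖wf y - wf z0‖ ≤ 24 / 2 ^ m + 17 * K / 2 ^ m + 24 / 2 ^ m := by linarith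
        _ = (17 * K + 48) / 2 ^ m := by ring
        _ ≤ _ := by gcongr; linarith
  have hvol : volume (⋃ j' ∈ C, cell (2 * m) j') = C.card * ENNReal.ofReal ((2 ^ (2 * m))⁻¹) := by
    rw [measure_biUnion_finset]
    · simp_rw [volume_cell]; simp
    · intro j1 _ j2 _ hne
      refine disjoint_left.2 fun x hx1 hx2 => hne ?_
      rw [mem_cell_iff] at hx1 hx2; rw [← hx1, hx2]
    · exact fun _ _ => measurableSet_Ico
  have h1 := (measureReal_mono hsub (volume_Bset_ne_top _ _)).trans (hv z0 hz0G)
  rw [Measure.real, hvol, ENNReal.toReal_mul, ENNReal.toReal_ofReal (by positivity)] at h1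
  simp only [ENNReal.toReal_natCast] at h1
  rwa [← div_eq_mul_inv, div_le_iff₀ (by positivity)] at h1

/-- The total measure of far pairs, in terms of a bound `E` for pairs of cells. -/
lemma sum_volume_farSet_le {G : Set ℝ} {m a : ℕ} {K v E : ℝ} (hK : 3 ≤ K)
    (hv0 : 0 ≤ v) (hv : ∀ z ∈ G, volume.real (Bset ((17 * K + 50) / 2 ^ m) z) ≤ v) (hE0 : 0 ≤ E)
    (hE : ∀ j j' : ℤ, ∑ b ∈ Finset.range (2 ^ (2 * m)),
      volume.real (farSet G m a K b ∩ cell (2 * m) j ×ˢ cell (2 * m) j') ≤ E) :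
    ∑ b ∈ Finset.range (2 ^ (2 * m)), volume (farSet G m a K b) ≤
      ENNReal.ofReal (2 ^ (2 * m) * (v * 2 ^ (2 * m) * E)) := by
  classical
  set N : ℝ := 2 ^ (2 * m) with hN
  have hN0 : 0 < N := by positivity
  have hN1 : 1 ≤ N := one_le_pow₀ one_le_two
  set L : ℤ := ⌈N * (K + 2)⌉ with hL
  set C : ℕ → Finset ℤ := fun j => (Finset.Icc (-L) L).filter fun j' =>
    ∃ b : ℕ, (farSet G m a K b ∩ cell (2 * m) (j : ℤ) ×ˢ cell (2 * m) j').Nonempty with hC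
  have hcov : ∀ b : ℕ, farSet G m a K b ⊆ ⋃ j ∈ Finset.range (2 ^ (2 * m)), ⋃ j' ∈ C j,
      farSet G m a K b ∩ cell (2 * m) (j : ℤ) ×ˢ cell (2 * m) j' := by
    rintro b ⟨z, z'⟩ hp
    obtain ⟨⟨-, hz0, hz1⟩, -, -, hd, -⟩ := id hp
    simp only at hz0 hz1 hd
    have hc : z ∈ cell (2 * m) (⌊N * z⌋₊ : ℤ) := by
      rw [mem_cell_iff, ← hN, Int.natCast_floor_eq_floor (by positivity)]
    have hc' : z' ∈ cell (2 * m) ⌊N * z'⌋ := mem_cell_iff.2 rfl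
    have hmem : (z, z') ∈ farSet G m a K b ∩ cell (2 * m) (⌊N * z⌋₊ : ℤ) ×ˢ cell (2 * m) ⌊N * z'⌋ :=
      ⟨hp, hc, hc'⟩
    refine mem_iUnion₂.2 ⟨⌊N * z⌋₊, ?_, mem_iUnion₂.2 ⟨⌊N * z'⌋, ?_, hmem⟩⟩
    · rw [Finset.mem_range, Nat.floor_lt (by positivity)]
      push_cast; rw [← hN]; nlinarith
    · refine Finset.mem_filter.2 ⟨?_, b, _, hmem⟩
      have hd' : |z' - z| ≤ K := hd.trans (div_le_self (by linarith) (one_le_pow₀ one_le_two))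
      obtain ⟨d1, d2⟩ := abs_le.1 hd'
      have l1 := Int.le_ceil (N * (K + 2))
      rw [Finset.mem_Icc]
      constructor
      · rw [Int.le_floor]; push_cast; nlinarith
      · rw [Int.floor_le_iff]; nlinarith
  calc ∑ b ∈ Finset.range (2 ^ (2 * m)), volume (farSet G m a K b)
      ≤ ∑ b ∈ Finset.range (2 ^ (2 * m)), ∑ j ∈ Finset.range (2 ^ (2 * m)), ∑ j' ∈ C j,
        volume (farSet G m a K b ∩ cell (2 * m) (j : ℤ) ×ˢ cell (2 * m) j') := by
        refine Finset.sum_le_sum fun b _ => (measure_mono (hcov b)).trans ?_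
        refine (measure_biUnion_finset_le _ _).trans (Finset.sum_le_sum fun j _ => ?_)
        exact measure_biUnion_finset_le _ _
    _ = ∑ j ∈ Finset.range (2 ^ (2 * m)), ∑ j' ∈ C j, ∑ b ∈ Finset.range (2 ^ (2 * m)),
        volume (farSet G m a K b ∩ cell (2 * m) (j : ℤ) ×ˢ cell (2 * m) j') := by
        rw [Finset.sum_comm]
        exact Finset.sum_congr rfl fun j _ => Finset.sum_comm
    _ ≤ ∑ j ∈ Finset.range (2 ^ (2 * m)), ∑ j' ∈ C j, ENNReal.ofReal E := by
        refine Finset.sum_le_sum fun j _ => Finset.sum_le_sum fun j' _ => ?_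
        refine le_trans (le_of_eq ?_) (ENNReal.ofReal_le_ofReal (hE j j'))
        rw [ENNReal.ofReal_sum_of_nonneg fun _ _ => measureReal_nonneg]
        refine Finset.sum_congr rfl fun b _ => (ofReal_measureReal ?_).symm
        refine ((measure_mono inter_subset_right).trans_lt ?_).ne
        rw [Measure.volume_eq_prod, Measure.prod_prod, volume_cell, volume_cell]
        exact ENNReal.mul_lt_top ENNReal.ofReal_lt_top ENNReal.ofReal_lt_top
    _ ≤ ∑ j ∈ Finset.range (2 ^ (2 * m)), ENNReal.ofReal (v * N * E) := by
        refine Finset.sum_le_sum fun j _ => ?_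
        rw [Finset.sum_const, nsmul_eq_mul, ← ENNReal.ofReal_natCast,
          ← ENNReal.ofReal_mul (by positivity)]
        refine ENNReal.ofReal_le_ofReal ?_
        gcongr
        exact card_le_of_farSet hK hv0 hv j (C j) fun j' hj' => (Finset.mem_filter.1 hj').2
    _ = _ := by
        rw [Finset.sum_const, nsmul_eq_mul, Finset.card_range, ENNReal.ofReal_mul hN0.le]
        congr 1
        push_cast
        rw [hN, ENNReal.ofReal_pow zero_le_two]; simp

/-- Few points have a neighborhood containing many good points that are not very close. -/
lemma volume_far_le {G : Set ℝ} (hG : MeasurableSet G)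
    (hper : ∀ (x : ℝ) (k : ℤ), x + k ∈ G ↔ x ∈ G) {m a : ℕ} {K v E : ℝ} (hK : 3 ≤ K)
    (hv0 : 0 ≤ v) (hv : ∀ z ∈ G, volume.real (Bset ((17 * K + 50) / 2 ^ m) z) ≤ v) (hE0 : 0 ≤ E)
    (hE : ∀ j j' : ℤ, ∑ b ∈ Finset.range (2 ^ (2 * m)),
      volume.real (farSet G m a K b ∩ cell (2 * m) j ×ˢ cell (2 * m) j') ≤ E)
    {T : ℝ≥0∞} (hT0 : T ≠ 0) (hT : T ≠ ∞) :
    volume ({y : ℝ | 2 ^ (2 * m) * y ∈ G ∧ T < volume {y' : ℝ | 2 ^ (2 * m) * y' ∈ G ∧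
      y' ∈ Bset (K / 2 ^ m / 2 ^ (2 * m)) y ∧
      K / 2 ^ m / 2 ^ a / 2 ^ (2 * m) < |y' - y|}} ∩ Ico 0 1) ≤
    ENNReal.ofReal (v * E) / T := by
  set N : ℝ := 2 ^ (2 * m) with hN
  have hN0 : 0 < N := by positivity
  have hNe : ENNReal.ofReal N ≠ 0 := by simpa using hN0
  have hNc : (((2 ^ (2 * m) : ℕ)) : ℝ) = N := by push_cast; rfl
  have hNc' : (((2 ^ (2 * m) : ℕ)) : ℝ≥0∞) = ENNReal.ofReal N := by
    rw [← hNc, ENNReal.ofReal_natCast]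
  refine (volume_inter_Ico_le_sum (N := 2 ^ (2 * m)) (by positivity) _).trans ?_
  rw [hNc, hNc']
  have hb : ∀ b : ℕ, volume ({z : ℝ | (b + z) / N ∈ {y : ℝ | N * y ∈ G ∧ T < volume {y' : ℝ |
      N * y' ∈ G ∧ y' ∈ Bset (K / 2 ^ m / N) y ∧ K / 2 ^ m / 2 ^ a / N < |y' - y|}}} ∩ Ico 0 1) ≤
      volume (farSet G m a K b) / (ENNReal.ofReal N * T) := by
    intro b
    have hA := measurableSet_farSet hG m a K b
    rw [Measure.volume_eq_prod, Measure.prod_apply hA]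
    refine (measure_mono ?_).trans (meas_ge_le_lintegral_div
      (measurable_measure_prodMk_left hA).aemeasurable (mul_ne_zero hNe hT0)
      (ENNReal.mul_ne_top ENNReal.ofReal_ne_top hT))
    rintro z ⟨⟨hzG, hzT⟩, hz⟩
    have hzG' : z ∈ G := by
      rw [mul_div_cancel₀ _ hN0.ne', add_comm] at hzG
      exact (hper z b).1 (by exact_mod_cast hzG)
    set Y := {y' : ℝ | N * y' ∈ G ∧ y' ∈ Bset (K / 2 ^ m / N) ((b + z) / N) ∧
      K / 2 ^ m / 2 ^ a / N < |y' - (b + z) / N|} with hY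
    have hvol : ENNReal.ofReal N * volume Y =
        volume ((fun x => x * N⁻¹) ⁻¹' ((fun x => x + b / N) ⁻¹' Y)) := by
      rw [Real.volume_preimage_mul_right (by positivity), measure_preimage_add_right, inv_inv,
        abs_of_pos hN0]
    have hsub : (fun x => x * N⁻¹) ⁻¹' ((fun x => x + b / N) ⁻¹' Y) ⊆
        Prod.mk z ⁻¹' farSet G m a K b := by
      intro z' hz'
      have e : z' * N⁻¹ + b / N = (b + z') / N := by field_simp; ring
      simp only [mem_preimage, e] at hz'
      obtain ⟨h1, ⟨h2, h3⟩, h4⟩ := hz'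
      rw [mul_div_cancel₀ _ hN0.ne', add_comm] at h1
      have h1' : z' ∈ G := (hper z' b).1 (by exact_mod_cast h1)
      rw [← sub_div, add_sub_add_left_eq_sub, abs_div, abs_of_pos hN0] at h2 h4
      rw [div_le_div_iff_of_pos_right hN0] at h2
      rw [div_lt_div_iff_of_pos_right hN0] at h4
      refine ⟨⟨hzG', hz⟩, h1', h4, h2, ?_⟩
      have h5 := two_pow_mul_wf_sub m ((b + z') / N) ((b + z) / N)
      rw [← hN, mul_div_cancel₀ _ hN0.ne', mul_div_cancel₀ _ hN0.ne'] at h5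
      have e1 : wf (b + z') = wf z' := by
        rw [add_comm]; exact_mod_cast wf_add_int z' b
      have e2 : wf (b + z) = wf z := by
        rw [add_comm]; exact_mod_cast wf_add_int z b
      rw [e1, e2] at h5
      simp only
      rw [← h5, norm_two_pow_mul]
      calc (2:ℝ) ^ m * ‖wf ((b + z') / N) - wf ((b + z) / N)‖ ≤ 2 ^ m * (K / 2 ^ m / N) := by gcongr
        _ = _ := by rw [← hN]; field_simp
    calc ENNReal.ofReal N * T ≤ ENNReal.ofReal N * volume Y := by gcongr
      _ ≤ _ := by rw [hvol]; exact measure_mono hsub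
  calc (ENNReal.ofReal N)⁻¹ * ∑ b ∈ Finset.range (2 ^ (2 * m)), _
      ≤ (ENNReal.ofReal N)⁻¹ * ∑ b ∈ Finset.range (2 ^ (2 * m)),
        volume (farSet G m a K b) / (ENNReal.ofReal N * T) := by
        gcongr with b _
        exact hb b
    _ = (ENNReal.ofReal N)⁻¹ * ((∑ b ∈ Finset.range (2 ^ (2 * m)),
        volume (farSet G m a K b)) / (ENNReal.ofReal N * T)) := by
        simp_rw [div_eq_mul_inv]; rw [Finset.sum_mul]
    _ ≤ (ENNReal.ofReal N)⁻¹ * (ENNReal.ofReal (N * (v * N * E)) / (ENNReal.ofReal N * T)) := by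
        gcongr
        exact sum_volume_farSet_le hK hv0 hv hE0 hE
    _ = _ := by
        rw [show N * (v * N * E) = N * (N * (v * E)) by ring, ENNReal.ofReal_mul hN0.le,
          ENNReal.mul_div_mul_left _ _ hNe ENNReal.ofReal_ne_top, ENNReal.ofReal_mul hN0.le,
          ← mul_div_assoc, ← mul_assoc, ENNReal.inv_mul_cancel hNe ENNReal.ofReal_ne_top, one_mul]

lemma volume_near_le {m a : ℕ} (ham : a ≤ m) {K : ℝ} (y : ℝ) :
    volume {y' : ℝ | y' ∈ Bset (K / 2 ^ m / 2 ^ (2 * m)) y ∧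
      |y' - y| ≤ K / 2 ^ m / 2 ^ a / 2 ^ (2 * m)} ≤
    tp (-(2 * a)) * volume (Bset (17 * K / 2 ^ (3 * m - a)) (2 ^ (2 * a) * y)) := by
  have h1 : tp (-(2 * a)) = ENNReal.ofReal |((2:ℝ) ^ (2 * a))⁻¹| := by
    rw [abs_of_pos (by positivity), tp, Real.rpow_neg zero_le_two]
    congr 2
    exact_mod_cast Real.rpow_natCast 2 (2 * a)
  rw [h1, ← Real.volume_preimage_mul_left (by positivity)]
  refine measure_mono fun y' ⟨⟨_, h3⟩, h4⟩ => ?_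
  have e : (2:ℝ) ^ (3 * m - a) * 2 ^ a = 2 ^ m * 2 ^ (2 * m) := by
    rw [← pow_add, ← pow_add]; congr 1; omega
  have e2 : K / 2 ^ (3 * m - a) = 2 ^ a * (K / 2 ^ m / 2 ^ (2 * m)) := by
    rw [div_div, ← e]; field_simp
  have h5 : |2 ^ (2 * a) * y' - 2 ^ (2 * a) * y| ≤ K / 2 ^ (3 * m - a) := by
    rw [← mul_sub, abs_mul, abs_of_pos (by positivity)]
    calc _ ≤ (2:ℝ) ^ (2 * a) * (K / 2 ^ m / 2 ^ a / 2 ^ (2 * m)) := by gcongr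
      _ = _ := by rw [e2]; field_simp; ring
  have hK : 0 ≤ K / 2 ^ (3 * m - a) := (abs_nonneg _).trans h5
  have e3 : 17 * K / 2 ^ (3 * m - a) = 17 * (K / 2 ^ (3 * m - a)) := by ring
  refine ⟨by linarith, ?_⟩
  have h6 := two_pow_mul_wf_sub a y' y
  have h7 : wf (2 ^ (2 * a) * y') - wf (2 ^ (2 * a) * y) = (2:ℂ) ^ a * (wf y' - wf y) -
      (Tf (2 * a) (2 ^ (2 * a) * y') - Tf (2 * a) (2 ^ (2 * a) * y)) := by rw [h6]; ring
  rw [h7]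
  refine (norm_sub_le _ _).trans ?_
  have h8 := norm_Tf_sub_le (2 * a) (2 ^ (2 * a) * y') (2 ^ (2 * a) * y)
  have h9 : ‖(2:ℂ) ^ a * (wf y' - wf y)‖ ≤ K / 2 ^ (3 * m - a) := by
    rw [norm_two_pow_mul, e2]; gcongr
  linarith

lemma exp_neg_le_two_rpow {x : ℝ} (hx : 0 ≤ x) : rexp (-x) ≤ 2 ^ (-x) := by
  rw [Real.rpow_def_of_pos two_pos, Real.exp_le_exp]
  have := Real.log_two_lt_d9
  nlinarith

lemma far_bound_le {β g K : ℝ} (hβ : β = 2 - g) (hg0 : 0 < g) (hg : g ≤ 3 / 2) (hK : 3 ≤ K)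
    {q a : ℕ} (hq : 100 ≤ q * g) (ha : 2 * q ≤ a) {m : ℕ} (hm : m = q * a) :
    (2:ℝ) ^ (-(β * m)) * (3 * (50 * (2 ^ (4 * a))⁻¹ *
      ((2:ℝ) ^ (-(β * (2 * m - a))) + (2 ^ (2 * m))⁻¹ * rexp (-4 ^ a)) +
      (2 ^ (2 * m))⁻¹ * ((200 * K ^ 2) ^ 2 / 4 * ((2:ℝ) ^ (m + g * m / 2) / 2 ^ (2 * m)) ^ 2 +
        2 * rexp (-(200 * K ^ 2) ^ 2 / 8 * ((2:ℝ) ^ (5 * (m:ℝ) / 2) / (13 * K) / 2 ^ (2 * m)) ^ 2))))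
    ≤ (300 + 3 * ((200 * K ^ 2) ^ 2 / 4 + 2)) *
      ((2:ℝ) ^ (-(2 * (a:ℝ))) * (2:ℝ) ^ (-(3 * m * β + g * a / 2))) := by
  have hmr : (m:ℝ) = q * a := by rw [hm]; push_cast; ring
  have ha0 : (0:ℝ) ≤ a := by positivity
  have hm0 : (0:ℝ) ≤ m := by positivity
  have hqa : 100 * a ≤ g * m := by rw [hmr]; nlinarith
  have e1 : ((2:ℝ) ^ (4 * a))⁻¹ = 2 ^ (-(4 * (a:ℝ))) := by
    rw [Real.rpow_neg zero_le_two]; congr 1; exact_mod_cast (Real.rpow_natCast 2 (4 * a)).symm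
  have e2 : (2:ℝ) ^ (2 * m) = 2 ^ (2 * (m:ℝ)) := by
    exact_mod_cast (Real.rpow_natCast 2 (2 * m)).symm
  have e3 : ((2:ℝ) ^ (2 * m))⁻¹ = 2 ^ (-(2 * (m:ℝ))) := by rw [Real.rpow_neg zero_le_two, e2]
  have sq (x : ℝ) : ((2:ℝ) ^ x) ^ 2 = 2 ^ (2 * x) := by
    rw [mul_comm, Real.rpow_mul zero_le_two]; exact_mod_cast rfl
  have b1 : ((2:ℝ) ^ (2 * m))⁻¹ * rexp (-4 ^ a) ≤ 2 ^ (-(β * (2 * m - a))) := by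
    have h4 : 2 * (m:ℝ) ≤ 4 ^ a := by
      have h1 : a < 2 ^ a := Nat.lt_two_pow_self
      have h2 : 2 * m ≤ 4 ^ a := by
        calc 2 * m = (2 * q) * a := by rw [hm]; ring
          _ ≤ 2 ^ a * 2 ^ a := Nat.mul_le_mul (ha.trans h1.le) h1.le
          _ = 4 ^ a := (mul_pow 2 2 a).symm
      exact_mod_cast h2
    calc ((2:ℝ) ^ (2 * m))⁻¹ * rexp (-4 ^ a) ≤ 2 ^ (-(2 * (m:ℝ))) * 2 ^ (-(2 * (m:ℝ))) := by
          rw [e3]; gcongr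
          refine le_trans ?_ (exp_neg_le_two_rpow (by positivity))
          exact Real.exp_le_exp.2 (by linarith)
      _ = 2 ^ (-(2 * (m:ℝ)) + -(2 * (m:ℝ))) := (Real.rpow_add two_pos _ _).symm
      _ ≤ _ := by
        refine Real.rpow_le_rpow_of_exponent_le one_le_two ?_
        rw [hβ]; nlinarith
  have b2 : ((2:ℝ) ^ (m + g * m / 2) / 2 ^ (2 * m)) ^ 2 = 2 ^ (-(β * m)) := by
    rw [e2, ← Real.rpow_sub two_pos, sq]; congr 1; rw [hβ]; ring
  have b3 : rexp (-(200 * K ^ 2) ^ 2 / 8 *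
      ((2:ℝ) ^ (5 * (m:ℝ) / 2) / (13 * K) / 2 ^ (2 * m)) ^ 2) ≤ 2 ^ (-(β * m)) := by
    have h1 : ((2:ℝ) ^ (5 * (m:ℝ) / 2) / (13 * K) / 2 ^ (2 * m)) ^ 2 = 2 ^ m / (13 * K) ^ 2 := by
      rw [div_right_comm, e2, ← Real.rpow_sub two_pos, div_pow, sq, ← Real.rpow_natCast 2 m]
      congr 2; ring
    have h2 : (m:ℝ) ≤ 2 ^ m := by exact_mod_cast Nat.lt_two_pow_self.le
    have h3 : -(200 * K ^ 2) ^ 2 / 8 * ((2:ℝ) ^ m / (13 * K) ^ 2) ≤ -(2 * (m:ℝ)) := by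
      have : -(200 * K ^ 2) ^ 2 / 8 * ((2:ℝ) ^ m / (13 * K) ^ 2) =
        -(5000 / 169 * K ^ 2 * 2 ^ m) := by field_simp; ring
      rw [this]
      have : (9:ℝ) ≤ K ^ 2 := by nlinarith
      nlinarith
    rw [h1]
    refine (Real.exp_le_exp.2 h3).trans ((exp_neg_le_two_rpow (by positivity)).trans ?_)
    refine Real.rpow_le_rpow_of_exponent_le one_le_two ?_
    rw [hβ]; nlinarith
  have c1 : (2:ℝ) ^ (-(β * m)) * ((2:ℝ) ^ (4 * a))⁻¹ * 2 ^ (-(β * (2 * m - a))) ≤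
      (2:ℝ) ^ (-(2 * (a:ℝ))) * (2:ℝ) ^ (-(3 * m * β + g * a / 2)) := by
    rw [e1, ← Real.rpow_add two_pos, ← Real.rpow_add two_pos, ← Real.rpow_add two_pos]
    refine Real.rpow_le_rpow_of_exponent_le one_le_two ?_
    rw [hβ]; nlinarith
  have c2 : (2:ℝ) ^ (-(β * m)) * ((2:ℝ) ^ (2 * m))⁻¹ * 2 ^ (-(β * m)) ≤
      (2:ℝ) ^ (-(2 * (a:ℝ))) * (2:ℝ) ^ (-(3 * m * β + g * a / 2)) := by
    rw [e3, ← Real.rpow_add two_pos, ← Real.rpow_add two_pos, ← Real.rpow_add two_pos]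
    refine Real.rpow_le_rpow_of_exponent_le one_le_two ?_
    rw [hβ]; nlinarith
  calc _ ≤ (2:ℝ) ^ (-(β * m)) * (3 * (50 * (2 ^ (4 * a))⁻¹ *
      ((2:ℝ) ^ (-(β * (2 * m - a))) + (2:ℝ) ^ (-(β * (2 * m - a)))) +
      (2 ^ (2 * m))⁻¹ * ((200 * K ^ 2) ^ 2 / 4 * (2:ℝ) ^ (-(β * m)) +
        2 * (2:ℝ) ^ (-(β * m))))) := by
        rw [b2]; gcongr
    _ = 300 * ((2:ℝ) ^ (-(β * m)) * ((2:ℝ) ^ (4 * a))⁻¹ * 2 ^ (-(β * (2 * m - a)))) +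
      3 * ((200 * K ^ 2) ^ 2 / 4 + 2) *
        ((2:ℝ) ^ (-(β * m)) * ((2:ℝ) ^ (2 * m))⁻¹ * 2 ^ (-(β * m))) := by ring
    _ ≤ 300 * ((2:ℝ) ^ (-(2 * (a:ℝ))) * (2:ℝ) ^ (-(3 * m * β + g * a / 2))) +
      3 * ((200 * K ^ 2) ^ 2 / 4 + 2) *
        ((2:ℝ) ^ (-(2 * (a:ℝ))) * (2:ℝ) ^ (-(3 * m * β + g * a / 2))) := by gcongr
    _ = _ := by ring

/-- Outside an exponentially small set of points, the neighborhoods of the graph of `wf` of radius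
proportional to `2 ^ (-n)` have measure at most `2 ^ (-β n)`. -/
def SmallBall (β : ℝ) : Prop :=
  ∀ K : ℝ, 0 < K → ExpSmall fun n => {y | tp (-(β * n)) < volume (Bset (K / 2 ^ n) y)}

lemma SmallBall.mono {β β' : ℝ} (h : SmallBall β) (hβ : β' ≤ β) : SmallBall β' := fun K hK =>
  (h K hK).mono <| .of_forall fun n y (hy : _ < _) =>
    (tp_mono (by gcongr)).trans_lt hy

lemma smallBall_half : SmallBall (1 / 2) := fun K hK => by
  refine ⟨1, one_pos, ?_⟩
  filter_upwards [eventually_const_mul_tp_le (C := ENNReal.ofReal (2 * K)) ENNReal.ofReal_ne_top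
    (one_half_lt_one (α := ℝ))] with n hn
  have : {y | tp (-(1 / 2 * n)) < volume (Bset (K / 2 ^ n) y)} = ∅ := by
    refine eq_empty_of_forall_notMem fun y hy => ?_
    rw [mem_ofPred_eq] at hy
    refine hy.not_ge ?_
    refine (volume_Bset_le _ _).trans (le_trans (le_of_eq ?_) hn)
    rw [tp, ← ENNReal.ofReal_mul (by positivity), one_mul, Real.rpow_neg zero_le_two,
      Real.rpow_natCast]
    congr 1; ring
  rw [this]; simp

/-- The points with small neighborhoods at two scales. -/
def goodSet (β K : ℝ) (m a : ℕ) : Set ℝ :=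
  {z | volume (Bset ((17 * K + 50) / 2 ^ m) z) ≤ tp (-(β * m)) ∧
    volume (Bset (200 * K ^ 2 * 2 ^ a / 2 ^ (2 * m)) z) ≤ tp (-(β * (2 * m - a)))}

lemma measurableSet_goodSet (β K : ℝ) (m a : ℕ) : MeasurableSet (goodSet β K m a) :=
  (measurableSet_le (measurable_volume_Bset _) measurable_const).inter
    (measurableSet_le (measurable_volume_Bset _) measurable_const)

lemma add_int_mem_goodSet {β K : ℝ} {m a : ℕ} (x : ℝ) (k : ℤ) :
    x + k ∈ goodSet β K m a ↔ x ∈ goodSet β K m a := by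
  simp only [goodSet, mem_ofPred_eq, volume_Bset_add_int]

lemma SmallBall.expSmall_compl_goodSet {β : ℝ} (h : SmallBall β) {K : ℝ} (hK : 3 ≤ K) {q : ℕ}
    (hq : 1 ≤ q) : ExpSmall fun a => (goodSet β K (q * a) a)ᶜ := by
  have h1 := (h (17 * K + 50) (by positivity)).comp_mul hq
  have h2 := (h (200 * K ^ 2) (by positivity)).comp_mul (k := 2 * q - 1) (by omega)
  refine (h1.union h2).mono (.of_forall fun a z hz => ?_)
  simp only [goodSet, mem_compl_iff, mem_ofPred_eq, not_and_or, not_le] at hz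
  have e : (2 * q - 1) * a + a = 2 * (q * a) := by
    obtain ⟨k, rfl⟩ := Nat.exists_eq_add_of_le hq
    rw [show 2 * (1 + k) - 1 = 2 * k + 1 by omega]; ring
  have e' : (((2 * q - 1) * a : ℕ) : ℝ) = 2 * ((q * a : ℕ):ℝ) - a := by
    rw [eq_sub_iff_add_eq]; exact_mod_cast e
  refine hz.imp id fun hz => ?_
  simp only [mem_ofPred_eq]
  rw [e']
  convert hz using 3
  rw [← e, pow_add]; field_simp

lemma expSmall_preimage_mul {E : ℕ → Set ℝ} (h : ExpSmall E)
    (hper : ∀ n (x : ℝ) (k : ℤ), x + k ∈ E n ↔ x ∈ E n) (l : ℕ → ℕ) :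
    ExpSmall fun n => {y : ℝ | 2 ^ l n * y ∈ E n} :=
  h.of_volume_le (C := 1) (by simp) <| .of_forall fun n => by
    rw [one_mul]
    exact_mod_cast volume_preimage_mul_inter_Ico_le (N := 2 ^ l n) (by positivity) (hper n)

/-- The points near which many points far from the diagonal belong to the neighborhood. -/
def farBad (β g K : ℝ) (m a : ℕ) : Set ℝ :=
  {y : ℝ | 2 ^ (2 * m) * y ∈ goodSet β K m a ∧ tp (-(3 * m * β + g * a / 2)) <
    volume {y' : ℝ | 2 ^ (2 * m) * y' ∈ goodSet β K m a ∧
      y' ∈ Bset (K / 2 ^ m / 2 ^ (2 * m)) y ∧ K / 2 ^ m / 2 ^ a / 2 ^ (2 * m) < |y' - y|}}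

lemma expSmall_farBad {β g K : ℝ} (hβ : β = 2 - g) (hg0 : 0 < g) (hg : g ≤ 3 / 2) (hK : 3 ≤ K)
    {q : ℕ} (hq : 100 ≤ q * g) (hq1 : 1 ≤ q) : ExpSmall fun a => farBad β g K (q * a) a := by
  refine .of_le (C := ENNReal.ofReal (300 + 3 * ((200 * K ^ 2) ^ 2 / 4 + 2)))
    ENNReal.ofReal_ne_top two_pos ?_
  filter_upwards [eventually_ge_atTop (2 * q)] with a ha
  obtain ⟨m, hm⟩ : ∃ m, m = q * a := ⟨_, rfl⟩
  rw [← hm]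
  have hmr : (m:ℝ) = q * a := by rw [hm]; push_cast; ring
  have ha0 : (0:ℝ) ≤ a := by positivity
  have hqa : 100 * a ≤ g * m := by rw [hmr]; nlinarith
  have hreal {ρ z t : ℝ} (h : volume (Bset ρ z) ≤ tp t) : volume.real (Bset ρ z) ≤ 2 ^ t :=
    ENNReal.toReal_le_of_le_ofReal (by positivity) h
  have hE := sum_volume_farSet_inter_le (measurableSet_goodSet β K m a) (m := m) (a := a)
    (by rw [hm]; exact Nat.le_mul_of_pos_left a hq1) hK
    (U0 := (2:ℝ) ^ (m + g * m / 2)) (U1 := (2:ℝ) ^ (5 * (m:ℝ) / 2) / (13 * K))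
    (v := (2:ℝ) ^ (-(β * (2 * m - a)))) ?_ (by positivity) ?_ (by positivity)
    (fun z hz => hreal hz.2)
  · refine (volume_far_le (measurableSet_goodSet β K m a) add_int_mem_goodSet hK
      (v := (2:ℝ) ^ (-(β * m))) (by positivity) (fun z hz => hreal hz.1) (by positivity) hE
      (tp_pos _).ne' (tp_ne_top _)).trans ?_
    refine ENNReal.div_le_of_le_mul ?_
    rw [tp, tp, mul_assoc (ENNReal.ofReal (300 + _)), ← ENNReal.ofReal_mul (by positivity), ← ENNReal.ofReal_mul (by positivity)]
    exact ENNReal.ofReal_le_ofReal (far_bound_le hβ hg0 hg hK hq ha hm)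
  · rw [← pow_add, ← pow_add, ← Real.rpow_natCast]
    refine Real.rpow_le_rpow_of_exponent_le one_le_two ?_
    push_cast; linarith
  · rw [mul_div_cancel₀ _ (by positivity), ← Real.rpow_natCast, ← Real.rpow_natCast,
      ← Real.rpow_mul zero_le_two]
    refine Real.rpow_le_rpow_of_exponent_le one_le_two ?_
    push_cast; linarith

lemma SmallBall.expSmall_mul {β g : ℝ} (h : SmallBall β) (hβ : β = 2 - g) (hg0 : 0 < g)
    (hg : g ≤ 3 / 2) {K : ℝ} (hK : 3 ≤ K) {q : ℕ} (hq : 100 ≤ q * g) (hq1 : 1 ≤ q) :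
    ExpSmall fun a => {y | tp (-((β + g / (12 * q)) * (3 * q * a))) <
      volume (Bset (K / 2 ^ (q * a) / 2 ^ (2 * (q * a))) y)} := by
  obtain ⟨C, hC⟩ := exists_volume_density_le
  have hbad := expSmall_preimage_mul (h.expSmall_compl_goodSet hK hq1)
    (fun a x k => by simp only [mem_compl_iff, add_int_mem_goodSet]) (fun a => 2 * (q * a))
  have hnear := expSmall_preimage_mul
    ((h (17 * K) (by positivity)).comp_mul (k := 3 * q - 1) (by omega))
    (fun a x k => by simp only [mem_ofPred_eq, volume_Bset_add_int]) (fun a => 2 * a)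
  have hfar := expSmall_farBad hβ hg0 hg hK hq hq1
  have hdens : ExpSmall fun a => {y | volume (Bset (K / 2 ^ (q * a) / 2 ^ (2 * (q * a))) y) <
      2 * volume (Bset (K / 2 ^ (q * a) / 2 ^ (2 * (q * a))) y ∩
        {y : ℝ | 2 ^ (2 * (q * a)) * y ∈ (goodSet β K (q * a) a)ᶜ})} := by
    refine hbad.of_volume_le (C := C) (by simp) ?_
    obtain ⟨k, hk⟩ := exists_nat_gt K
    filter_upwards [eventually_ge_atTop k] with a ha
    refine hC _ (by positivity) ?_ _ ?_ ?_
    · rw [div_div, ← pow_add, div_le_one (by positivity)]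
      have h1 : k ≤ q * a + 2 * (q * a) := by nlinarith
      have h2 : (k:ℝ) < 2 ^ k := by exact_mod_cast Nat.lt_two_pow_self
      have h3 : (2:ℝ) ^ k ≤ 2 ^ (q * a + 2 * (q * a)) := pow_le_pow_right₀ one_le_two h1
      linarith
    · exact (measurableSet_goodSet _ _ _ _).compl.preimage (measurable_const_mul _)
    · intro x k
      simp only [mem_ofPred_eq, mem_compl_iff]
      rw [mul_add, show (2:ℝ) ^ (2 * (q * a)) * k = ((2 ^ (2 * (q * a)) * k : ℤ) : ℝ) by push_cast; rfl,
        add_int_mem_goodSet]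
  refine (((hbad.union hnear).union hfar).union hdens).mono ?_
  have hq0 : (0:ℝ) < q := by exact_mod_cast hq1
  filter_upwards [eventually_const_mul_tp_le (C := 4) (by simp) (x := 3 * β * q + g / 4)
    (y := 3 * β * q + g / 2) (by linarith)] with a ha y hy
  by_contra hcon
  simp only [mem_union, not_or] at hcon
  obtain ⟨⟨⟨h1, h2⟩, h3⟩, h4⟩ := hcon
  simp only [mem_ofPred_eq, mem_compl_iff, not_not, not_lt] at h1 h2 h4 hy
  refine hy.not_ge ?_
  clear hbad hnear hfar hdens
  set ρ := K / 2 ^ (q * a) / 2 ^ (2 * (q * a)) with hρ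
  set G : Set ℝ := {y : ℝ | 2 ^ (2 * (q * a)) * y ∈ goodSet β K (q * a) a} with hG
  have hGc : {y : ℝ | 2 ^ (2 * (q * a)) * y ∉ goodSet β K (q * a) a} = Gᶜ := rfl
  have hGm : MeasurableSet G := (measurableSet_goodSet _ _ _ _).preimage (measurable_const_mul _)
  set P : Set ℝ := {y' : ℝ | y' ∈ Bset ρ y ∧ |y' - y| ≤ K / 2 ^ (q * a) / 2 ^ a / 2 ^ (2 * (q * a))}
  set Q : Set ℝ := {y' : ℝ | y' ∈ G ∧
      y' ∈ Bset ρ y ∧ K / 2 ^ (q * a) / 2 ^ a / 2 ^ (2 * (q * a)) < |y' - y|}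
  have e1 : (q * a : ℕ) = (q:ℝ) * a := by push_cast; rfl
  have hP : volume P ≤ tp (-((3 * β * q + g / 2) * a)) := by
    have ham : a ≤ q * a := Nat.le_mul_of_pos_left a hq1
    have e2 : (3 * q - 1) * a = 3 * (q * a) - a := by
      rw [Nat.sub_mul, one_mul, mul_assoc]
    have e3 : ((3 * (q * a) - a : ℕ) : ℝ) = 3 * (q * a) - a := by
      rw [Nat.cast_sub (by omega)]; push_cast; ring
    rw [e2] at h2
    refine (volume_near_le ham y).trans ?_
    calc _ ≤ tp (-(2 * a)) * tp (-(β * (3 * (q * a) - a : ℕ))) := by gcongr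
      _ ≤ _ := by
        rw [← tp_add, e3]
        refine tp_mono ?_
        have : 0 ≤ g * a := by positivity
        rw [hβ]; linarith
  have hQ : volume Q ≤ tp (-((3 * β * q + g / 2) * a)) := by
    simp only [farBad, mem_ofPred_eq, not_and, not_lt] at h3
    refine (h3 h1).trans (tp_mono (le_of_eq ?_))
    rw [e1]; ring
  have hsub : Bset ρ y ∩ G ⊆ P ∪ Q := fun y' hy' => by
    rcases le_or_gt |y' - y| (K / 2 ^ (q * a) / 2 ^ a / 2 ^ (2 * (q * a))) with h | h
    · exact .inl ⟨hy'.1, h⟩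
    · exact .inr ⟨hy'.2, hy'.1, h⟩
  have h5 := measure_inter_add_sdiff (μ := volume) (Bset ρ y) hGm
  rw [sdiff_eq] at h5
  rw [hGc] at h4
  have h6 : volume (Bset ρ y ∩ Gᶜ) ≤ volume (Bset ρ y ∩ G) := by
    have hfin : volume (Bset ρ y ∩ Gᶜ) ≠ ∞ :=
      ((measure_mono inter_subset_left).trans_lt (volume_Bset_ne_top ρ y).lt_top).ne
    rw [← h5, two_mul] at h4
    exact (ENNReal.add_le_add_iff_right hfin).1 h4
  have h7 : volume (Bset ρ y ∩ G) ≤ 2 * tp (-((3 * β * q + g / 2) * a)) := by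
    rw [two_mul]
    exact (measure_mono hsub).trans ((measure_union_le _ _).trans (add_le_add hP hQ))
  calc volume (Bset ρ y) ≤ 2 * volume (Bset ρ y ∩ G) := by
        rw [← h5, two_mul]; gcongr
    _ ≤ 2 * (2 * tp (-((3 * β * q + g / 2) * a))) := by gcongr
    _ = 4 * tp (-((3 * β * q + g / 2) * a)) := by rw [← mul_assoc]; norm_num
    _ ≤ _ := ha.trans (le_of_eq ?_)
  congr 1; field_simp; ring

lemma SmallBall.add_div {β g : ℝ} (h : SmallBall β) (hβ : β = 2 - g) (hg0 : 0 < g)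
    (hg : g ≤ 3 / 2) {q : ℕ} (hq : 100 ≤ q * g) (hq1 : 1 ≤ q) :
    SmallBall (β + g / (24 * q)) := by
  intro K hK
  have hq0 : (0:ℝ) < q := by exact_mod_cast hq1
  refine ((h.expSmall_mul hβ hg0 hg (le_max_right K 3) hq hq1).comp_div
    (k := 3 * q) (by omega)).mono ?_
  have hc : 0 < g / (24 * q) := by positivity
  have : ∀ᶠ n : ℕ in atTop, 3 * q * (β + g / (12 * q)) / (g / (24 * q)) ≤ (n:ℝ) :=
    (tendsto_natCast_atTop_atTop (R := ℝ)).eventually_ge_atTop _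
  filter_upwards [this] with n hn y hy
  rw [div_le_iff₀ hc] at hn
  simp only [mem_ofPred_eq] at hy ⊢
  set a := n / (3 * q) with ha
  have h1 : n < 3 * q * a + 3 * q := by
    have h := Nat.div_add_mod n (3 * q)
    rw [← ha] at h
    have := Nat.mod_lt n (y := 3 * q) (by omega)
    omega
  have h1' : (n:ℝ) < 3 * q * a + 3 * q := by exact_mod_cast h1
  have h2 : q * a + 2 * (q * a) ≤ n := by
    have := Nat.div_add_mod n (3 * q); rw [← ha, mul_assoc] at this; omega
  have e : g / (12 * q) = 2 * (g / (24 * q)) := by field_simp; ring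
  have hβ0 : 0 ≤ β + g / (12 * q) := by
    have : 0 < g / (12 * q) := by positivity
    linarith
  refine lt_of_le_of_lt (tp_mono ?_) (hy.trans_le (measure_mono (Bset_mono ?_ y)))
  · have := mul_le_mul_of_nonneg_left h1'.le hβ0
    rw [e] at this hn ⊢
    linarith
  · rw [div_div, ← pow_add]
    have : K ≤ max K 3 := le_max_left _ _
    gcongr
    exact one_le_two

lemma SmallBall.add_sq {β g : ℝ} (h : SmallBall β) (hβ : β = 2 - g) (hg0 : 0 < g)
    (hg : g ≤ 3 / 2) : SmallBall (β + g ^ 2 / 2500) := by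
  have h1 : 100 ≤ (⌈100 / g⌉₊ : ℝ) * g := (div_le_iff₀ hg0).1 (Nat.le_ceil _)
  have h2 : (⌈100 / g⌉₊ : ℝ) * g < 100 + g := by
    calc _ < (100 / g + 1) * g := by gcongr; exact Nat.ceil_lt_add_one (by positivity)
      _ = _ := by field_simp
  have h3 : 1 ≤ ⌈100 / g⌉₊ := Nat.one_le_ceil_iff.2 (by positivity)
  have h4 : (0:ℝ) < ⌈100 / g⌉₊ := by exact_mod_cast h3
  refine (h.add_div hβ hg0 hg h1 h3).mono ?_
  rw [add_le_add_iff_left, div_le_div_iff₀ (by norm_num) (by positivity)]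
  nlinarith

lemma smallBall {β : ℝ} (hβ : β < 2) : SmallBall β := by
  obtain ⟨g, hg⟩ : ∃ g, g = 2 - β := ⟨_, rfl⟩
  have hg0 : 0 < g := by linarith
  have key (k : ℕ) : SmallBall (2 - max (min g (3 / 2)) (3 / 2 - k * ((min g (3 / 2)) ^ 2 / 2500))) := by
    set g' := min g (3 / 2)
    have hg' : 0 < g' := lt_min hg0 (by norm_num)
    have hg'2 : g' ≤ 3 / 2 := min_le_right _ _
    induction k with
    | zero => exact smallBall_half.mono (by have := le_max_right g' (3 / 2); norm_num; linarith)
    | succ k ih =>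
      set G := max g' (3 / 2 - k * (g' ^ 2 / 2500)) with hG
      have h1 : g' ≤ G := le_max_left _ _
      have h2 : G ≤ 3 / 2 := max_le hg'2 (by
        have : 0 ≤ k * (g' ^ 2 / 2500) := by positivity
        linarith)
      refine (ih.add_sq rfl (hg'.trans_le h1) h2).mono ?_
      have h3 : 3 / 2 - (k + 1 : ℕ) * (g' ^ 2 / 2500) ≥ 3 / 2 - k * (g' ^ 2 / 2500) - g' ^ 2 / 2500 := by
        push_cast; linarith
      have h4 : G - G ^ 2 / 2500 ≤ max g' (3 / 2 - (k + 1 : ℕ) * (g' ^ 2 / 2500)) := by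
        have h5 : g' ^ 2 ≤ G ^ 2 := by gcongr
        rcases max_cases g' (3 / 2 - k * (g' ^ 2 / 2500)) with h | h
        · exact le_trans (by nlinarith) (le_max_left _ _)
        · exact le_trans (by linarith [h.1]) (le_max_right _ _)
      linarith
  have hg' : 0 < min g (3 / 2) := lt_min hg0 (by norm_num)
  obtain ⟨k, hk⟩ := exists_nat_gt (3 / 2 / ((min g (3 / 2)) ^ 2 / 2500))
  rw [div_lt_iff₀ (by positivity)] at hk
  refine (key k).mono ?_
  have : max (min g (3 / 2)) (3 / 2 - k * ((min g (3 / 2)) ^ 2 / 2500)) ≤ g :=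
    max_le (min_le_left _ _) (by linarith)
  linarith

lemma ExpSmall.ae_eventually_notMem {A : ℕ → Set ℝ} (h : ExpSmall A) :
    ∀ᵐ y ∂(volume.restrict (Ico (0:ℝ) 1)), ∀ᶠ n in atTop, y ∉ A n := by
  obtain ⟨c, hc, h⟩ := h
  obtain ⟨n₀, h⟩ := eventually_atTop.1 h
  have hlt : tp (-c) < 1 := by
    rw [tp, ← ENNReal.ofReal_one, ENNReal.ofReal_lt_ofReal_iff one_pos]
    exact Real.rpow_lt_one_of_one_lt_of_neg one_lt_two (by linarith)
  have key : ∑' n, (volume.restrict (Ico (0:ℝ) 1)) (A (n + n₀)) ≠ ∞ := by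
    have : ∑' n, (volume.restrict (Ico (0:ℝ) 1)) (A (n + n₀)) ≤ ∑' n : ℕ, tp (-c) ^ n := by
      refine ENNReal.tsum_le_tsum fun n => ?_
      rw [Measure.restrict_apply' measurableSet_Ico]
      refine (h (n + n₀) (by omega)).trans ?_
      have : tp (-c) ^ n = tp (-(c * n)) := by
        rw [tp, tp, ← ENNReal.ofReal_pow (by positivity), ← Real.rpow_natCast,
          ← Real.rpow_mul zero_le_two, neg_mul]
      rw [this]
      refine tp_mono ?_
      push_cast
      have : 0 ≤ c * n₀ := by positivity
      linarith
    refine ne_top_of_le_ne_top ?_ this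
    rw [ENNReal.tsum_geometric]
    exact ENNReal.inv_ne_top.2 (tsub_pos_of_lt hlt).ne'
  filter_upwards [MeasureTheory.ae_eventually_notMem key] with y hy
  rw [← eventually_map (P := fun n => y ∉ A n) (m := fun n => n + n₀), map_add_atTop_eq_nat] at hy
  exact hy

lemma ae_volume_Bset_le {K : ℝ} (hK : 0 < K) :
    ∀ᵐ y ∂(volume.restrict (Ico (0:ℝ) 1)), ∀ β : ℝ, β < 2 → ∀ᶠ n : ℕ in atTop,
      volume (Bset (K / 2 ^ n) y) ≤ tp (-(β * n)) := by
  have h (k : ℕ) : ∀ᵐ y ∂(volume.restrict (Ico (0:ℝ) 1)), ∀ᶠ n : ℕ in atTop,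
      volume (Bset (K / 2 ^ n) y) ≤ tp (-((2 - 1 / ((k:ℝ) + 1)) * n)) := by
    have hk : 2 - 1 / ((k:ℝ) + 1) < 2 := by
      have : 0 < 1 / ((k:ℝ) + 1) := by positivity
      linarith
    filter_upwards [(smallBall hk K hK).ae_eventually_notMem] with y hy
    filter_upwards [hy] with n hn
    simpa using hn
  filter_upwards [ae_all_iff.2 h] with y hy β hβ
  obtain ⟨k, hk⟩ := exists_nat_one_div_lt (sub_pos.2 hβ)
  filter_upwards [hy k] with n hn
  refine hn.trans (tp_mono ?_)
  gcongr
  linarith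

lemma two_le_liminf_log_div {u : ℕ → ℝ} {r : ℝ} (hlow : ∀ n : ℕ, (2:ℝ) ^ (-(2 * n + r)) ≤ u n)
    (hup : ∀ β : ℝ, β < 2 → ∀ᶠ n : ℕ in atTop, u n ≤ (2:ℝ) ^ (-(β * n))) :
    2 ≤ liminf (fun n : ℕ => Real.log (u n) / Real.log ((2:ℝ) ^ (-(n:ℝ)))) atTop := by
  have hlog : 0 < Real.log 2 := Real.log_pos one_lt_two
  have hu (n : ℕ) : 0 < u n := lt_of_lt_of_le (by positivity) (hlow n)
  have hbdd : IsBoundedUnder (· ≤ ·) atTop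
      (fun n : ℕ => Real.log (u n) / Real.log ((2:ℝ) ^ (-(n:ℝ)))) := by
    refine ⟨2 + |r|, eventually_map.2 ?_⟩
    filter_upwards [eventually_ge_atTop 1] with n hn
    have hn1 : (1:ℝ) ≤ n := by exact_mod_cast hn
    have h := Real.log_le_log (by positivity) (hlow n)
    rw [Real.log_rpow two_pos] at h ⊢
    rw [div_le_iff_of_neg (by nlinarith)]
    refine le_trans ?_ h
    have h1 := le_abs_self r
    have h2 := abs_nonneg r
    have : r ≤ |r| * n := by nlinarith
    nlinarith
  refine le_of_forall_lt fun β hβ => ?_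
  obtain ⟨β', h1, h2⟩ := exists_between hβ
  refine h1.trans_le (le_liminf_of_le hbdd.isCoboundedUnder_ge ?_)
  filter_upwards [eventually_ge_atTop 1, hup β' h2] with n hn hun
  have hn1 : (1:ℝ) ≤ n := by exact_mod_cast hn
  have h := Real.log_le_log (hu n) hun
  rw [Real.log_rpow two_pos] at h ⊢
  rw [le_div_iff_of_neg (by nlinarith)]
  refine h.trans (le_of_eq (by ring))

lemma two_rpow_neg_half (n : ℕ) : (2:ℝ) ^ (-(n:ℝ) / 2) = rr ^ n := by
  have h : rr = (2:ℝ) ^ (-(1 / 2) : ℝ) := by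
    rw [rr, Real.sqrt_eq_rpow, Real.rpow_neg zero_le_two]
  rw [h, ← Real.rpow_natCast, ← Real.rpow_mul zero_le_two]
  congr 1; ring

lemma repr_ee (x : ℝ) : Complex.orthonormalBasisOneI.repr (ee x) = cs (2 * π * x) := by
  ext i
  rw [Complex.orthonormalBasisOneI_repr_apply, ee, Complex.exp_ofReal_mul_I_re,
    Complex.exp_ofReal_mul_I_im]
  rfl

lemma Wfn_eq_repr (x : ℝ) : Wfn x = Complex.orthonormalBasisOneI.repr (wf x) := by
  have h := (summable_wf x).hasSum.mapL
    (Complex.orthonormalBasisOneI.repr.toContinuousLinearEquiv : ℂ →L[ℝ] E2)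
  unfold Wfn wf
  refine Eq.trans (tsum_congr fun n => ?_) h.tsum_eq
  simp only [ContinuousLinearEquiv.coe_coe, map_smul]
  rw [two_rpow_neg_half, mul_assoc (2 * π), ← repr_ee]
  rfl

lemma norm_Wfn_sub (x y : ℝ) : ‖Wfn x - Wfn y‖ = ‖wf x - wf y‖ := by
  rw [Wfn_eq_repr, Wfn_eq_repr, ← map_sub, LinearIsometryEquiv.norm_map]

lemma norm_cs' (t : ℝ) : ‖cs' t‖ = 1 := by
  rw [EuclideanSpace.norm_eq, Real.sqrt_eq_one]
  simp [cs']

lemma norm_Sfn_le (ξ x : ℝ) : ‖Sfn ξ x‖ ≤ 2 * π * 4 := by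
  unfold Sfn
  rw [norm_smul, norm_neg, Real.norm_of_nonneg (by positivity)]
  gcongr
  refine (tsum_of_norm_bounded summable_rr_pow.hasSum fun n => ?_).trans tsum_rr_pow_le
  have h := two_rpow_neg_half (n + 1)
  push_cast at h
  rw [norm_smul, norm_cs', mul_one, h, Real.norm_of_nonneg (pow_nonneg rr_pos.le _)]
  exact pow_le_pow_of_le_one rr_pos.le rr_lt_one.le (by omega)

lemma norm_integral_Sfn_le (ξ x v : ℝ) : ‖∫ t in x..v, Sfn ξ t‖ ≤ 2 * π * 4 * |v - x| :=
  intervalIntegral.norm_integral_le_of_norm_le_const fun t _ => norm_Sfn_le ξ t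

/-- The points of the dyadic interval of length `2 ^ (-n)` around `x` above which the graph of `Wfn`
is close to the stable fiber through `(x, Wfn x)`. -/
def fiberNhd (K : ℝ) (n : ℕ) (ξ x : ℝ) : Set ℝ :=
  {v : ℝ | v ∈ Ico ((⌊(2:ℝ) ^ n * x⌋ : ℝ) / 2 ^ n) (((⌊(2:ℝ) ^ n * x⌋ : ℝ) + 1) / 2 ^ n) ∧
    ‖Wfn v - Wfn x - ∫ t in x..v, Sfn ξ t‖ ≤ K * 2 ^ (-(n : ℝ))}

lemma self_mem_dyadic (n : ℕ) (x : ℝ) :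
    x ∈ Ico ((⌊(2:ℝ) ^ n * x⌋ : ℝ) / 2 ^ n) (((⌊(2:ℝ) ^ n * x⌋ : ℝ) + 1) / 2 ^ n) := by
  have h1 := Int.floor_le ((2:ℝ) ^ n * x)
  have h2 := Int.lt_floor_add_one ((2:ℝ) ^ n * x)
  constructor
  · rw [div_le_iff₀ (by positivity)]; linarith
  · rw [lt_div_iff₀ (by positivity)]; linarith

lemma mul_two_rpow_neg (K : ℝ) (n : ℕ) : K * 2 ^ (-(n:ℝ)) = K / 2 ^ n := by
  rw [Real.rpow_neg zero_le_two, Real.rpow_natCast]; rfl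

lemma fiberNhd_subset {K : ℝ} (hK : 0 < K) (n : ℕ) (ξ x : ℝ) :
    fiberNhd K n ξ x ⊆ Bset ((1 + K + 2 * π * 4) / 2 ^ n) x := by
  rintro v ⟨hv, h⟩
  rw [mul_two_rpow_neg] at h
  have hx := self_mem_dyadic n x
  have hπ := Real.pi_pos
  have h1 : |v - x| ≤ 1 / 2 ^ n := by
    have := hv.1; have := hv.2; have := hx.1; have := hx.2
    rw [add_div] at *
    rw [abs_le]; constructor <;> linarith
  refine ⟨h1.trans (by gcongr; nlinarith), ?_⟩
  rw [← norm_Wfn_sub]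
  have h2 := norm_integral_Sfn_le ξ x v
  have h3 := norm_add_le (Wfn v - Wfn x - ∫ t in x..v, Sfn ξ t) (∫ t in x..v, Sfn ξ t)
  rw [sub_add_cancel] at h3
  have h4 : 2 * π * 4 * |v - x| ≤ 2 * π * 4 * (1 / 2 ^ n) := by gcongr
  have h5 : 0 ≤ 1 / (2:ℝ) ^ n := by positivity
  calc _ ≤ K / 2 ^ n + 2 * π * 4 * (1 / 2 ^ n) := by linarith
    _ ≤ 1 / 2 ^ n + K / 2 ^ n + 2 * π * 4 * (1 / 2 ^ n) := by linarith
    _ = _ := by ring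

lemma le_volume_fiberNhd {K : ℝ} {r : ℕ} (hr : 24 + 2 * π * 4 ≤ K * 2 ^ r) (n : ℕ) (ξ x : ℝ) :
    tp (-(2 * n + 2 * r)) ≤ volume (fiberNhd K n ξ x) := by
  have hx := self_mem_dyadic n x
  have hπ := Real.pi_pos
  set L := (⌊(2:ℝ) ^ n * x⌋ : ℝ) / 2 ^ n with hL
  set R := ((⌊(2:ℝ) ^ n * x⌋ : ℝ) + 1) / 2 ^ n with hR
  set δ : ℝ := ((2:ℝ) ^ (2 * (n + r)))⁻¹ with hδ
  have hδ0 : 0 < δ := by positivity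
  have hLR : R - L = 1 / 2 ^ n := by rw [hR, hL]; ring
  have hδn : δ ≤ R - L := by
    rw [hLR, hδ, ← one_div]
    exact one_div_le_one_div_of_le (by positivity) (pow_le_pow_right₀ one_le_two (by omega))
  have e : tp (-(2 * n + 2 * r)) = ENNReal.ofReal δ := by
    rw [tp, Real.rpow_neg zero_le_two, hδ, ← Real.rpow_natCast]; congr 3; push_cast; ring
  have hsub : Ico (max L (x - δ)) (min R (x + δ)) ⊆ fiberNhd K n ξ x := by
    intro v hv
    rw [mem_Ico, max_le_iff, lt_min_iff] at hv
    obtain ⟨⟨h1, h2⟩, h3, h4⟩ := hv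
    refine ⟨⟨h1, h3⟩, ?_⟩
    have h5 : |v - x| ≤ δ := by rw [abs_le]; constructor <;> linarith
    rw [mul_two_rpow_neg]
    refine (norm_sub_le _ _).trans ?_
    rw [norm_Wfn_sub]
    have h6 := norm_wf_sub_le (n + r) v x
    have h7 := norm_integral_Sfn_le ξ x v
    have h8 : (2:ℝ) ^ (2 * (n + r)) * |v - x| ≤ 1 := by
      calc _ ≤ (2:ℝ) ^ (2 * (n + r)) * δ := by gcongr
        _ = 1 := mul_inv_cancel₀ (by positivity)
    have h9 : δ ≤ 1 / 2 ^ (n + r) := by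
      rw [hδ, ← one_div]
      exact one_div_le_one_div_of_le (by positivity) (pow_le_pow_right₀ one_le_two (by omega))
    calc _ ≤ (16 * (2 ^ (2 * (n + r)) * |v - x|) + 8) / 2 ^ (n + r) + 2 * π * 4 * |v - x| :=
          add_le_add h6 h7
      _ ≤ (16 * 1 + 8) / 2 ^ (n + r) + 2 * π * 4 * (1 / 2 ^ (n + r)) := by
          gcongr
          exact h5.trans h9
      _ = (24 + 2 * π * 4) / 2 ^ (n + r) := by ring
      _ ≤ K * 2 ^ r / 2 ^ (n + r) := by gcongr
      _ = K / 2 ^ n := by rw [pow_add]; field_simp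
  refine le_trans ?_ (measure_mono hsub)
  rw [Real.volume_Ico, e]
  refine ENNReal.ofReal_le_ofReal ?_
  have := hx.1; have := hx.2
  rcases max_cases L (x - δ) with h | h <;> rcases min_cases R (x + δ) with h' | h' <;> linarith

/-- For every `K > 0` and `λ²`-a.e. `(ξ,x) ∈ [0,1)²`, the local dimension estimate
`liminf_N log λ({v ∈ I_N(x) : |W(v) - W(x) - ∫_x^v S(ξ,t) dt| ≤ K 2^{-N}}) / log 2^{-N} ≥ 2`
holds, where `I_N(x)` is the dyadic interval of length `2^{-N}` containing `x`. -/
theorem liminf_local_dimension_ge_two :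
    ∀ K : ℝ, 0 < K →
      ∀ᵐ p ∂((volume : Measure (ℝ × ℝ)).restrict usq),
        2 ≤ Filter.liminf (fun N : ℕ =>
          Real.log (volume {v : ℝ | v ∈ Ico ((⌊(2:ℝ) ^ N * p.2⌋ : ℝ) / 2 ^ N)
                (((⌊(2:ℝ) ^ N * p.2⌋ : ℝ) + 1) / 2 ^ N) ∧
              ‖Wfn v - Wfn p.2 - ∫ t in p.2..v, Sfn p.1 t‖ ≤ K * 2 ^ (-(N : ℝ))}).toReal
            / Real.log ((2 : ℝ) ^ (-(N : ℝ)))) Filter.atTop := by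
  intro K hK
  have hπ := Real.pi_pos
  have hK' : 0 < 1 + K + 2 * π * 4 := by positivity
  obtain ⟨r, hr⟩ := pow_unbounded_of_one_lt ((24 + 2 * π * 4) / K) (one_lt_two (α := ℝ))
  rw [div_lt_iff₀' hK] at hr
  rw [usq, Measure.volume_eq_prod, ← Measure.prod_restrict]
  filter_upwards [Measure.quasiMeasurePreserving_snd.ae (ae_volume_Bset_le hK')] with p hp
  have hfin (n : ℕ) : volume (fiberNhd K n p.1 p.2) ≠ ∞ :=
    ne_top_of_le_ne_top (volume_Bset_ne_top _ _) (measure_mono (fiberNhd_subset hK n p.1 p.2))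
  refine two_le_liminf_log_div (u := fun n => (volume (fiberNhd K n p.1 p.2)).toReal)
    (r := 2 * r) (fun n => ?_) fun β hβ => ?_
  · exact (ENNReal.ofReal_le_iff_le_toReal (hfin n)).1 (le_volume_fiberNhd hr.le n p.1 p.2)
  · filter_upwards [hp β hβ] with n hn
    exact ENNReal.toReal_le_of_le_ofReal (by positivity)
      ((measure_mono (fiberNhd_subset hK n p.1 p.2)).trans hn)

end
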